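/- There exists an absolute constant C > 0 with the following property. Let f(x) = a·x^α + b·x^β + c·x^γ be a nonzero polynomial with integer coefficients a, b, c and natural number exponents α < β < γ, and let s ≥ 1 be a real number such that log max(|a|, |b|, |c|, α, β, γ) ≤ s. Then any two distinct real roots x₁, x₂ of f satisfy |x₁ − x₂| ≥ exp(−C·s³). -/

import Mathlib

/-- A positive radical of prime exponent that is not rational has trace zero. -/
lemma tri_trace_zero {K : Type*} [Field K] [Algebra ℚ K] [FiniteDimensional ℚ K] (φ : K →ₐ[ℚ] ℝ)
    (y : K) (hpos : 0 < φ y) (t : ℚ) (hy : y ^ 7 = algebraMap ℚ K t)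
    (hr : ∀ ρ : ℚ, 0 < ρ → ρ ^ 7 ≠ t) : Algebra.trace ℚ K y = 0 := by
  have hφ : (φ y) ^ 7 = (t : ℝ) := by
    rw [← map_pow, hy]; simp
  have hir : Irreducible (Polynomial.X ^ 7 - Polynomial.C t : Polynomial ℚ) := by
    apply X_pow_sub_C_irreducible_of_prime (by norm_num)
    intro b hb
    refine hr b ?_ hb
    have : (b : ℝ) ^ 7 = (φ y) ^ 7 := by rw [hφ, ← hb]; push_cast; rfl
    have h2 : (b : ℝ) = φ y := (Odd.strictMono_pow (by decide : Odd 7)).injective this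
    have : (0 : ℝ) < b := by rw [h2]; exact hpos
    exact_mod_cast this
  have hmin : minpoly ℚ y = Polynomial.X ^ 7 - Polynomial.C t := by
    symm
    apply minpoly.eq_of_irreducible_of_monic hir
    · simp [hy]
    · exact Polynomial.monic_X_pow_sub_C t (by norm_num)
  rw [trace_eq_finrank_mul_minpoly_nextCoeff, hmin]
  have : (Polynomial.X ^ 7 - Polynomial.C t : Polynomial ℚ).nextCoeff = 0 := by
    rw [Polynomial.nextCoeff_of_natDegree_pos]
    · rw [Polynomial.natDegree_X_pow_sub_C]
      simp [Polynomial.coeff_X_pow, Polynomial.coeff_C]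
    · rw [Polynomial.natDegree_X_pow_sub_C]; norm_num
  rw [this]; simp

/-- Seventh-power independence of two positive rationals. -/
def TriIndep (x1 x2 : ℚ) : Prop :=
  ∀ a b : ℤ, ∀ ρ : ℚ, 0 < ρ → x1 ^ a * x2 ^ b = ρ ^ 7 → (7 : ℤ) ∣ a ∧ (7 : ℤ) ∣ b

lemma tri_radical_indep (x1 x2 : ℚ) (hx1 : 0 < x1) (hx2 : 0 < x2) (hind : TriIndep x1 x2)
    (r1 r2 : ℝ) (h1 : 0 < r1) (h2 : 0 < r2) (e1 : r1 ^ 7 = x1) (e2 : r2 ^ 7 = x2)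
    (c : Fin 7 × Fin 7 → ℚ)
    (hc : ∑ k, (c k : ℝ) * (r1 ^ (k.1 : ℕ) * r2 ^ (k.2 : ℕ)) = 0) : c = 0 := by
  have i1 : IsIntegral ℚ r1 := IsIntegral.of_pow (n := 7) (by norm_num) (by
    rw [e1]; exact isIntegral_algebraMap (R := ℚ) (x := x1))
  have i2 : IsIntegral ℚ r2 := IsIntegral.of_pow (n := 7) (by norm_num) (by
    rw [e2]; exact isIntegral_algebraMap (R := ℚ) (x := x2))
  let K := IntermediateField.adjoin ℚ ({r1, r2} : Set ℝ)
  have : FiniteDimensional ℚ K := by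
    apply IntermediateField.finiteDimensional_adjoin
    intro x hx
    rcases hx with rfl | hx
    · exact i1
    · rw [Set.mem_singleton_iff] at hx; rw [hx]; exact i2
  let R1 : K := ⟨r1, IntermediateField.subset_adjoin _ _ (by simp)⟩
  let R2 : K := ⟨r2, IntermediateField.subset_adjoin _ _ (by simp)⟩
  have hR1 : K.val R1 = r1 := rfl
  have hR2 : K.val R2 = r2 := rfl
  have E1 : R1 ^ 7 = algebraMap ℚ K x1 := by
    refine K.val.injective (show K.val _ = K.val _ from ?_)
    rw [map_pow, hR1, e1]; simp
  have E2 : R2 ^ 7 = algebraMap ℚ K x2 := by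
    refine K.val.injective (show K.val _ = K.val _ from ?_)
    rw [map_pow, hR2, e2]; simp
  have n1 : R1 ≠ 0 := fun h => h1.ne' (by rw [← hR1, h]; simp)
  have n2 : R2 ≠ 0 := fun h => h2.ne' (by rw [← hR2, h]; simp)
  have hK : ∑ k, algebraMap ℚ K (c k) * (R1 ^ (k.1 : ℕ) * R2 ^ (k.2 : ℕ)) = 0 := by
    refine K.val.injective (show K.val _ = K.val _ from ?_)
    rw [map_sum, map_zero, ← hc]
    refine Finset.sum_congr rfl fun k _ => ?_
    rw [map_mul, map_mul, map_pow, map_pow, hR1, hR2]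
    simp
  funext k0
  have hK2 : ∑ k : Fin 7 × Fin 7,
      (c k) • (R1 ^ ((k.1 : ℤ) - (k0.1 : ℤ)) * R2 ^ ((k.2 : ℤ) - (k0.2 : ℤ))) = 0 := by
    have : ∑ k : Fin 7 × Fin 7,
      (c k) • (R1 ^ ((k.1 : ℤ) - (k0.1 : ℤ)) * R2 ^ ((k.2 : ℤ) - (k0.2 : ℤ)))
       = (∑ k, algebraMap ℚ K (c k) * (R1 ^ (k.1 : ℕ) * R2 ^ (k.2 : ℕ))) *
         (R1 ^ (k0.1 : ℕ) * R2 ^ (k0.2 : ℕ))⁻¹ := by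
      rw [Finset.sum_mul]
      refine Finset.sum_congr rfl fun k _ => ?_
      rw [Algebra.smul_def, zpow_sub₀ n1, zpow_sub₀ n2]
      simp only [zpow_natCast]
      field_simp
    rw [this, hK, zero_mul]
  have htr := congrArg (Algebra.trace ℚ K) hK2
  rw [map_sum, map_zero, Finset.sum_eq_single k0] at htr
  · simp only [sub_self, zpow_zero, mul_one, map_smul] at htr
    rw [show (1 : K) = algebraMap ℚ K 1 by simp, Algebra.trace_algebraMap] at htr
    have hpos := Module.finrank_pos (R := ℚ) (M := K)
    simp only [nsmul_eq_mul, mul_one, smul_eq_mul, mul_eq_zero] at htr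
    rcases htr with h | h
    · exact h
    · have : Module.finrank ℚ K = 0 := by exact_mod_cast h
      omega
  · intro k _ hk
    refine (map_smul _ _ _).trans ?_
    refine (congrArg (fun y => c k • y) (tri_trace_zero (K := K) K.val _ ?_ (x1 ^ ((k.1 : ℤ) - (k0.1 : ℤ)) * x2 ^ ((k.2 : ℤ) - (k0.2 : ℤ))) ?_ ?_)).trans (smul_zero _)
    · rw [map_mul, map_zpow₀, map_zpow₀, hR1, hR2]; positivity
    · rw [mul_pow, map_mul, map_zpow₀, map_zpow₀]
      have Z : ∀ (y t : K) (n : ℤ), y ^ 7 = t → (y ^ n) ^ 7 = t ^ n := by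
        rintro y t n rfl
        simp only [← zpow_natCast, ← zpow_mul]
        simp only [mul_comm]
      exact congrArg₂ _ (Z _ _ _ E1) (Z _ _ _ E2)
    · intro ρ hρ he
      obtain ⟨d1, d2⟩ := hind _ _ ρ hρ he.symm
      apply hk
      have a1 := k.1.isLt
      have a2 := k0.1.isLt
      have a3 := k.2.isLt
      have a4 := k0.2.isLt
      ext <;> omega
  · simp

/-- Liouville type inequality for integer combinations of the radicals. -/
lemma tri_liouville {ι : Type*} [Fintype ι] [DecidableEq ι] [AddCommGroup ι]
    (r : ι → ℝ) (hli : ∀ c : ι → ℚ, ∑ k, (c k : ℝ) * r k = 0 → c = 0)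
    (r0 : r 0 = 1) (V : ℝ) (hV : 0 ≤ V) (a : ι → ι → ℤ)
    (hmul : ∀ k k', V * (r k * r k') = a k k' * r (k + k'))
    (H A R : ℝ) (hH : ∀ k k', |(a k k' : ℝ)| ≤ H) (hR : ∀ k, |r k| ≤ R)
    (c : ι → ℤ) (hA : ∀ k, |(c k : ℝ)| ≤ A) (hAH : 1 ≤ A * H) (hVn : V ≠ 0) (hc : c ≠ 0) :
    1 ≤ (Fintype.card ι) * ((Fintype.card ι).factorial * (A * H) ^ (Fintype.card ι)) * (V * R)
      * |∑ k, (c k : ℝ) * r k| := by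
  set ξ := ∑ k, (c k : ℝ) * r k with hξ
  have hξ0 : ξ ≠ 0 := by
    intro h
    apply hc
    have := hli (fun k => (c k : ℚ)) (by rw [← h, hξ]; simp)
    funext k
    have := congrFun this k
    simpa using this
  let M : Matrix ι ι ℤ := fun k' j => c (j - k') * a (j - k') k'
  have hM : ∀ k', ∑ j, (M k' j : ℝ) * r j = V * ξ * r k' := by
    intro k'
    rw [hξ]
    simp only [M]
    rw [← Equiv.sum_comp (Equiv.addRight k')]
    simp only [Equiv.coe_addRight, add_sub_cancel_right]
    rw [Finset.mul_sum, Finset.sum_mul]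
    refine Finset.sum_congr rfl fun k _ => ?_
    push_cast
    rw [mul_assoc, ← hmul]; ring
  have hMb : ∀ i j, |(M i j : ℝ)| ≤ A * H := by
    intro i j
    simp only [M]; push_cast
    rw [abs_mul]
    exact mul_le_mul (hA _) (hH _ _) (abs_nonneg _) ((abs_nonneg _).trans (hA (j - i)))
  have hdet : M.det ≠ 0 := by
    intro h
    obtain ⟨v, hv0, hv⟩ := Matrix.exists_vecMul_eq_zero_iff.mpr h
    apply hv0
    have hs : (∑ k, (v k : ℝ) * r k) * (V * ξ) = 0 := by
      have : (∑ k, (v k : ℝ) * r k) * (V * ξ) = ∑ j, ((Matrix.vecMul v M j : ℤ) : ℝ) * r j := by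
        rw [Finset.sum_mul]
        simp only [Matrix.vecMul, dotProduct]
        push_cast
        simp only [Finset.sum_mul]
        rw [Finset.sum_comm]
        refine Finset.sum_congr rfl fun k _ => ?_
        rw [mul_assoc, mul_comm (r k), ← hM k, Finset.mul_sum]
        refine Finset.sum_congr rfl fun j _ => by ring
      rw [this, hv]; simp
    have hs2 : ∑ k, (v k : ℝ) * r k = 0 := by
      rcases mul_eq_zero.mp hs with h | h
      · exact h
      · exact absurd h (mul_ne_zero hVn hξ0)
    have := hli (fun k => (v k : ℚ)) (by rw [← hs2]; simp)
    funext k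
    have := congrFun this k
    simpa using this
  let MR : Matrix ι ι ℝ := M.map (Int.cast : ℤ → ℝ)
  have hdetR : MR.det = (M.det : ℝ) := by
    have := RingHom.map_det (Int.castRingHom ℝ) M
    simpa [MR] using this.symm
  have h1 : (1 : ℝ) ≤ |MR.det| := by
    rw [hdetR, ← Int.cast_abs]
    exact_mod_cast Int.one_le_abs hdet
  have hmv : MR.mulVec r = (V * ξ) • r := by
    funext k
    simp only [Matrix.mulVec, dotProduct, MR, Matrix.map_apply, Pi.smul_apply, smul_eq_mul]
    exact hM k
  have hadj : MR.det = V * ξ * ∑ k, MR.adjugate 0 k * r k := by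
    have h2 : MR.adjugate.mulVec (MR.mulVec r) = MR.det • r := by
      rw [Matrix.mulVec_mulVec, Matrix.adjugate_mul, Matrix.smul_mulVec, Matrix.one_mulVec]
    rw [hmv, Matrix.mulVec_smul] at h2
    have h3 := congrFun h2 0
    simp only [Pi.smul_apply, smul_eq_mul, r0, mul_one, Matrix.mulVec, dotProduct] at h3
    exact h3.symm
  have hadjb : ∀ k, |MR.adjugate 0 k| ≤ (Fintype.card ι).factorial * (A * H) ^ (Fintype.card ι) := by
    intro k
    rw [Matrix.adjugate_apply]
    have := Matrix.det_le (A := MR.updateRow k (Pi.single 0 1)) (abv := AbsoluteValue.abs)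
      (x := A * H) (by
        intro i j
        rw [Matrix.updateRow_apply]
        split_ifs with h
        · simp only [AbsoluteValue.abs_apply, Pi.single_apply]
          split_ifs
          · simpa using hAH
          · simpa using le_trans zero_le_one hAH
        · exact hMb i j)
    simpa [nsmul_eq_mul] using this
  have hR0 : 0 ≤ R := (abs_nonneg _).trans (hR 0)
  calc (1 : ℝ) ≤ |MR.det| := h1
    _ = V * |ξ| * |∑ k, MR.adjugate 0 k * r k| := by
        rw [hadj, abs_mul, abs_mul, abs_of_nonneg hV]
    _ ≤ V * |ξ| * ∑ k : ι, ((Fintype.card ι).factorial * (A * H) ^ (Fintype.card ι) * R) := by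
        gcongr
        refine (Finset.abs_sum_le_sum_abs _ _).trans (Finset.sum_le_sum fun k _ => ?_)
        rw [abs_mul]
        exact mul_le_mul (hadjb k) (hR k) (abs_nonneg _) (by positivity)
    _ = _ := by
        rw [Finset.sum_const, Finset.card_univ, nsmul_eq_mul]; ring


lemma tri_order_mul (f g : ℂ → ℂ) (a : ℂ) (m : ℕ) (hf : Differentiable ℂ f) (hg : Differentiable ℂ g)
    (h : (m : ℕ∞) ≤ analyticOrderAt f a) : (m : ℕ∞) ≤ analyticOrderAt (f * g) a := by
  rw [analyticOrderAt_mul (hf.analyticAt a) (hg.analyticAt a)]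
  exact h.trans le_self_add

lemma tri_order_zero (g : ℂ → ℂ) (a : ℂ) (hg : Differentiable ℂ g) (h0 : g a ≠ 0) :
    analyticOrderAt g a = 0 := by
  exact (hg.analyticAt a).analyticOrderAt_eq_zero.mpr h0

lemma tri_diff_dslope (f : ℂ → ℂ) (a : ℂ) (hf : Differentiable ℂ f) : Differentiable ℂ (dslope f a) := by
  have := (Complex.differentiableOn_dslope (s := Set.univ) (c := a) (f := f) Filter.univ_mem).mpr
    hf.differentiableOn
  exact differentiableOn_univ.mp this

lemma tri_factor_one (m : ℕ) : ∀ (f : ℂ → ℂ) (a : ℂ), Differentiable ℂ f →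
    (m : ℕ∞) ≤ analyticOrderAt f a →
    ∃ g : ℂ → ℂ, Differentiable ℂ g ∧ f = (fun z => (z - a) ^ m) * g := by
  induction m with
  | zero => intro f a hf _; exact ⟨f, hf, by funext z; simp⟩
  | succ m ih =>
    intro f a hf h
    have h0 : f a = 0 := by
      by_contra h0
      rw [tri_order_zero f a hf h0] at h
      simp at h
    have e : f = (fun z => z - a) * dslope f a := by
      funext z
      have := sub_smul_dslope f a z
      simp only [smul_eq_mul, h0, sub_zero] at this
      simp [this]
    have hd := tri_diff_dslope f a hf
    have ho : analyticOrderAt f a = 1 + analyticOrderAt (dslope f a) a := by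
      conv_lhs => rw [e]
      have hlin : AnalyticAt ℂ (fun z : ℂ => z - a) a := by fun_prop
      rw [analyticOrderAt_mul hlin (hd.analyticAt a)]
      congr 1
      have : ((1 : ℕ) : ℕ∞) = analyticOrderAt (fun z : ℂ => z - a) a := by
        symm
        rw [hlin.analyticOrderAt_eq_natCast]
        exact ⟨fun _ => 1, by fun_prop, by simp, by simp⟩
      rw [← this]; simp
    obtain ⟨g, hg, e2⟩ := ih (dslope f a) a hd (by
      rw [ho, add_comm 1] at h
      push_cast at h
      exact (ENat.add_le_add_iff_right (by simp)).mp h)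
    refine ⟨g, hg, ?_⟩
    rw [e, e2]
    funext z
    simp only [Pi.mul_apply]; ring

lemma tri_factor (m : ℕ) (S : Finset ℂ) : ∀ (f : ℂ → ℂ), Differentiable ℂ f →
    (∀ a ∈ S, (m : ℕ∞) ≤ analyticOrderAt f a) →
    ∃ g : ℂ → ℂ, Differentiable ℂ g ∧ ∀ z, f z = (∏ a ∈ S, (z - a) ^ m) * g z := by
  induction S using Finset.induction_on with
  | empty => intro f hf _; exact ⟨f, hf, by simp⟩
  | insert a S ha ih =>
    intro f hf h
    obtain ⟨g, hg, e⟩ := tri_factor_one m f a hf (h a (by simp))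
    obtain ⟨g', hg', e'⟩ := ih g hg (by
      intro b hb
      have hb' := h b (by simp [hb])
      have hdp : Differentiable ℂ (fun z : ℂ => (z - a) ^ m) := by fun_prop
      rw [e, analyticOrderAt_mul (hdp.analyticAt b) (hg.analyticAt b),
        tri_order_zero _ b hdp, zero_add] at hb'
      · exact hb'
      · apply pow_ne_zero
        rw [sub_ne_zero]
        rintro rfl
        exact ha hb)
    refine ⟨g', hg', fun z => ?_⟩
    rw [Finset.prod_insert ha, mul_assoc, ← e', e]; rfl

/-- the smoothed characteristic polynomial -/
noncomputable def triB (m : ℕ) (y : ℂ) : ℂ :=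
  ∑ k ∈ Finset.Ico m (2 * m), y ^ k * (1 - y) ^ (2 * m - 1 - k) * ((2 * m - 1).choose k : ℂ)

lemma triB_low (m : ℕ) : ∃ g : ℂ → ℂ, Differentiable ℂ g ∧ ∀ y, triB m y = y ^ m * g y := by
  refine ⟨fun y => ∑ k ∈ Finset.Ico m (2 * m), y ^ (k - m) * (1 - y) ^ (2 * m - 1 - k) *
    ((2 * m - 1).choose k : ℂ), by fun_prop, fun y => ?_⟩
  rw [triB, Finset.mul_sum]
  refine Finset.sum_congr rfl fun k hk => ?_
  rw [Finset.mem_Ico] at hk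
  rw [← mul_assoc, ← mul_assoc, ← pow_add, Nat.add_sub_cancel' hk.1]

lemma triB_high (m : ℕ) (hm : 1 ≤ m) :
    ∃ g : ℂ → ℂ, Differentiable ℂ g ∧ ∀ y, triB m y - 1 = (1 - y) ^ m * g y := by
  refine ⟨fun y => - ∑ k ∈ Finset.range m, y ^ k * (1 - y) ^ (m - 1 - k) *
    ((2 * m - 1).choose k : ℂ), by fun_prop, fun y => ?_⟩
  have h1 : (1 : ℂ) = ∑ k ∈ Finset.range (2 * m), y ^ k * (1 - y) ^ (2 * m - 1 - k) *
      ((2 * m - 1).choose k : ℂ) := by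
    have := add_pow y (1 - y) (2 * m - 1)
    rw [show 2 * m - 1 + 1 = 2 * m by omega] at this
    rw [← this]; simp
  rw [← Finset.sum_range_add_sum_Ico _ (show m ≤ 2 * m by omega)] at h1
  have h2 : triB m y - 1 = - ∑ k ∈ Finset.range m, y ^ k * (1 - y) ^ (2 * m - 1 - k) *
      ((2 * m - 1).choose k : ℂ) := by
    rw [triB]; linear_combination -h1
  rw [h2, mul_neg, Finset.mul_sum]
  congr 1
  refine Finset.sum_congr rfl fun k hk => ?_
  rw [Finset.mem_range] at hk
  rw [show 2 * m - 1 - k = m + (m - 1 - k) by omega, pow_add]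
  ring

lemma triB_norm (m : ℕ) (hm : 1 ≤ m) (y : ℂ) (Y : ℝ) (hY : 1 ≤ Y) (hy : ‖y‖ ≤ Y) :
    ‖triB m y‖ ≤ (3 * Y) ^ (2 * m) := by
  have h1 : ‖triB m y‖ ≤ ∑ k ∈ Finset.range (2 * m), ‖y‖ ^ k * ‖1 - y‖ ^ (2 * m - 1 - k) *
      ((2 * m - 1).choose k : ℝ) := by
    rw [triB]
    refine (norm_sum_le _ _).trans ?_
    have : ∀ k, ‖y ^ k * (1 - y) ^ (2 * m - 1 - k) * ((2 * m - 1).choose k : ℂ)‖ =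
        ‖y‖ ^ k * ‖1 - y‖ ^ (2 * m - 1 - k) * ((2 * m - 1).choose k : ℝ) := by
      intro k; simp
    simp only [this]
    apply Finset.sum_le_sum_of_subset_of_nonneg
    · intro k hk; simp at hk ⊢; omega
    · intros; positivity
  have h2 := add_pow ‖y‖ ‖1 - y‖ (2 * m - 1)
  rw [show 2 * m - 1 + 1 = 2 * m by omega] at h2
  rw [← h2] at h1
  have h3 : ‖1 - y‖ ≤ 1 + ‖y‖ := by simpa using norm_sub_le (1 : ℂ) y
  calc ‖triB m y‖ ≤ _ := h1
    _ ≤ (3 * Y) ^ (2 * m - 1) := by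
        gcongr; linarith
    _ ≤ _ := by
        apply pow_le_pow_right₀ <;> [linarith; omega]

/-- exponential interpolation function at the nodes `7 * σ` -/
noncomputable def triEll (s σ : ℕ) (z : ℂ) : ℂ :=
  (s : ℂ)⁻¹ * ∑ k ∈ Finset.range s, Complex.exp (k * (2 * Real.pi * Complex.I * ((z / 7 - σ) / s)))

lemma triEll_diff (s σ : ℕ) : Differentiable ℂ (triEll s σ) := by
  unfold triEll
  fun_prop

lemma triEll_self (s σ : ℕ) (hs : 1 ≤ s) : triEll s σ (7 * σ) = 1 := by
  have : (s : ℂ) ≠ 0 := by exact_mod_cast (by omega : s ≠ 0)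
  simp [triEll, this]

lemma triEll_other (s σ τ : ℕ) (hs : σ < s) (ht : τ < s) (hne : σ ≠ τ) :
    triEll s σ (7 * τ) = 0 := by
  have hs0 : (s : ℂ) ≠ 0 := by exact_mod_cast (by omega : s ≠ 0)
  set w := Complex.exp (2 * Real.pi * Complex.I * (((τ : ℂ) - σ) / s)) with hw
  have h1 : triEll s σ (7 * τ) = (s : ℂ)⁻¹ * ∑ k ∈ Finset.range s, w ^ k := by
    rw [triEll]
    congr 1
    refine Finset.sum_congr rfl fun k _ => ?_
    rw [hw, ← Complex.exp_nat_mul]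
    congr 3
    field_simp
  have hws : w ^ s = 1 := by
    rw [hw, ← Complex.exp_nat_mul, Complex.exp_eq_one_iff]
    refine ⟨(τ : ℤ) - σ, ?_⟩
    push_cast
    field_simp
  have hw1 : w ≠ 1 := by
    intro h
    rw [hw, Complex.exp_eq_one_iff] at h
    obtain ⟨n, hn⟩ := h
    have hpi : (2 * Real.pi * Complex.I : ℂ) ≠ 0 := Complex.two_pi_I_ne_zero
    rw [mul_comm (n : ℂ)] at hn
    have h2 := mul_left_cancel₀ hpi hn
    rw [div_eq_iff hs0] at h2
    have h3 : (τ : ℤ) - σ = n * s := by exact_mod_cast h2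
    have h4 : n = 0 := by
      by_contra hn0
      have : 1 ≤ |n| := Int.one_le_abs hn0
      have h5 : |(τ : ℤ) - σ| < s := by rw [abs_lt]; omega
      rw [h3, abs_mul] at h5
      have : |(s : ℤ)| = s := abs_of_nonneg (by omega)
      rw [this] at h5
      nlinarith
    rw [h4] at h3
    omega
  rw [h1]
  have := mul_geom_sum w s
  rw [hws, sub_self, mul_eq_zero] at this
  rcases this with h | h
  · exact absurd (sub_eq_zero.mp h) hw1
  · rw [h, mul_zero]

lemma triEll_norm (s σ : ℕ) (hs : σ < s) (z : ℂ) (ρ : ℝ) (hz : ‖z‖ ≤ ρ) :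
    ‖triEll s σ z‖ ≤ Real.exp (7 * (ρ + s)) := by
  have hs0 : (0 : ℝ) < s := by exact_mod_cast (by omega : 0 < s)
  have hρ : 0 ≤ ρ := (norm_nonneg _).trans hz
  have h1 : ∀ k ∈ Finset.range s,
      ‖Complex.exp (k * (2 * Real.pi * Complex.I * ((z / 7 - σ) / s)))‖ ≤ Real.exp (7 * (ρ + s)) := by
    intro k hk
    rw [Finset.mem_range] at hk
    refine (Complex.norm_exp_le_exp_norm _).trans (Real.exp_le_exp.mpr ?_)
    have hk' : (k : ℝ) ≤ s := by exact_mod_cast hk.le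
    have hσ' : (σ : ℝ) ≤ s := by exact_mod_cast hs.le
    have h2 : ‖z / 7 - σ‖ ≤ ρ + s := by
      refine (norm_sub_le _ _).trans ?_
      simp only [norm_div, Complex.norm_natCast, Complex.norm_ofNat]
      have := norm_nonneg z
      linarith
    simp only [norm_mul, norm_div, Complex.norm_natCast, Complex.norm_ofNat, Complex.norm_I,
      Complex.norm_real, Real.norm_eq_abs, abs_of_pos Real.pi_pos, mul_one]
    have h3 : (k : ℝ) * (2 * Real.pi * (‖z / 7 - σ‖ / s)) = (k / s) * (2 * Real.pi) * ‖z / 7 - σ‖ := by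
      field_simp
    rw [h3]
    have h4 : (k : ℝ) / s ≤ 1 := by rw [div_le_one hs0]; exact hk'
    have h5 : 2 * Real.pi ≤ 7 := by linarith [Real.pi_lt_d2]
    have h6 : (k / s : ℝ) * (2 * Real.pi) ≤ 1 * 7 := by
      apply mul_le_mul h4 h5 <;> positivity
    calc _ ≤ (1 * 7) * (ρ + s) := by gcongr
      _ = _ := by ring
  rw [triEll, norm_mul, norm_inv, Complex.norm_natCast, inv_mul_le_iff₀ hs0]
  refine (norm_sum_le _ _).trans ((Finset.sum_le_sum h1).trans ?_)
  simp

lemma tri_order_sum {ι : Type*} (S : Finset ι) (F : ι → ℂ → ℂ) (a : ℂ) (m : ℕ)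
    (h : ∀ i ∈ S, (m : ℕ∞) ≤ analyticOrderAt (F i) a) :
    (m : ℕ∞) ≤ analyticOrderAt (∑ i ∈ S, F i) a := by
  classical
  induction S using Finset.induction_on with
  | empty =>
    have : analyticOrderAt (0 : ℂ → ℂ) a = ⊤ := by
      rw [analyticOrderAt_eq_top]; simp
    simp [this]
  | insert i S hi ih =>
    rw [Finset.sum_insert hi]
    refine le_trans ?_ le_analyticOrderAt_add
    exact le_min (h i (by simp)) (ih fun j hj => h j (by simp [hj]))

/-- Schwarz type lemma for a function close to functions vanishing at nodes. -/
lemma tri_schwarz (s m : ℕ) (hs : 1 ≤ s) (hm : 1 ≤ m) (ρ : ℝ) (G : ℂ → ℂ) (Gs : ℕ → ℂ → ℂ)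
    (hG : Differentiable ℂ G) (hGs : ∀ σ < s, Differentiable ℂ (Gs σ))
    (ord : ∀ σ < s, (m : ℕ∞) ≤ analyticOrderAt (Gs σ) (7 * σ)) (B η : ℝ)
    (hB : ∀ z, ‖z‖ ≤ ρ → ‖G z‖ ≤ B)
    (hη : ∀ σ < s, ∀ z, ‖z‖ ≤ ρ → ‖Gs σ z - G z‖ ≤ η) (hρ : 7 * (s : ℝ) < ρ)
    (x : ℝ) (hx0 : 0 ≤ x) (hx1 : x ≤ 7 * s) :
    ‖G x‖ ≤ (B + s * (η * (3 * Real.exp (7 * (ρ + s))) ^ (2 * m))) *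
        (7 * s / (ρ - 7 * s)) ^ (m * s) + s * (η * (3 * Real.exp (7 * (ρ + s))) ^ (2 * m)) := by
  set K := (3 * Real.exp (7 * (ρ + s))) ^ (2 * m) with hK
  have hs0 : (0 : ℝ) < s := by exact_mod_cast hs
  have hρ0 : 0 < ρ := by linarith
  set χ : ℕ → ℂ → ℂ := fun σ z => triB m (triEll s σ z) with hχ
  have hBd : Differentiable ℂ (triB m) := by unfold triB; fun_prop
  have hχd : ∀ σ, Differentiable ℂ (χ σ) := fun σ => hBd.comp (triEll_diff s σ)
  have hχn : ∀ σ < s, ∀ z, ‖z‖ ≤ ρ → ‖χ σ z‖ ≤ K := fun σ hσ z hz =>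
    triB_norm m hm _ _ (Real.one_le_exp (by positivity)) (triEll_norm s σ hσ z ρ hz)
  set Err : ℂ → ℂ := ∑ σ ∈ Finset.range s, (Gs σ - G) * χ σ with hErr
  have hErrd : Differentiable ℂ Err := by
    rw [hErr]
    apply Differentiable.sum
    intro σ hσ
    exact ((hGs σ (Finset.mem_range.mp hσ)).sub hG).mul (hχd σ)
  have hErrn : ∀ z, ‖z‖ ≤ ρ → ‖Err z‖ ≤ s * (η * K) := by
    intro z hz
    rw [hErr, Finset.sum_apply]
    refine (norm_sum_le _ _).trans ?_
    have : ∀ σ ∈ Finset.range s, ‖((Gs σ - G) * χ σ) z‖ ≤ η * K := by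
      intro σ hσ
      rw [Finset.mem_range] at hσ
      rw [Pi.mul_apply, norm_mul]
      exact mul_le_mul (hη σ hσ z hz) (hχn σ hσ z hz) (norm_nonneg _)
        ((norm_nonneg _).trans (hη σ hσ z hz))
    refine (Finset.sum_le_sum this).trans ?_
    simp
  set F : ℂ → ℂ := G + Err with hF
  have hFd : Differentiable ℂ F := hG.add hErrd
  have hFn : ∀ z, ‖z‖ ≤ ρ → ‖F z‖ ≤ B + s * (η * K) := fun z hz =>
    (norm_add_le _ _).trans (add_le_add (hB z hz) (hErrn z hz))
  set S : Finset ℂ := (Finset.range s).image (fun σ : ℕ => (7 * σ : ℂ)) with hS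
  have hinj : Set.InjOn (fun σ : ℕ => (7 * σ : ℂ)) (Finset.range s) := by
    intro a _ b _ h
    simpa using h
  have hord : ∀ a ∈ S, (m : ℕ∞) ≤ analyticOrderAt F a := by
    intro a ha
    rw [hS, Finset.mem_image] at ha
    obtain ⟨τ, hτ, rfl⟩ := ha
    have hτ' := Finset.mem_range.mp hτ
    have e : F = Gs τ + (χ τ - 1) * (Gs τ - G) +
        ∑ σ ∈ (Finset.range s).erase τ, χ σ * (Gs σ - G) := by
      rw [hF, hErr, ← Finset.add_sum_erase _ _ hτ]
      simp only [mul_comm (χ _)]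
      ring
    rw [e]
    refine le_trans (le_min (le_trans (le_min (ord τ hτ') ?_) le_analyticOrderAt_add) ?_)
      le_analyticOrderAt_add
    · apply tri_order_mul _ _ _ _ ((hχd τ).sub (differentiable_const 1)) ((hGs τ hτ').sub hG)
      obtain ⟨g, hg, eg⟩ := triB_high m hm
      obtain ⟨h, hh, eh⟩ := tri_factor_one 1 (fun z => 1 - triEll s τ z) (7 * τ)
        ((differentiable_const 1).sub (triEll_diff s τ)) (by
          have : AnalyticAt ℂ (fun z => 1 - triEll s τ z) (7 * τ) :=
            (((differentiable_const (1 : ℂ)).sub (triEll_diff s τ)).analyticAt _)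
          simp only [Nat.cast_one]
          rw [Order.one_le_iff_ne_zero, this.analyticOrderAt_ne_zero, triEll_self s τ hs, sub_self])
      rw [natCast_le_analyticOrderAt (((hχd τ).sub (differentiable_const 1)).analyticAt _)]
      refine ⟨fun z => h z ^ m * g (triEll s τ z),
        ((hh.pow m).mul (hg.comp (triEll_diff s τ))).analyticAt _, Filter.Eventually.of_forall ?_⟩
      intro z
      have := congrFun eh z
      simp only [Pi.mul_apply, pow_one] at this
      simp only [Pi.sub_apply, Pi.one_apply, hχ, smul_eq_mul, eg, this]
      rw [mul_pow]; ring
    · apply tri_order_sum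
      intro σ hσ
      rw [Finset.mem_erase] at hσ
      have hσ' := Finset.mem_range.mp hσ.2
      apply tri_order_mul _ _ _ _ (hχd σ) ((hGs σ hσ').sub hG)
      obtain ⟨g, hg, eg⟩ := triB_low m
      obtain ⟨h, hh, eh⟩ := tri_factor_one 1 (triEll s σ) (7 * τ)
        (triEll_diff s σ) (by
          have : AnalyticAt ℂ (triEll s σ) (7 * τ) := (triEll_diff s σ).analyticAt _
          simp only [Nat.cast_one]
          rw [Order.one_le_iff_ne_zero, this.analyticOrderAt_ne_zero,
            triEll_other s σ τ hσ' hτ' hσ.1])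
      rw [natCast_le_analyticOrderAt ((hχd σ).analyticAt _)]
      refine ⟨fun z => h z ^ m * g (triEll s σ z),
        ((hh.pow m).mul (hg.comp (triEll_diff s σ))).analyticAt _, Filter.Eventually.of_forall ?_⟩
      intro z
      have := congrFun eh z
      simp only [Pi.mul_apply, pow_one] at this
      simp only [hχ, smul_eq_mul, eg]
      rw [this, mul_pow]; ring
  obtain ⟨g, hg, eg⟩ := tri_factor m S F hFd hord
  have hW : ∀ z, ∏ a ∈ S, (z - a) ^ m = ∏ σ ∈ Finset.range s, (z - 7 * σ) ^ m := by
    intro z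
    rw [hS, Finset.prod_image hinj]
  have hgap : 0 < ρ - 7 * s := by linarith
  have hgn : ∀ z ∈ Metric.closedBall (0 : ℂ) ρ, ‖g z‖ ≤ (B + s * (η * K)) / (ρ - 7 * s) ^ (m * s) := by
    intro z hz
    have hz' : z ∈ closure (Metric.ball (0 : ℂ) ρ) := by rwa [closure_ball _ hρ0.ne']
    refine Complex.norm_le_of_forall_mem_frontier_norm_le Metric.isBounded_ball
      hg.diffContOnCl ?_ hz'
    intro w hw
    rw [frontier_ball _ hρ0.ne', mem_sphere_zero_iff_norm] at hw
    rw [le_div_iff₀ (by positivity)]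
    refine le_trans ?_ (hFn w hw.le)
    rw [eg w, norm_mul, mul_comm, hW, norm_prod]
    gcongr
    calc (ρ - 7 * s) ^ (m * s) = ∏ σ ∈ Finset.range s, (ρ - 7 * s) ^ m := by
          rw [Finset.prod_const, Finset.card_range, pow_mul]
      _ ≤ _ := by
          apply Finset.prod_le_prod
          · intros; positivity
          · intro σ hσ
            rw [Finset.mem_range] at hσ
            have hσ' : (σ : ℝ) ≤ s := by exact_mod_cast hσ.le
            rw [norm_pow]
            gcongr
            have h1 := norm_sub_norm_le w (7 * σ)
            rw [hw] at h1
            simp only [norm_mul, Complex.norm_ofNat, Complex.norm_natCast] at h1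
            linarith
  have hxn : ‖(x : ℂ)‖ ≤ ρ := by
    rw [Complex.norm_real, Real.norm_eq_abs, abs_of_nonneg hx0]; linarith
  have hFx : ‖F x‖ ≤ (B + s * (η * K)) * (7 * s / (ρ - 7 * s)) ^ (m * s) := by
    rw [eg x, norm_mul, hW, norm_prod]
    have h1 : ∏ σ ∈ Finset.range s, ‖((x : ℂ) - 7 * σ) ^ m‖ ≤ (7 * s) ^ (m * s) := by
      calc _ ≤ ∏ σ ∈ Finset.range s, (7 * (s : ℝ)) ^ m := by
            apply Finset.prod_le_prod
            · intros; positivity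
            · intro σ hσ
              rw [Finset.mem_range] at hσ
              have hσ' : (σ : ℝ) ≤ s := by exact_mod_cast hσ.le
              rw [norm_pow]
              gcongr
              have : (x : ℂ) - 7 * σ = ((x - 7 * σ : ℝ) : ℂ) := by push_cast; ring
              rw [this, Complex.norm_real, Real.norm_eq_abs, abs_le]
              have : (0 : ℝ) ≤ σ := by positivity
              constructor <;> linarith
        _ = _ := by rw [Finset.prod_const, Finset.card_range, pow_mul]
    have h2 := hgn x (by rw [mem_closedBall_zero_iff]; exact hxn)
    calc _ ≤ (7 * (s : ℝ)) ^ (m * s) * ((B + s * (η * K)) / (ρ - 7 * s) ^ (m * s)) := by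
          gcongr
      _ = _ := by rw [div_pow]; ring
  have : G x = F x - Err x := by rw [hF]; simp
  rw [this]
  exact (norm_sub_le _ _).trans (add_le_add hFx (hErrn _ hxn))

lemma tri_order_phi {J : Type*} [Fintype J] (P : J → Polynomial ℂ) (p w c : J → ℂ) (θ : ℂ)
    (a : ℂ) (m t0 t1 : ℕ) (h0 : t0 ≤ m) (h1 : t1 ≤ m)
    (hv : ∀ u0 < 2 * m, ∀ u1 < 2 * m, ∑ j, p j * w j ^ u1 *
      (Polynomial.derivative^[u0] (P j)).eval a * (Complex.exp (θ * w j * a) * c j) = 0) :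
    (m : ℕ∞) ≤ analyticOrderAt (fun z => ∑ j, p j * w j ^ t1 *
      (Polynomial.derivative^[t0] (P j)).eval z * (Complex.exp (θ * w j * z) * c j)) a := by
  set Φ : ℕ → ℕ → ℂ → ℂ := fun t0 t1 z => ∑ j, p j * w j ^ t1 *
      (Polynomial.derivative^[t0] (P j)).eval z * (Complex.exp (θ * w j * z) * c j) with hΦ
  have hd : ∀ u0 u1, Differentiable ℂ (Φ u0 u1) := by
    intro u0 u1
    simp only [hΦ]
    fun_prop
  have hder : ∀ u0 u1, deriv (Φ u0 u1) = Φ (u0 + 1) u1 + θ • Φ u0 (u1 + 1) := by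
    intro u0 u1
    funext z
    apply HasDerivAt.deriv
    simp only [hΦ, Pi.add_apply, Pi.smul_apply, smul_eq_mul, Finset.mul_sum]
    rw [← Finset.sum_add_distrib]
    apply HasDerivAt.fun_sum
    intro j _
    have e1 := ((Polynomial.derivative^[u0] (P j)).hasDerivAt z).const_mul (p j * w j ^ u1)
    have e2 : HasDerivAt (fun z => Complex.exp (θ * w j * z)) (Complex.exp (θ * w j * z) * (θ * w j)) z := by
      have := ((hasDerivAt_id z).const_mul (θ * w j)).cexp
      simpa using this
    have := e1.mul (e2.mul_const (c j))
    refine this.congr_deriv ?_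
    rw [Function.iterate_succ_apply']
    ring
  change (m : ℕ∞) ≤ analyticOrderAt (Φ t0 t1) a
  rw [natCast_le_analyticOrderAt_iff_iteratedDeriv_eq_zero ((hd t0 t1).analyticAt a)]
  have key : ∀ k u0 u1, u0 + k < 2 * m → u1 + k < 2 * m → iteratedDeriv k (Φ u0 u1) a = 0 := by
    intro k
    induction k with
    | zero => intro u0 u1 h0 h1; rw [iteratedDeriv_zero]; exact hv u0 (by omega) u1 (by omega)
    | succ k ih =>
      intro u0 u1 h0 h1
      rw [iteratedDeriv_succ', hder, iteratedDeriv_add, iteratedDeriv_const_smul, ih _ _ (by omega) (by omega),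
        ih _ _ (by omega) (by omega)]
      · simp
      · exact (hd _ _).contDiff.contDiffAt
      · exact ((hd _ _).contDiff.contDiffAt)
      · exact ((hd _ _).const_smul θ).contDiff.contDiffAt
  intro k hk
  exact key k t0 t1 (by omega) (by omega)


open Polynomial in
/-- rational polynomial with integer coefficients -/
def TriIntP (f : Polynomial ℚ) : Prop := ∃ g : Polynomial ℤ, g.map (Int.castRingHom ℚ) = f

lemma TriIntP.mul {f g : Polynomial ℚ} (hf : TriIntP f) (hg : TriIntP g) : TriIntP (f * g) := by
  obtain ⟨a, rfl⟩ := hf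
  obtain ⟨b, rfl⟩ := hg
  exact ⟨a * b, by simp⟩

lemma TriIntP.add {f g : Polynomial ℚ} (hf : TriIntP f) (hg : TriIntP g) : TriIntP (f + g) := by
  obtain ⟨a, rfl⟩ := hf
  obtain ⟨b, rfl⟩ := hg
  exact ⟨a + b, by simp⟩

lemma TriIntP.pow {f : Polynomial ℚ} (hf : TriIntP f) (n : ℕ) : TriIntP (f ^ n) := by
  obtain ⟨a, rfl⟩ := hf
  exact ⟨a ^ n, by simp⟩

open Polynomial in
/-- binomial polynomial -/
noncomputable def triBin (a : ℕ) : Polynomial ℚ := C ((a.factorial : ℚ)⁻¹) * descPochhammer ℚ a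

open Polynomial in
lemma triBin_succ (a : ℕ) : triBin (a + 1) = triBin a * (C (((a : ℚ) + 1)⁻¹) * (X - C (a : ℚ))) := by
  rw [triBin, triBin, descPochhammer_succ_right, Nat.factorial_succ]
  push_cast
  rw [mul_inv, C_mul, map_natCast]
  ring

open Polynomial in
lemma triBin_pascal (a : ℕ) : (triBin (a + 1)).comp (X + 1) = triBin (a + 1) + triBin a := by
  have h := congrArg (fun p => Polynomial.comp p (X + 1)) (descPochhammer_succ_comp_X_sub_one (R := ℚ) a)
  simp only [sub_comp, smul_eq_mul, mul_comp, comp_assoc, X_comp, one_comp, add_sub_cancel_right, comp_X,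
    add_comp, natCast_comp] at h
  rw [triBin, triBin, mul_comp, C_comp]
  have h2 : (descPochhammer ℚ (a + 1)).comp (X + 1) =
      descPochhammer ℚ (a + 1) + (a + 1) * descPochhammer ℚ a := by linear_combination -h
  rw [h2, mul_add]
  congr 1
  rw [← mul_assoc]
  congr 1
  rw [show ((a : Polynomial ℚ) + 1) = C ((a : ℚ) + 1) by simp, ← C_mul]
  congr 1
  rw [Nat.factorial_succ]
  push_cast
  have : (a.factorial : ℚ) ≠ 0 := by exact_mod_cast a.factorial_ne_zero
  have : (a : ℚ) + 1 ≠ 0 := by positivity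
  field_simp

open Polynomial in
lemma triBin_int_zero (N D : ℕ) (hD : ∀ a, 1 ≤ a → a ≤ N → a ∣ D) (a : ℕ) (ha : a ≤ N) :
    TriIntP ((triBin a).comp (C (D : ℚ) * X)) := by
  rcases a with _ | a
  · exact ⟨1, by simp [triBin]⟩
  have key : ∀ a, a + 1 ≤ N → (triBin (a + 1)).comp (C (D : ℚ) * X) =
      C ((D : ℚ) / ((a : ℚ) + 1)) * X * ∏ u ∈ Finset.range a, (C ((D : ℚ) / ((u : ℚ) + 1)) * X - 1) := by
    intro a
    induction a with
    | zero => intro _; simp [triBin]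
    | succ a ih =>
      intro h
      rw [triBin_succ, mul_comp, ih (by omega), Finset.prod_range_succ]
      simp only [mul_comp, C_comp, sub_comp, X_comp]
      have e1 : (C (((a + 1 : ℕ) : ℚ)) : Polynomial ℚ) = C ((a : ℚ) + 1) := by push_cast; rfl
      rw [e1]
      have e2 : (C (D : ℚ) * X - C ((a : ℚ) + 1) : Polynomial ℚ) =
          C ((a : ℚ) + 1) * (C ((D : ℚ) / ((a : ℚ) + 1)) * X - 1) := by
        rw [mul_sub, ← mul_assoc, ← C_mul, mul_div_cancel₀ _ (by positivity), mul_one]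
      rw [e2]
      have e3 : (C ((D : ℚ) / (((a + 1 : ℕ) : ℚ) + 1)) : Polynomial ℚ) =
        C ((D : ℚ) / ((a : ℚ) + 1)) * (C ((((a + 1 : ℕ) : ℚ) + 1)⁻¹) * C ((a : ℚ) + 1)) := by
        rw [← C_mul, ← C_mul]
        congr 1
        field_simp
      rw [e3]
      ring
  have hdiv : ∀ u, u + 1 ≤ N → ∃ q : ℤ, (D : ℚ) / ((u : ℚ) + 1) = q := by
    intro u hu
    obtain ⟨q, hq⟩ := hD (u + 1) (by omega) hu
    refine ⟨q, ?_⟩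
    rw [hq]; push_cast
    field_simp
  rw [key a ha]
  obtain ⟨q, hq⟩ := hdiv a ha
  refine TriIntP.mul ⟨C q * X, by simp [hq]⟩ ?_
  have : ∀ b ≤ a, TriIntP (∏ u ∈ Finset.range b, (C ((D : ℚ) / ((u : ℚ) + 1)) * X - 1)) := by
    intro b
    induction b with
    | zero => intro _; exact ⟨1, by simp⟩
    | succ b ih =>
      intro hb
      rw [Finset.prod_range_succ]
      obtain ⟨q, hq⟩ := hdiv b (by omega)
      exact (ih (by omega)).mul ⟨C q * X - 1, by simp [hq]⟩
  exact this a le_rfl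

open Polynomial in
lemma triBin_int (N D : ℕ) (hD : ∀ a, 1 ≤ a → a ≤ N → a ∣ D) (x : ℕ) : ∀ (a : ℕ), a ≤ N →
    TriIntP ((triBin a).comp (C (x : ℚ) + C (D : ℚ) * X)) := by
  induction x with
  | zero =>
    intro a ha
    simpa using triBin_int_zero N D hD a ha
  | succ x ih =>
    intro a ha
    have e : (C ((x + 1 : ℕ) : ℚ) + C (D : ℚ) * X : Polynomial ℚ) =
        (X + 1 : Polynomial ℚ).comp (C (x : ℚ) + C (D : ℚ) * X) := by
      simp; ring
    rw [e, ← comp_assoc]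
    rcases a with _ | a
    · exact ⟨1, by simp [triBin]⟩
    · rw [triBin_pascal, add_comp]
      exact (ih _ ha).add (ih _ (by omega))

open Polynomial in
/-- Feldman polynomials -/
noncomputable def triFel (N k : ℕ) : Polynomial ℚ := triBin N ^ (k / N) * X ^ (k % N)

open Polynomial in
lemma tri_iter_comp (p : Polynomial ℚ) (x D : ℚ) (t : ℕ) :
    derivative^[t] (p.comp (C x + C D * X)) = C (D ^ t) * (derivative^[t] p).comp (C x + C D * X) := by
  induction t with
  | zero => simp
  | succ t ih =>
    rw [Function.iterate_succ_apply', ih, Function.iterate_succ_apply', derivative_C_mul, derivative_comp]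
    simp only [derivative_add, derivative_C, derivative_C_mul, derivative_X, zero_add, mul_one, pow_succ, C_mul]
    ring

open Polynomial in
lemma triFel_int (N D : ℕ) (hD : ∀ a, 1 ≤ a → a ≤ N → a ∣ D) (k t x : ℕ) :
    ∃ n : ℤ, (D : ℚ) ^ t * (derivative^[t] (triFel N k)).eval (x : ℚ) = n := by
  have h : TriIntP ((triFel N k).comp (C (x : ℚ) + C (D : ℚ) * X)) := by
    rw [triFel, mul_comp, pow_comp, pow_comp, X_comp]
    exact ((triBin_int N D hD x N le_rfl).pow _).mul (TriIntP.pow ⟨C (x : ℤ) + C (D : ℤ) * X, by simp⟩ _)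
  obtain ⟨g, hg⟩ := h
  have h1 := tri_iter_comp (triFel N k) x D t
  rw [← hg, iterate_derivative_map] at h1
  have h2 := congrArg (Polynomial.eval 0) h1
  simp only [eval_mul, eval_C, eval_comp, eval_add, eval_X, mul_zero, add_zero] at h2
  rw [← h2]
  refine ⟨(derivative^[t] g).eval 0, ?_⟩
  have := Polynomial.eval_map_apply (f := Int.castRingHom ℚ) (p := derivative^[t] g) (0 : ℤ)
  simpa using this

lemma tri_lcm (N : ℕ) : ∃ D : ℕ, 1 ≤ D ∧ (∀ a, 1 ≤ a → a ≤ N → a ∣ D) ∧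
    (D : ℝ) ≤ Real.exp (6 * N) := by
  refine ⟨Nat.lcmUpto N, Nat.lcmUpto_pos N, ?_, ?_⟩
  · intro a h1 h2
    exact Finset.dvd_lcm (f := id) (by simp [h1, h2])
  · have h := Chebyshev.psi_le_const_mul_self (x := N) (by positivity)
    rw [Chebyshev.psi_eq_log_lcmUpto] at h
    have hp : (0 : ℝ) < Nat.lcmUpto N := by exact_mod_cast Nat.lcmUpto_pos N
    rw [← Real.log_le_iff_le_exp hp]
    refine h.trans ?_
    have : Real.log 4 ≤ 2 := by
      rw [show (4 : ℝ) = 2 ^ 2 by norm_num, Real.log_pow]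
      have := Real.log_two_lt_d9
      push_cast; linarith
    gcongr
    linarith

open Polynomial in
lemma triFel_natDegree (N k : ℕ) (hN : 1 ≤ N) : (triFel N k).natDegree = k := by
  have h0 : ((N.factorial : ℚ)⁻¹) ≠ 0 := inv_ne_zero (by exact_mod_cast N.factorial_ne_zero)
  have hb : (triBin N).natDegree = N := by
    rw [triBin, natDegree_C_mul h0, descPochhammer_natDegree]
  have hb0 : triBin N ≠ 0 := by
    intro h; rw [h] at hb; simp at hb; omega
  rw [triFel, natDegree_mul (pow_ne_zero _ hb0) (pow_ne_zero _ X_ne_zero), natDegree_pow, hb,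
    natDegree_pow, natDegree_X, mul_one]
  rw [mul_comm]
  exact Nat.div_add_mod k N

open Polynomial in
lemma tri_iter_eval (p : Polynomial ℂ) (t : ℕ) :
    iteratedDeriv t (fun z => p.eval z) = fun z => (derivative^[t] p).eval z := by
  induction t with
  | zero => simp
  | succ t ih =>
    rw [iteratedDeriv_succ, ih, Function.iterate_succ_apply']
    funext z
    exact Polynomial.deriv _

open Polynomial in
lemma triFel_norm (N k Q t : ℕ) (hN : 1 ≤ N) (hk : k < N * Q) (r : ℝ) (hr : 0 ≤ r) (z : ℂ) (hz : ‖z‖ ≤ r) :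
    ‖(derivative^[t] ((triFel N k).map (algebraMap ℚ ℂ))).eval z‖ ≤
      t.factorial * (((r + 1 + N) / N) ^ (N * Q) * Real.exp (N * Q) * (r + 1) ^ N) := by
  have hN0 : (0 : ℝ) < N := by exact_mod_cast hN
  have hf0 : (0 : ℝ) < N.factorial := by exact_mod_cast N.factorial_pos
  have hsup : ∀ w ∈ Metric.sphere z 1, ‖((triFel N k).map (algebraMap ℚ ℂ)).eval w‖ ≤
      ((r + 1 + N) / N) ^ (N * Q) * Real.exp (N * Q) * (r + 1) ^ N := by
    intro w hw
    rw [mem_sphere_iff_norm] at hw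
    have hw1 : ‖w‖ ≤ r + 1 := by
      have : ‖w‖ ≤ ‖z‖ + ‖w - z‖ := by
        have := norm_add_le z (w - z)
        simpa using this
      linarith
    have hbin : ‖((triBin N).map (algebraMap ℚ ℂ)).eval w‖ ≤ ((r + 1 + N) / N) ^ N * Real.exp N := by
      rw [triBin, Polynomial.map_mul, map_C, descPochhammer_map, eval_mul, eval_C,
        descPochhammer_eval_eq_prod_range, norm_mul, norm_prod]
      have h1 : ∏ j ∈ Finset.range N, ‖w - (j : ℂ)‖ ≤ (r + 1 + N) ^ N := by
        calc _ ≤ ∏ j ∈ Finset.range N, (r + 1 + N) := by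
              apply Finset.prod_le_prod
              · intros; positivity
              · intro j hj
                rw [Finset.mem_range] at hj
                have hj' : (j : ℝ) ≤ N := by exact_mod_cast hj.le
                refine (norm_sub_le _ _).trans ?_
                rw [Complex.norm_natCast]; linarith
          _ = _ := by simp
      have h2 : ‖(algebraMap ℚ ℂ) ((N.factorial : ℚ)⁻¹)‖ = (N.factorial : ℝ)⁻¹ := by
        simp
      rw [h2]
      have h3 : (N : ℝ) ^ N / N.factorial ≤ Real.exp N := Real.pow_div_factorial_le_exp _ hN0.le N
      calc _ ≤ (N.factorial : ℝ)⁻¹ * (r + 1 + N) ^ N := by gcongr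
        _ = ((r + 1 + N) / N) ^ N * ((N : ℝ) ^ N / N.factorial) := by
            rw [div_pow]; field_simp
        _ ≤ _ := by gcongr
    have hbase : 1 ≤ (r + 1 + N) / N := by rw [le_div_iff₀ hN0]; linarith
    have hone : 1 ≤ ((r + 1 + N) / N) ^ N * Real.exp N :=
      one_le_mul_of_one_le_of_one_le (one_le_pow₀ hbase) (Real.one_le_exp hN0.le)
    rw [triFel, Polynomial.map_mul, Polynomial.map_pow, Polynomial.map_pow, map_X, eval_mul, eval_pow, eval_pow,
      eval_X, norm_mul, norm_pow, norm_pow]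
    have hkQ : k / N ≤ Q := (Nat.div_lt_of_lt_mul hk).le
    have e1 : ‖((triBin N).map (algebraMap ℚ ℂ)).eval w‖ ^ (k / N) ≤
        ((r + 1 + N) / N) ^ (N * Q) * Real.exp (N * Q) := by
      calc _ ≤ (((r + 1 + N) / N) ^ N * Real.exp N) ^ (k / N) := by gcongr
        _ ≤ (((r + 1 + N) / N) ^ N * Real.exp N) ^ Q := pow_le_pow_right₀ hone hkQ
        _ = _ := by rw [mul_pow, ← pow_mul, ← Real.exp_nat_mul]; ring_nf
    have e2 : ‖w‖ ^ (k % N) ≤ (r + 1) ^ N :=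
      calc _ ≤ (r + 1) ^ (k % N) := by gcongr
        _ ≤ _ := pow_le_pow_right₀ (by linarith) (Nat.mod_lt _ (by omega)).le
    exact mul_le_mul e1 e2 (by positivity) (by positivity)
  have := Complex.norm_iteratedDeriv_le_of_forall_mem_sphere_norm_le (c := z) (R := 1) t one_pos
    (f := fun z => ((triFel N k).map (algebraMap ℚ ℂ)).eval z)
    (Polynomial.differentiable _).diffContOnCl hsup
  rw [tri_iter_eval] at this
  simpa using this


section
attribute [local instance] Matrix.seminormedAddCommGroup Matrix.normedAddCommGroup

lemma tri_siegel {α β : Type*} [Fintype α] [Fintype β] [DecidableEq α] [DecidableEq β]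
    (A : Matrix α β ℤ) (A0 : ℝ) (hA0 : 1 ≤ A0)
    (hA : ∀ i j, |(A i j : ℝ)| ≤ A0) (hpos : 0 < Fintype.card α)
    (hcard : 2 * Fintype.card α ≤ Fintype.card β) :
    ∃ t : β → ℤ, t ≠ 0 ∧ (∀ i, ∑ j, A i j * t j = 0) ∧
      ∀ j, |(t j : ℝ)| ≤ Fintype.card β * A0 := by
  have hb : (1 : ℝ) ≤ Fintype.card β := by
    have : 1 ≤ Fintype.card β := by omega
    exact_mod_cast this
  have hbA : 1 ≤ (Fintype.card β : ℝ) * A0 := one_le_mul_of_one_le_of_one_le hb hA0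
  by_cases h0 : A = 0
  · refine ⟨fun _ => 1, ?_, ?_, ?_⟩
    · have hβ : Nonempty β := by
        rw [← Fintype.card_pos_iff]; omega
      obtain ⟨j⟩ := hβ
      intro h
      have := congrFun h j
      simp at this
    · simp [h0]
    · intro j; simpa using hbA
  · obtain ⟨t, ht0, ht, htn⟩ := Int.Matrix.exists_ne_zero_int_vec_norm_le' A (by omega) hpos h0
    refine ⟨t, ht0, fun i => ?_, fun j => ?_⟩
    · have := congrFun ht i
      simpa [Matrix.mulVec, dotProduct] using this
    · have h1 : |(t j : ℝ)| ≤ ‖t‖ := by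
        have := norm_le_pi_norm t j
        rwa [Int.norm_eq_abs] at this
      have hnA : ‖A‖ ≤ A0 := by
        rw [Matrix.norm_le_iff (by linarith)]
        intro i j
        rw [Int.norm_eq_abs]; exact hA i j
      have hnA1 : 1 ≤ ‖A‖ := Int.Matrix.one_le_norm_A_of_ne_zero A h0
      refine h1.trans (htn.trans ?_)
      have hbase : 1 ≤ (Fintype.card β : ℝ) * ‖A‖ := one_le_mul_of_one_le_of_one_le hb hnA1
      have hexp : ((Fintype.card α : ℝ) / ((Fintype.card β : ℝ) - Fintype.card α)) ≤ 1 := by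
        have h2 : 2 * (Fintype.card α : ℝ) ≤ Fintype.card β := by exact_mod_cast hcard
        have h3 : (0 : ℝ) < Fintype.card α := by exact_mod_cast hpos
        rw [div_le_one (by linarith)]; linarith
      calc _ ≤ ((Fintype.card β : ℝ) * ‖A‖) ^ (1 : ℝ) :=
            Real.rpow_le_rpow_of_exponent_le hbase hexp
        _ = (Fintype.card β : ℝ) * ‖A‖ := Real.rpow_one _
        _ ≤ _ := by gcongr
end

lemma tri_mul_exp {a b x y : ℝ} (hb : 0 ≤ b) (h1 : a ≤ Real.exp x) (h2 : b ≤ Real.exp y) :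
    a * b ≤ Real.exp (x + y) := by
  rw [Real.exp_add]
  exact mul_le_mul h1 h2 hb (Real.exp_pos _).le

lemma tri_pow_exp {a x : ℝ} (n : ℕ) (ha : 0 ≤ a) (h1 : a ≤ Real.exp x) :
    a ^ n ≤ Real.exp (n * x) := by
  rw [Real.exp_nat_mul]
  gcongr

/-- Data for the transcendence argument. -/
structure TriD where
  E : ℕ
  s : ℕ
  u1 : ℕ
  v1 : ℕ
  u2 : ℕ
  v2 : ℕ
  b1 : ℤ
  b2 : ℤ
  D : ℕ
  hE : Real.exp 14000 ≤ E
  hs : E ≤ s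
  hu1 : 1 ≤ u1
  hv1 : 1 ≤ v1
  hu2 : 1 ≤ u2
  hv2 : 1 ≤ v2
  hu1' : (u1 : ℝ) ≤ Real.exp s
  hv1' : (v1 : ℝ) ≤ Real.exp s
  hu2' : (u2 : ℝ) ≤ Real.exp s
  hv2' : (v2 : ℝ) ≤ Real.exp s
  hb1 : |(b1 : ℝ)| ≤ Real.exp s
  hb2 : |(b2 : ℝ)| ≤ Real.exp s
  hD1 : 1 ≤ D
  hD : ∀ a, 1 ≤ a → a ≤ 7 * s → a ∣ D
  hD' : (D : ℝ) ≤ Real.exp (42 * s)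

namespace TriD
variable (d : TriD)

/-- main scale -/
def Z : ℝ := (d.E : ℝ) ^ 2 * (d.s : ℝ) ^ 3

/-- side of the box -/
def L : ℕ := 98 * d.E * d.s

/-- multiplicity -/
def m : ℕ := 196 * d.E ^ 2 * d.s ^ 2

/-- degree -/
def L0 : ℕ := (7 * d.s) * (7 * d.E ^ 2 * d.s ^ 2)

/-- index type -/
abbrev J : Type := Fin d.L0 × Fin d.L × Fin d.L

/-- frequencies -/
def w (l : Fin d.L × Fin d.L) : ℤ := d.b2 * l.1 - d.b1 * l.2

lemma hE1 : (14000 : ℝ) ≤ d.E := by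
  have := Real.add_one_le_exp 14000
  linarith [d.hE]

lemma hEs : (d.E : ℝ) ≤ d.s := by exact_mod_cast d.hs

lemma hs1 : (14000 : ℝ) ≤ d.s := d.hE1.trans d.hEs

lemma hsexp : (d.s : ℝ) ≤ Real.exp d.s := by
  have := Real.add_one_le_exp (d.s : ℝ)
  linarith

lemma hZs2 : (d.E : ℝ) * d.s ^ 3 * 14000 ≤ d.Z := by
  have h1 := d.hE1
  have : (0 : ℝ) ≤ d.E * d.s ^ 3 := by positivity
  unfold Z
  nlinarith

lemma hZs3 : (d.E : ℝ) * d.s ^ 2 * 14000 ≤ d.Z := by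
  have h1 := d.hs1
  refine le_trans ?_ d.hZs2
  have : (0 : ℝ) ≤ d.E * d.s ^ 2 := by positivity
  nlinarith

lemma hZs4 : (d.s : ℝ) ^ 2 * 14000 ≤ d.Z := by
  have h1 := d.hE1
  refine le_trans ?_ d.hZs3
  have : (0 : ℝ) ≤ (d.s : ℝ) ^ 2 := by positivity
  nlinarith

lemma hZs5 : (d.s : ℝ) * 14000 ≤ d.Z := by
  have h1 := d.hs1
  refine le_trans ?_ d.hZs4
  nlinarith

lemma hZ1 : (14000 : ℝ) ≤ d.Z := by
  have h1 := d.hs1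
  have := d.hZs5
  linarith

lemma felX (k t : ℕ) (hk : k < d.L0) (ht : t ≤ 2 * d.m) (z : ℂ) (hz : ‖z‖ ≤ 7 * d.s) :
    ‖(Polynomial.derivative^[t] ((triFel (7 * d.s) k).map (algebraMap ℚ ℂ))).eval z‖ ≤
      t.factorial * Real.exp (148 * d.Z) := by
  have hs := d.hs1
  have h := triFel_norm (7 * d.s) k (7 * d.E ^ 2 * d.s ^ 2) t
    (by have : (0 : ℝ) < d.s := by linarith
        have : 0 < d.s := by exact_mod_cast this
        omega) hk (7 * d.s) (by positivity) z hz
  refine h.trans ?_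
  gcongr
  have e0 : (((7 * d.s : ℕ) : ℝ) * ((7 * d.E ^ 2 * d.s ^ 2 : ℕ) : ℝ)) = 49 * d.Z := by
    unfold Z; push_cast; ring
  have e1 : ((7 * (d.s : ℝ) + 1 + (7 * d.s : ℕ)) / (7 * d.s : ℕ)) ≤ Real.exp 2 := by
    rw [div_le_iff₀ (by push_cast; linarith)]
    have := Real.add_one_le_exp 2
    push_cast
    nlinarith
  have e2 := tri_pow_exp ((7 * d.s) * (7 * d.E ^ 2 * d.s ^ 2)) (by positivity) e1
  rw [Nat.cast_mul (7 * d.s) (7 * d.E ^ 2 * d.s ^ 2), e0] at e2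
  have e3 : (7 * (d.s : ℝ) + 1) ^ (7 * d.s) ≤ Real.exp ((7 * d.s : ℕ) * (7 * d.s)) :=
    tri_pow_exp _ (by positivity) (Real.add_one_le_exp _)
  have e4 := tri_mul_exp (by positivity) (tri_mul_exp (by positivity) e2 (le_refl (Real.exp (49 * d.Z)))) e3
  rw [e0]
  refine e4.trans (Real.exp_le_exp.mpr ?_)
  have := d.hZs4
  push_cast
  nlinarith

lemma felR (k t : ℕ) (hk : k < d.L0) (ht : t ≤ 2 * d.m) (z : ℂ) (hz : ‖z‖ ≤ 7 * d.E * d.s) :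
    ‖(Polynomial.derivative^[t] ((triFel (7 * d.s) k).map (algebraMap ℚ ℂ))).eval z‖ ≤
      t.factorial * Real.exp (49 * d.Z * Real.log d.E + 99 * d.Z) := by
  have hs := d.hs1
  have hE := d.hE1
  have h := triFel_norm (7 * d.s) k (7 * d.E ^ 2 * d.s ^ 2) t
    (by have : (0 : ℝ) < d.s := by linarith
        have : 0 < d.s := by exact_mod_cast this
        omega) hk (7 * d.E * d.s) (by positivity) z hz
  refine h.trans ?_
  gcongr
  have e0 : (((7 * d.s : ℕ) : ℝ) * ((7 * d.E ^ 2 * d.s ^ 2 : ℕ) : ℝ)) = 49 * d.Z := by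
    unfold Z; push_cast; ring
  have e1 : ((7 * (d.E : ℝ) * (d.s : ℝ) + 1 + (7 * d.s : ℕ)) / (7 * d.s : ℕ)) ≤
      Real.exp (Real.log d.E + 1) := by
    rw [div_le_iff₀ (by push_cast; linarith), Real.exp_add, Real.exp_log (by linarith)]
    have := Real.add_one_le_exp 1
    push_cast
    have h2 : (d.E : ℝ) * 2 ≤ d.E * Real.exp 1 := by gcongr; linarith
    have h3 : (d.E : ℝ) * 2 * (7 * d.s) ≤ d.E * Real.exp 1 * (7 * d.s) := by gcongr
    nlinarith
  have e2 := tri_pow_exp ((7 * d.s) * (7 * d.E ^ 2 * d.s ^ 2)) (by positivity) e1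
  rw [Nat.cast_mul (7 * d.s) (7 * d.E ^ 2 * d.s ^ 2), e0] at e2
  have e3 : (7 * (d.E : ℝ) * (d.s : ℝ) + 1) ^ (7 * d.s) ≤ Real.exp ((7 * d.s : ℕ) * (7 * d.E * d.s)) :=
    tri_pow_exp _ (by positivity) (Real.add_one_le_exp _)
  have e4 := tri_mul_exp (by positivity) (tri_mul_exp (by positivity) e2 (le_refl (Real.exp (49 * d.Z)))) e3
  rw [e0]
  refine e4.trans (Real.exp_le_exp.mpr ?_)
  have := d.hZs3
  push_cast
  nlinarith

lemma hm2 : ((2 * d.m : ℕ) : ℝ) * d.s = 392 * d.Z := by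
  unfold m Z; push_cast; ring

lemma hfact (t : ℕ) (ht : t ≤ 2 * d.m) : (t.factorial : ℝ) ≤ Real.exp (1960 * d.Z) := by
  have hs := d.hs1
  have hEs := d.hEs
  have h1 : (t.factorial : ℝ) ≤ (t : ℝ) ^ t := by exact_mod_cast t.factorial_le_pow
  have ht' : (t : ℝ) ≤ 392 * d.E ^ 2 * d.s ^ 2 := by
    have : (t : ℝ) ≤ ((2 * d.m : ℕ) : ℝ) := by exact_mod_cast ht
    refine this.trans (le_of_eq ?_)
    unfold m; push_cast; ring
  have h2 : (t : ℝ) ≤ Real.exp (5 * d.s) := by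
    have e1 : (392 : ℝ) * d.E ^ 2 * d.s ^ 2 ≤ d.s ^ 5 := by
      calc (392 : ℝ) * d.E ^ 2 * d.s ^ 2 ≤ d.s * d.s ^ 2 * d.s ^ 2 := by
            gcongr; linarith
        _ = _ := by ring
    have e2 := tri_pow_exp 5 (by positivity) d.hsexp
    push_cast at e2
    linarith
  have h3 := tri_pow_exp t (by positivity) h2
  refine h1.trans (h3.trans (Real.exp_le_exp.mpr ?_))
  have h4 : (t : ℝ) * d.s ≤ ((2 * d.m : ℕ) : ℝ) * d.s := by gcongr
  rw [hm2] at h4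
  linarith

lemma hDpow (t : ℕ) (ht : t ≤ 2 * d.m) : (d.D : ℝ) ^ t ≤ Real.exp (16464 * d.Z) := by
  have h3 := tri_pow_exp t (by positivity) d.hD'
  refine h3.trans (Real.exp_le_exp.mpr ?_)
  have h4 : (t : ℝ) * d.s ≤ ((2 * d.m : ℕ) : ℝ) * d.s := by gcongr
  rw [hm2] at h4
  linarith

lemma hLexp : (d.L : ℝ) * 2 ≤ Real.exp (3 * d.s) := by
  have hs := d.hs1
  have hEs := d.hEs
  have e1 : (d.L : ℝ) * 2 ≤ d.s ^ 3 := by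
    unfold L; push_cast
    calc (98 : ℝ) * d.E * d.s * 2 = 196 * d.E * d.s := by ring
      _ ≤ d.s * d.s * d.s := by gcongr; linarith
      _ = _ := by ring
  have e2 := tri_pow_exp 3 (by positivity) d.hsexp
  push_cast at e2
  linarith

lemma hw (l : Fin d.L × Fin d.L) : |(d.w l : ℝ)| ≤ Real.exp (4 * d.s) := by
  have h1 : |(d.w l : ℝ)| ≤ Real.exp d.s * d.L + Real.exp d.s * d.L := by
    unfold w; push_cast
    refine (abs_sub _ _).trans ?_
    rw [abs_mul, abs_mul]
    have a1 : |((l.1 : ℕ) : ℝ)| ≤ d.L := by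
      rw [abs_of_nonneg (by positivity)]; exact_mod_cast l.1.isLt.le
    have a2 : |((l.2 : ℕ) : ℝ)| ≤ d.L := by
      rw [abs_of_nonneg (by positivity)]; exact_mod_cast l.2.isLt.le
    exact add_le_add (mul_le_mul d.hb2 a1 (abs_nonneg _) (Real.exp_pos _).le)
      (mul_le_mul d.hb1 a2 (abs_nonneg _) (Real.exp_pos _).le)
  have := tri_mul_exp (by positivity) (le_refl (Real.exp d.s)) d.hLexp
  rw [show (d.s : ℝ) + 3 * d.s = 4 * d.s by ring] at this
  linarith

lemma hwpow (l : Fin d.L × Fin d.L) (t : ℕ) (ht : t ≤ 2 * d.m) :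
    |(d.w l : ℝ)| ^ t ≤ Real.exp (1568 * d.Z) := by
  have h3 := tri_pow_exp t (by positivity) (d.hw l)
  refine h3.trans (Real.exp_le_exp.mpr ?_)
  have h4 : (t : ℝ) * d.s ≤ ((2 * d.m : ℕ) : ℝ) * d.s := by gcongr
  rw [hm2] at h4
  linarith

/-- integer values of the Feldman polynomials -/
noncomputable def NF (k t x : ℕ) : ℤ := (triFel_int (7 * d.s) d.D d.hD k t x).choose

lemma NF_spec (k t x : ℕ) :
    (d.D : ℚ) ^ t * (Polynomial.derivative^[t] (triFel (7 * d.s) k)).eval (x : ℚ) = d.NF k t x :=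
  (triFel_int (7 * d.s) d.D d.hD k t x).choose_spec

lemma NF_spec' (k t x : ℕ) :
    (d.D : ℂ) ^ t * (Polynomial.derivative^[t] ((triFel (7 * d.s) k).map (algebraMap ℚ ℂ))).eval (x : ℂ)
      = d.NF k t x := by
  have h := congrArg (algebraMap ℚ ℂ) (d.NF_spec k t x)
  rw [map_mul, map_pow, ← Polynomial.eval_map_apply, ← Polynomial.iterate_derivative_map] at h
  simpa using h

lemma hNF (k t x : ℕ) (hk : k < d.L0) (ht : t ≤ 2 * d.m) (hx : x ≤ 7 * d.s) :
    |(d.NF k t x : ℝ)| ≤ Real.exp (18572 * d.Z) := by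
  have h := congrArg norm (d.NF_spec' k t x)
  rw [Complex.norm_intCast, norm_mul, norm_pow, Complex.norm_natCast] at h
  rw [← h]
  have h1 := d.felX k t hk ht x (by rw [Complex.norm_natCast]; exact_mod_cast hx)
  have h2 := tri_mul_exp (by positivity) (d.hfact t ht) (le_refl (Real.exp (148 * d.Z)))
  have h3 := tri_mul_exp (norm_nonneg _) (d.hDpow t ht) (h1.trans h2)
  refine h3.trans (Real.exp_le_exp.mpr (by linarith))

/-- integer monomials -/
def U (e1 e2 : ℕ) : ℤ :=
  d.u1 ^ e1 * d.v1 ^ (d.L * d.s - e1) * (d.u2 ^ e2 * d.v2 ^ (d.L * d.s - e2))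

lemma hUaux (u v : ℕ) (hu : (u : ℝ) ≤ Real.exp d.s) (hv : (v : ℝ) ≤ Real.exp d.s) (e : ℕ)
    (he : e ≤ d.L * d.s) : (u : ℝ) ^ e * (v : ℝ) ^ (d.L * d.s - e) ≤ Real.exp (98 * (d.E * d.s ^ 3)) := by
  have h1 := tri_mul_exp (by positivity) (tri_pow_exp e (by positivity) hu)
    (tri_pow_exp (d.L * d.s - e) (by positivity) hv)
  refine h1.trans (Real.exp_le_exp.mpr (le_of_eq ?_))
  rw [← add_mul, ← Nat.cast_add, Nat.add_sub_cancel' he]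
  unfold L; push_cast; ring

lemma hU (e1 e2 : ℕ) (h1 : e1 ≤ d.L * d.s) (h2 : e2 ≤ d.L * d.s) :
    |(d.U e1 e2 : ℝ)| ≤ Real.exp d.Z := by
  have a := tri_mul_exp (by positivity) (d.hUaux d.u1 d.v1 d.hu1' d.hv1' e1 h1)
    (d.hUaux d.u2 d.v2 d.hu2' d.hv2' e2 h2)
  unfold U; push_cast
  rw [abs_of_nonneg (by positivity)]
  refine a.trans (Real.exp_le_exp.mpr ?_)
  have := d.hZs2
  have : (0 : ℝ) ≤ d.E * d.s ^ 3 := by positivity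
  nlinarith

/-- entries of the linear system -/
noncomputable def ent (δ σ t0 t1 : ℕ) (j : d.J) : ℤ :=
  d.NF j.1 t0 (7 * σ + δ) * d.w j.2 ^ t1 *
    d.U (j.2.1 * σ + δ * (j.2.1 / 7)) (j.2.2 * σ + δ * (j.2.2 / 7))

lemma he_aux (δ σ l : ℕ) (hδ : δ ≤ 1) (hσ : σ < d.s) (hl : l < d.L) :
    l * σ + δ * (l / 7) ≤ d.L * d.s := by
  have h1 : δ * (l / 7) ≤ l := by
    calc δ * (l / 7) ≤ 1 * (l / 7) := Nat.mul_le_mul_right _ hδ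
      _ ≤ l := by omega
  calc l * σ + δ * (l / 7) ≤ l * σ + l := by omega
    _ = l * (σ + 1) := by ring
    _ ≤ d.L * d.s := Nat.mul_le_mul hl.le hσ

lemma hent (δ σ t0 t1 : ℕ) (hδ : δ ≤ 1) (hσ : σ < d.s) (h0 : t0 ≤ 2 * d.m) (h1 : t1 ≤ 2 * d.m)
    (j : d.J) : |(d.ent δ σ t0 t1 j : ℝ)| ≤ Real.exp (20200 * d.Z) := by
  have a1 := d.hNF j.1 t0 (7 * σ + δ) j.1.isLt h0 (by omega)
  have a2 := d.hwpow j.2 t1 h1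
  have a3 := d.hU _ _ (d.he_aux δ σ j.2.1 hδ hσ j.2.1.isLt) (d.he_aux δ σ j.2.2 hδ hσ j.2.2.isLt)
  have a4 := tri_mul_exp (abs_nonneg _) (tri_mul_exp (by positivity) a1 a2) a3
  unfold ent; push_cast
  rw [abs_mul, abs_mul, abs_pow]
  refine a4.trans (Real.exp_le_exp.mpr ?_)
  have := d.hZ1
  linarith

lemma hcardJ : (Fintype.card d.J : ℝ) ≤ Real.exp d.Z := by
  have hs := d.hs1
  have hEs := d.hEs
  have h1 : (Fintype.card d.J : ℝ) ≤ d.s ^ 12 := by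
    simp only [Fintype.card_prod, Fintype.card_fin]
    unfold L0 L; push_cast
    calc _ = 470596 * (d.E : ℝ) ^ 4 * d.s ^ 5 := by ring
      _ ≤ d.s ^ 3 * d.s ^ 4 * d.s ^ 5 := by
        gcongr
        calc (470596 : ℝ) ≤ 14000 ^ 3 := by norm_num
          _ ≤ _ := by gcongr
      _ = _ := by ring
  have h2 := tri_pow_exp 12 (by positivity) d.hsexp
  refine h1.trans (h2.trans (Real.exp_le_exp.mpr ?_))
  have := d.hZs5
  push_cast
  linarith

lemma siegel : ∃ p : d.J → ℤ, p ≠ 0 ∧ (∀ j, |(p j : ℝ)| ≤ Real.exp (20201 * d.Z)) ∧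
    ∀ σ < d.s, ∀ t0 < 2 * d.m, ∀ t1 < 2 * d.m, ∑ j, p j * d.ent 0 σ t0 t1 j = 0 := by
  have hs := d.hs1
  have hE := d.hE1
  have hs0 : 0 < d.s := by
    have : (0 : ℝ) < d.s := by linarith
    exact_mod_cast this
  have hE0 : 0 < d.E := by
    have : (0 : ℝ) < d.E := by linarith
    exact_mod_cast this
  have hm0 : 0 < d.m := by unfold m; positivity
  obtain ⟨p, hp0, hp, hpb⟩ := tri_siegel (α := Fin d.s × Fin (2 * d.m) × Fin (2 * d.m)) (β := d.J)
    (fun i j => d.ent 0 i.1 i.2.1 i.2.2 j) (Real.exp (20200 * d.Z))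
    (Real.one_le_exp (by have := d.hZ1; linarith))
    (fun i j => d.hent 0 _ _ _ (by norm_num) i.1.isLt i.2.1.isLt.le i.2.2.isLt.le j)
    (by simp only [Fintype.card_prod, Fintype.card_fin]; positivity)
    (by
      simp only [Fintype.card_prod, Fintype.card_fin]
      unfold L0 L m
      have : 0 ≤ d.E ^ 4 * d.s ^ 5 := by positivity
      nlinarith)
  refine ⟨p, hp0, fun j => ?_, fun σ hσ t0 h0 t1 h1 => ?_⟩
  · refine (hpb j).trans ?_
    have := tri_mul_exp (by positivity) d.hcardJ (le_refl (Real.exp (20200 * d.Z)))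
    refine this.trans (Real.exp_le_exp.mpr (by linarith))
  · have := hp (⟨σ, hσ⟩, ⟨t0, h0⟩, ⟨t1, h1⟩)
    simpa [mul_comm] using this

end TriD


lemma tri_vand {ι : Type*} [DecidableEq ι] (S : Finset ι) (w c : ι → ℤ) (m : ℕ)
    (hinj : Set.InjOn w S) (hcard : S.card ≤ m)
    (h : ∀ t < m, ∑ i ∈ S, c i * w i ^ t = 0) : ∀ i ∈ S, c i = 0 := by
  intro i hi
  set Q : Polynomial ℤ := ∏ j ∈ S.erase i, (Polynomial.X - Polynomial.C (w j)) with hQ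
  have hdeg : Q.natDegree < m := by
    rw [hQ, Polynomial.natDegree_prod_of_monic _ _ (fun j _ => Polynomial.monic_X_sub_C _)]
    simp only [Polynomial.natDegree_X_sub_C, Finset.sum_const, smul_eq_mul, mul_one,
      Finset.card_erase_of_mem hi]
    have := Finset.card_pos.mpr ⟨i, hi⟩
    omega
  have h1 : ∑ j ∈ S, c j * Q.eval (w j) = 0 := by
    simp only [Polynomial.eval_eq_sum_range' hdeg, Finset.mul_sum]
    rw [Finset.sum_comm]
    refine Finset.sum_eq_zero fun t ht => ?_
    have := h t (Finset.mem_range.mp ht)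
    calc _ = Q.coeff t * ∑ i ∈ S, c i * w i ^ t := by
          rw [Finset.mul_sum]; exact Finset.sum_congr rfl fun _ _ => by ring
      _ = 0 := by rw [this, mul_zero]
  rw [Finset.sum_eq_single_of_mem i hi] at h1
  · rcases mul_eq_zero.mp h1 with h2 | h2
    · exact h2
    · exfalso
      rw [hQ, Polynomial.eval_prod, Finset.prod_eq_zero_iff] at h2
      obtain ⟨j, hj, hj'⟩ := h2
      simp only [Polynomial.eval_sub, Polynomial.eval_X, Polynomial.eval_C, sub_eq_zero] at hj'
      have := hinj hi (Finset.mem_of_mem_erase hj) hj'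
      exact (Finset.ne_of_mem_erase hj) this.symm
  · intro j hj hji
    have : Q.eval (w j) = 0 := by
      rw [hQ, Polynomial.eval_prod]
      refine Finset.prod_eq_zero (Finset.mem_erase.mpr ⟨hji, hj⟩) (by simp)
    rw [this, mul_zero]

lemma tri_poly_zero (Q : Polynomial ℚ) (s m N : ℕ) (hdeg : Q.natDegree < N) (hN : N ≤ s * m)
    (h : ∀ σ < s, ∀ t < m, (Polynomial.derivative^[t] Q).eval ((7 * σ + 1 : ℕ) : ℚ) = 0) : Q = 0 := by
  by_contra hQ
  have hd : ∀ σ ∈ Finset.range s,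
      (Polynomial.X - Polynomial.C ((7 * σ + 1 : ℕ) : ℚ)) ^ m ∣ Q := by
    intro σ hσ
    rw [← Polynomial.le_rootMultiplicity_iff hQ]
    rcases m with _ | n
    · simp
    · refine (Polynomial.lt_rootMultiplicity_iff_isRoot_iterate_derivative hQ).mpr ?_
      intro t ht
      exact h σ (Finset.mem_range.mp hσ) t (by omega)
  have hp : (∏ σ ∈ Finset.range s, (Polynomial.X - Polynomial.C ((7 * σ + 1 : ℕ) : ℚ)) ^ m) ∣ Q := by
    refine Finset.prod_dvd_of_coprime ?_ hd
    intro i _ j _ hij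
    apply IsCoprime.pow
    refine Polynomial.pairwise_coprime_X_sub_C (s := fun σ : ℕ => ((7 * σ + 1 : ℕ) : ℚ)) ?_ hij
    intro a b hab
    have : 7 * a + 1 = 7 * b + 1 := by
      simp only at hab
      exact_mod_cast hab
    omega
  have h1 := Polynomial.natDegree_le_of_dvd hp hQ
  rw [Polynomial.natDegree_prod_of_monic _ _ (fun j _ => (Polynomial.monic_X_sub_C _).pow m)] at h1
  simp only [Polynomial.natDegree_pow, Polynomial.natDegree_X_sub_C, Finset.sum_const,
    Finset.card_range, smul_eq_mul, mul_one] at h1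
  omega

namespace TriD
variable (d : TriD)

lemma hs0 : 0 < d.s := by
  have hs := d.hs1
  have : (0 : ℝ) < d.s := by linarith
  exact_mod_cast this

lemma hE0 : 0 < d.E := by
  have hs := d.hE1
  have : (0 : ℝ) < d.E := by linarith
  exact_mod_cast this

lemma Upos (e1 e2 : ℕ) : d.U e1 e2 ≠ 0 := by
  have h1 := d.hu1
  have h2 := d.hv1
  have h3 := d.hu2
  have h4 := d.hv2
  have : (0 : ℤ) < d.U e1 e2 := by unfold U; positivity
  exact this.ne'

lemma finish (p : d.J → ℤ) (hinj : Function.Injective d.w)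
    (h : ∀ σ < d.s, ∀ t0 < d.m, ∀ t1 < d.m, ∀ i : Fin 7 × Fin 7,
      ∑ j : d.J, (if (j.2.1 : ℕ) % 7 = i.1 ∧ (j.2.2 : ℕ) % 7 = i.2 then p j * d.ent 1 σ t0 t1 j else 0) = 0) :
    p = 0 := by
  have key : ∀ l : Fin d.L × Fin d.L, ∀ σ < d.s, ∀ t0 < d.m,
      ∑ k : Fin d.L0, p (k, l) * d.NF k t0 (7 * σ + 1) = 0 := by
    intro l σ hσ t0 h0
    let i : Fin 7 × Fin 7 := (⟨l.1 % 7, Nat.mod_lt _ (by norm_num)⟩, ⟨l.2 % 7, Nat.mod_lt _ (by norm_num)⟩)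
    let S : Finset (Fin d.L × Fin d.L) :=
      Finset.univ.filter fun q => (q.1 : ℕ) % 7 = i.1 ∧ (q.2 : ℕ) % 7 = i.2
    let c : Fin d.L × Fin d.L → ℤ := fun q => (∑ k : Fin d.L0, p (k, q) * d.NF k t0 (7 * σ + 1)) *
      d.U (q.1 * σ + 1 * (q.1 / 7)) (q.2 * σ + 1 * (q.2 / 7))
    have hS : S.card ≤ d.m := by
      have : S.card ≤ (Finset.range (14 * d.E * d.s) ×ˢ Finset.range (14 * d.E * d.s)).card := by
        refine Finset.card_le_card_of_injOn (fun q => ((q.1 : ℕ) / 7, (q.2 : ℕ) / 7)) ?_ ?_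
        · intro q _
          have h1 : (q.1 : ℕ) < 98 * d.E * d.s := q.1.isLt
          have h2 : (q.2 : ℕ) < 98 * d.E * d.s := q.2.isLt
          have e : 98 * d.E * d.s = 7 * (14 * d.E * d.s) := by ring
          simp only [Finset.coe_product, Finset.coe_range, Set.mem_prod, Set.mem_Iio]
          constructor
          · omega
          · omega
        · intro q hq q' hq' hqq
          simp only [S, Finset.coe_filter, Finset.mem_univ, true_and, Set.mem_ofPred_eq] at hq hq'
          simp only [Prod.mk.injEq] at hqq
          ext
          · omega
          · omega
      refine this.trans (le_of_eq ?_)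
      rw [Finset.card_product, Finset.card_range]; unfold m; ring
    have hv := tri_vand S d.w c d.m hinj.injOn hS (by
      intro t1 h1
      have := h σ hσ t0 h0 t1 h1 i
      rw [Fintype.sum_prod_type, Finset.sum_comm, ← Finset.sum_filter_add_sum_filter_not Finset.univ
        (fun q : Fin d.L × Fin d.L => (q.1 : ℕ) % 7 = i.1 ∧ (q.2 : ℕ) % 7 = i.2)] at this
      rw [Finset.sum_eq_zero (s := Finset.univ.filter (fun q : Fin d.L × Fin d.L =>
        ¬ ((q.1 : ℕ) % 7 = i.1 ∧ (q.2 : ℕ) % 7 = i.2))), add_zero] at this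
      · rw [← this]
        refine Finset.sum_congr rfl fun q hq => ?_
        have hq' := (Finset.mem_filter.mp hq).2
        simp only [hq', and_self, if_true, c, Finset.sum_mul]
        refine Finset.sum_congr rfl fun k _ => ?_
        unfold ent
        ring
      · intro q hq
        have hq' := (Finset.mem_filter.mp hq).2
        refine Finset.sum_eq_zero fun k _ => if_neg hq')
    have := hv l (by simp [S, i])
    exact (mul_eq_zero.mp this).resolve_right (d.Upos _ _)
  have hN : 1 ≤ 7 * d.s := by have := d.hs0; omega
  have hDq : (d.D : ℚ) ≠ 0 := by have := d.hD1; positivity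
  have hL0 : 0 < d.L0 := by
    have := d.hs0
    have := d.hE0
    unfold L0; positivity
  let Sq : Polynomial.Sequence ℚ := ⟨triFel (7 * d.s), fun k => by
    by_cases hk : k = 0
    · subst hk
      simp [triFel]
    · have := triFel_natDegree (7 * d.s) k hN
      rw [Polynomial.degree_eq_natDegree, this]
      rintro h0
      rw [h0] at this
      simp at this
      omega⟩
  funext j
  obtain ⟨k, l⟩ := j
  have hQ : ∑ k : Fin d.L0, (p (k, l) : ℚ) • triFel (7 * d.s) k = 0 := by
    refine tri_poly_zero _ d.s d.m d.L0 ?_ ?_ ?_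
    · refine lt_of_le_of_lt (Polynomial.natDegree_sum_le_of_forall_le (n := d.L0 - 1) _ _ ?_) (by omega)
      intro k _
      refine (Polynomial.natDegree_smul_le _ _).trans ?_
      rw [triFel_natDegree _ _ hN]
      have := k.isLt
      omega
    · unfold L0 m
      have : 0 ≤ d.E ^ 2 * d.s ^ 3 := by positivity
      nlinarith
    · intro σ hσ t ht
      have h1 := key l σ hσ t ht
      have h2 : ((∑ k : Fin d.L0, p (k, l) * d.NF k t (7 * σ + 1) : ℤ) : ℚ) = 0 := by rw [h1]; simp
      push_cast at h2
      rw [Polynomial.iterate_derivative_sum, Polynomial.eval_finsetSum]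
      have h3 : (d.D : ℚ) ^ t * (∑ b : Fin d.L0, Polynomial.eval ((7 * σ + 1 : ℕ) : ℚ)
          ((⇑Polynomial.derivative)^[t] ((p (b, l) : ℚ) • triFel (7 * d.s) b))) = 0 := by
        rw [← h2, Finset.mul_sum]
        refine Finset.sum_congr rfl fun k _ => ?_
        rw [← d.NF_spec, Polynomial.iterate_derivative_smul, Polynomial.eval_smul, smul_eq_mul]
        ring
      exact (mul_eq_zero.mp h3).resolve_left (pow_ne_zero _ hDq)
  have hli := (Sq.linearIndependent).comp (fun k : Fin d.L0 => (k : ℕ)) Fin.val_injective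
  have := Fintype.linearIndependent_iff.mp hli (fun k => (p (k, l) : ℚ)) hQ k
  exact_mod_cast this

end TriD


namespace TriD
variable (d : TriD)

/-- first logarithm -/
noncomputable def l1 : ℝ := Real.log d.u1 - Real.log d.v1
/-- second logarithm -/
noncomputable def l2 : ℝ := Real.log d.u2 - Real.log d.v2
/-- the linear form -/
noncomputable def Lam : ℝ := d.b1 * d.l1 + d.b2 * d.l2
/-- scale of the frequencies -/
noncomputable def th : ℝ := d.l1 / (7 * d.b2)
/-- exact exponents -/
noncomputable def ka (l : Fin d.L × Fin d.L) : ℝ := (l.1 * d.l1 + l.2 * d.l2) / 7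
/-- error of exponents -/
noncomputable def ep (l : Fin d.L × Fin d.L) : ℝ := l.2 * d.Lam / (7 * d.b2)
/-- seventh root of first number -/
noncomputable def r1 : ℝ := Real.exp (d.l1 / 7)
/-- seventh root of second number -/
noncomputable def r2 : ℝ := Real.exp (d.l2 / 7)

lemma tri_log_sub (u v : ℕ) (s : ℝ) (hu : 1 ≤ u) (hv : 1 ≤ v) (hu' : (u : ℝ) ≤ Real.exp s)
    (hv' : (v : ℝ) ≤ Real.exp s) : |Real.log u - Real.log v| ≤ s := by
  have a1 : 0 ≤ Real.log u := Real.log_natCast_nonneg _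
  have a2 : 0 ≤ Real.log v := Real.log_natCast_nonneg _
  have a3 : Real.log u ≤ s := (Real.log_le_iff_le_exp (by positivity)).mpr hu'
  have a4 : Real.log v ≤ s := (Real.log_le_iff_le_exp (by positivity)).mpr hv'
  rw [abs_le]; constructor <;> linarith

lemma hl1 : |d.l1| ≤ d.s := tri_log_sub _ _ _ d.hu1 d.hv1 d.hu1' d.hv1'
lemma hl2 : |d.l2| ≤ d.s := tri_log_sub _ _ _ d.hu2 d.hv2 d.hu2' d.hv2'

lemma exp_l1 : Real.exp d.l1 * d.v1 = d.u1 := by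
  have h1 : (0 : ℝ) < d.u1 := by exact_mod_cast d.hu1
  have h2 : (0 : ℝ) < d.v1 := by exact_mod_cast d.hv1
  rw [l1, Real.exp_sub, Real.exp_log h1, Real.exp_log h2]
  field_simp

lemma exp_l2 : Real.exp d.l2 * d.v2 = d.u2 := by
  have h1 : (0 : ℝ) < d.u2 := by exact_mod_cast d.hu2
  have h2 : (0 : ℝ) < d.v2 := by exact_mod_cast d.hv2
  rw [l2, Real.exp_sub, Real.exp_log h1, Real.exp_log h2]
  field_simp

lemma ka_eq (hb : d.b2 ≠ 0) (l : Fin d.L × Fin d.L) : d.ka l = d.th * d.w l + d.ep l := by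
  have : (d.b2 : ℝ) ≠ 0 := by exact_mod_cast hb
  unfold ka th w ep Lam
  push_cast
  field_simp
  ring

lemma hep (hb : d.b2 ≠ 0) (l : Fin d.L × Fin d.L) : |d.ep l| ≤ d.L * |d.Lam| := by
  have h1 : (1 : ℝ) ≤ |(d.b2 : ℝ)| := by
    have := Int.one_le_abs hb
    exact_mod_cast this
  have h2 : ((l.2 : ℕ) : ℝ) ≤ d.L := by exact_mod_cast l.2.isLt.le
  unfold ep
  rw [abs_div, abs_mul, abs_mul, Nat.abs_cast, abs_of_pos (by norm_num : (0 : ℝ) < 7)]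
  rw [div_le_iff₀ (by linarith)]
  have h3 : ((l.2 : ℕ) : ℝ) * |d.Lam| ≤ d.L * |d.Lam| := by gcongr
  have h4 : 0 ≤ (d.L : ℝ) * |d.Lam| := by positivity
  nlinarith

lemma hka (l : Fin d.L × Fin d.L) : |d.ka l| ≤ 28 * (d.E * d.s ^ 2) := by
  have h2 : ((l.2 : ℕ) : ℝ) ≤ d.L := by exact_mod_cast l.2.isLt.le
  have h1 : ((l.1 : ℕ) : ℝ) ≤ d.L := by exact_mod_cast l.1.isLt.le
  have e1 : |((l.1 : ℕ) : ℝ) * d.l1| ≤ d.L * d.s := by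
    rw [abs_mul, Nat.abs_cast]
    exact mul_le_mul h1 d.hl1 (abs_nonneg _) (by positivity)
  have e2 : |((l.2 : ℕ) : ℝ) * d.l2| ≤ d.L * d.s := by
    rw [abs_mul, Nat.abs_cast]
    exact mul_le_mul h2 d.hl2 (abs_nonneg _) (by positivity)
  unfold ka
  rw [abs_div, abs_of_pos (by norm_num : (0 : ℝ) < 7), div_le_iff₀ (by norm_num)]
  refine (abs_add_le _ _).trans ?_
  have : (d.L : ℝ) = 98 * d.E * d.s := by unfold L; push_cast; ring
  rw [this] at e1 e2
  nlinarith

lemma tri_exp_aux (ℓ u v : ℝ) (h : Real.exp ℓ * v = u) (N l σ δ : ℕ) (hδ : δ ≤ 1)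
    (he : l * σ + δ * (l / 7) ≤ N) :
    v ^ N * Real.exp (l * ℓ / 7 * (7 * σ + δ)) =
      u ^ (l * σ + δ * (l / 7)) * v ^ (N - (l * σ + δ * (l / 7))) * (Real.exp (ℓ / 7) ^ (l % 7)) ^ δ := by
  have e1 : Real.exp (l * ℓ / 7 * (7 * σ + δ)) =
      Real.exp ℓ ^ (l * σ + δ * (l / 7)) * (Real.exp (ℓ / 7) ^ (l % 7)) ^ δ := by
    rw [← Real.exp_nat_mul, ← Real.exp_nat_mul, ← Real.exp_nat_mul, ← Real.exp_add]
    congr 1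
    have hl : (l : ℝ) = 7 * ((l / 7 : ℕ) : ℝ) + ((l % 7 : ℕ) : ℝ) := by
      exact_mod_cast (Nat.div_add_mod l 7).symm
    push_cast
    have : ∀ x y z : ℝ, x = 7 * y + z → x * ℓ / 7 * (7 * σ + δ) = (x * σ + δ * y) * ℓ + δ * (z * (ℓ / 7)) := by
      rintro x y z rfl; ring
    exact this _ _ _ hl
  rw [e1, ← h]
  generalize l * σ + δ * (l / 7) = e at *
  obtain ⟨q, rfl⟩ := Nat.exists_eq_add_of_le he
  rw [Nat.add_sub_cancel_left, mul_pow, pow_add]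
  ring

/-- derivative of Feldman polynomial, complex -/
noncomputable def P (k : ℕ) : Polynomial ℂ := (triFel (7 * d.s) k).map (algebraMap ℚ ℂ)

lemma ent_spec (δ σ t0 t1 : ℕ) (hδ : δ ≤ 1) (hσ : σ < d.s) (j : d.J) :
    (d.D : ℂ) ^ t0 * ((d.v1 : ℂ) * d.v2) ^ (d.L * d.s) *
      ((d.w j.2 : ℂ) ^ t1 * (Polynomial.derivative^[t0] (d.P j.1)).eval ((7 * σ + δ : ℕ) : ℂ) *
        ((Real.exp (d.ka j.2 * (7 * σ + δ)) : ℝ) : ℂ)) =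
      (d.ent δ σ t0 t1 j : ℂ) * (((d.r1 ^ ((j.2.1 : ℕ) % 7) * d.r2 ^ ((j.2.2 : ℕ) % 7)) ^ δ : ℝ) : ℂ) := by
  have h1 := tri_exp_aux d.l1 d.u1 d.v1 d.exp_l1 (d.L * d.s) j.2.1 σ δ hδ (d.he_aux δ σ _ hδ hσ j.2.1.isLt)
  have h2 := tri_exp_aux d.l2 d.u2 d.v2 d.exp_l2 (d.L * d.s) j.2.2 σ δ hδ (d.he_aux δ σ _ hδ hσ j.2.2.isLt)
  have h3 : ((d.v1 : ℝ) * d.v2) ^ (d.L * d.s) * Real.exp (d.ka j.2 * (7 * σ + δ)) =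
      d.U (j.2.1 * σ + δ * (j.2.1 / 7)) (j.2.2 * σ + δ * (j.2.2 / 7)) *
      (d.r1 ^ ((j.2.1 : ℕ) % 7) * d.r2 ^ ((j.2.2 : ℕ) % 7)) ^ δ := by
    have : Real.exp (d.ka j.2 * (7 * σ + δ)) =
        Real.exp ((j.2.1 : ℕ) * d.l1 / 7 * (7 * σ + δ)) * Real.exp ((j.2.2 : ℕ) * d.l2 / 7 * (7 * σ + δ)) := by
      rw [← Real.exp_add]; congr 1; unfold ka; ring
    rw [this, mul_pow, mul_mul_mul_comm, h1, h2]
    unfold U r1 r2; push_cast; ring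
  have h3' := congrArg (fun x : ℝ => (x : ℂ)) h3
  simp only [Complex.ofReal_mul, Complex.ofReal_pow, Complex.ofReal_natCast, Complex.ofReal_intCast] at h3'
  have h4 := d.NF_spec' j.1 t0 (7 * σ + δ)
  unfold ent
  push_cast at h4 h3' ⊢
  calc _ = (d.w j.2 : ℂ) ^ t1 * ((d.D : ℂ) ^ t0 * (Polynomial.derivative^[t0] (d.P j.1)).eval (7 * (σ : ℂ) + δ)) *
        (((d.v1 : ℂ) * d.v2) ^ (d.L * d.s) * Complex.exp (d.ka j.2 * (7 * σ + δ))) := by ring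
    _ = _ := by
      rw [h3', P, h4]; ring

/-- auxiliary functions -/
noncomputable def Phi (p : d.J → ℤ) (t0 t1 : ℕ) (c : d.J → ℂ) (z : ℂ) : ℂ :=
  ∑ j, (p j : ℂ) * (d.w j.2 : ℂ) ^ t1 * (Polynomial.derivative^[t0] (d.P j.1)).eval z *
    (Complex.exp ((d.th : ℂ) * d.w j.2 * z) * c j)

lemma Phi_diff (p : d.J → ℤ) (t0 t1 : ℕ) (c : d.J → ℂ) : Differentiable ℂ (d.Phi p t0 t1 c) := by
  unfold Phi
  fun_prop

lemma Phi_spec (hb : d.b2 ≠ 0) (p : d.J → ℤ) (t0 t1 δ σ : ℕ) (hδ : δ ≤ 1) (hσ : σ < d.s) :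
    (d.D : ℂ) ^ t0 * ((d.v1 : ℂ) * d.v2) ^ (d.L * d.s) *
      d.Phi p t0 t1 (fun j => ((Real.exp ((7 * σ + δ) * d.ep j.2) : ℝ) : ℂ)) ((7 * σ + δ : ℕ) : ℂ) =
    ∑ j, ((p j * d.ent δ σ t0 t1 j : ℤ) : ℂ) *
      (((d.r1 ^ ((j.2.1 : ℕ) % 7) * d.r2 ^ ((j.2.2 : ℕ) % 7)) ^ δ : ℝ) : ℂ) := by
  unfold Phi
  rw [Finset.mul_sum]
  refine Finset.sum_congr rfl fun j _ => ?_
  rw [Int.cast_mul, mul_assoc (p j : ℂ) (d.ent δ σ t0 t1 j : ℂ), ← d.ent_spec δ σ t0 t1 hδ hσ j]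
  have : Complex.exp ((d.th : ℂ) * d.w j.2 * ((7 * σ + δ : ℕ) : ℂ)) *
      ((Real.exp ((7 * σ + δ) * d.ep j.2) : ℝ) : ℂ) = ((Real.exp (d.ka j.2 * (7 * σ + δ)) : ℝ) : ℂ) := by
    rw [Complex.ofReal_exp, ← Complex.exp_add, Complex.ofReal_exp]
    congr 1
    rw [d.ka_eq hb]
    push_cast
    ring
  rw [this]
  ring

end TriD


namespace TriD
variable (d : TriD)

/-- smallness assumption -/
def Small : Prop := |d.Lam| ≤ Real.exp (-(25000 * (d.E * d.Z)))

/-- main bound -/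
noncomputable def B0 : ℝ := Real.exp (49 * d.Z * Real.log d.E + 24100 * d.Z)

lemma hEZ : 14000 * d.Z ≤ d.E * d.Z := by
  have := d.hE1
  have := d.hZ1
  gcongr

lemma small_aux (h : d.Small) : (14 * d.E * d.s * d.s * d.L : ℝ) * |d.Lam| ≤ Real.exp (-(24999 * (d.E * d.Z))) := by
  have hE := d.hE1
  have hs := d.hs1
  have hEs := d.hEs
  have h1 : (14 * d.E * d.s * d.s * d.L : ℝ) ≤ d.s ^ 6 := by
    unfold L; push_cast
    calc (14 * d.E * d.s * d.s * (98 * d.E * d.s) : ℝ) = 1372 * d.E ^ 2 * d.s ^ 3 := by ring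
      _ ≤ d.s * d.s ^ 2 * d.s ^ 3 := by gcongr; linarith
      _ = _ := by ring
  have h2 := tri_pow_exp 6 (by positivity) d.hsexp
  have h3 := tri_mul_exp (abs_nonneg _) (h1.trans h2) h
  refine h3.trans (Real.exp_le_exp.mpr ?_)
  have := d.hZs5
  have := d.hEZ
  push_cast
  linarith

lemma ep_small (hb : d.b2 ≠ 0) (h : d.Small) (l : Fin d.L × Fin d.L) :
    7 * d.E * d.s * |d.ep l| ≤ 1 := by
  have h1 := d.small_aux h
  have h2 := d.hep hb l
  have h3 : Real.exp (-(24999 * (d.E * d.Z))) ≤ 1 := by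
    rw [Real.exp_le_one_iff]
    have := d.hEZ
    have := d.hZ1
    linarith
  have hs := d.hs1
  have hE := d.hE1
  have h4 : (7 * d.E * d.s : ℝ) * |d.ep l| ≤ 7 * d.E * d.s * (d.L * |d.Lam|) := by gcongr
  refine h4.trans (le_trans ?_ (h1.trans h3))
  have : (0 : ℝ) ≤ d.E * d.s * (d.L * |d.Lam|) := by positivity
  nlinarith

lemma Phi_term (hb : d.b2 ≠ 0) (h : d.Small) (p : d.J → ℤ) (hp : ∀ j, |(p j : ℝ)| ≤ Real.exp (20201 * d.Z))
    (t0 t1 : ℕ) (h0 : t0 ≤ 2 * d.m) (h1 : t1 ≤ 2 * d.m) (z : ℂ) (hz : ‖z‖ ≤ 7 * d.E * d.s) (j : d.J) :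
    ‖(p j : ℂ) * (d.w j.2 : ℂ) ^ t1 * (Polynomial.derivative^[t0] (d.P j.1)).eval z *
      Complex.exp ((d.th : ℂ) * d.w j.2 * z)‖ ≤
      Real.exp (20201 * d.Z + 1568 * d.Z + (1960 * d.Z + (49 * d.Z * Real.log d.E + 99 * d.Z)) + 197 * d.Z) := by
  rw [norm_mul, norm_mul, norm_mul, norm_pow, Complex.norm_intCast, Complex.norm_intCast]
  have e1 := (d.felR j.1 t0 j.1.isLt h0 z hz).trans (tri_mul_exp (Real.exp_pos _).le (d.hfact t0 h0) le_rfl)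
  have e2 : ‖Complex.exp ((d.th : ℂ) * d.w j.2 * z)‖ ≤ Real.exp (197 * d.Z) := by
    refine (Complex.norm_exp_le_exp_norm _).trans (Real.exp_le_exp.mpr ?_)
    rw [norm_mul]
    have a1 : (d.th : ℂ) * d.w j.2 = ((d.ka j.2 - d.ep j.2 : ℝ) : ℂ) := by
      rw [d.ka_eq hb]; push_cast; ring
    rw [a1, Complex.norm_real, Real.norm_eq_abs]
    have a2 := d.hka j.2
    have a3 := d.ep_small hb h j.2
    have a4 : |d.ka j.2 - d.ep j.2| ≤ 28 * (d.E * d.s ^ 2) + |d.ep j.2| :=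
      (abs_sub _ _).trans (by linarith)
    have a5 : |d.ka j.2 - d.ep j.2| * ‖z‖ ≤ (28 * (d.E * d.s ^ 2) + |d.ep j.2|) * (7 * d.E * d.s) := by
      gcongr
    have a6 : (28 * ((d.E : ℝ) * d.s ^ 2)) * (7 * d.E * d.s) = 196 * d.Z := by unfold Z; ring
    have := d.hZ1
    nlinarith
  exact tri_mul_exp (norm_nonneg _) (tri_mul_exp (norm_nonneg _) (tri_mul_exp (by positivity) (hp j)
    (d.hwpow j.2 t1 h1)) e1) e2

lemma Phi_bound (hb : d.b2 ≠ 0) (h : d.Small) (p : d.J → ℤ) (hp : ∀ j, |(p j : ℝ)| ≤ Real.exp (20201 * d.Z))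
    (t0 t1 : ℕ) (h0 : t0 ≤ 2 * d.m) (h1 : t1 ≤ 2 * d.m) (z : ℂ) (hz : ‖z‖ ≤ 7 * d.E * d.s)
    (c : d.J → ℂ) (ε : ℝ) (hε : 0 ≤ ε) (hc : ∀ j, ‖c j‖ ≤ ε) : ‖d.Phi p t0 t1 c z‖ ≤ d.B0 * ε := by
  unfold Phi
  refine (norm_sum_le _ _).trans ?_
  have : ∀ j ∈ (Finset.univ : Finset d.J), ‖(p j : ℂ) * (d.w j.2 : ℂ) ^ t1 *
      (Polynomial.derivative^[t0] (d.P j.1)).eval z *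
      (Complex.exp ((d.th : ℂ) * d.w j.2 * z) * c j)‖ ≤ Real.exp (20201 * d.Z + 1568 * d.Z +
        (1960 * d.Z + (49 * d.Z * Real.log d.E + 99 * d.Z)) + 197 * d.Z) * ε := by
    intro j _
    rw [← mul_assoc, norm_mul]
    exact mul_le_mul (d.Phi_term hb h p hp t0 t1 h0 h1 z hz j) (hc j) (norm_nonneg _) (Real.exp_pos _).le
  refine (Finset.sum_le_card_nsmul _ _ _ this).trans ?_
  rw [nsmul_eq_mul, ← mul_assoc, Finset.card_univ]
  refine mul_le_mul_of_nonneg_right ?_ hε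
  refine (tri_mul_exp (Real.exp_pos _).le d.hcardJ le_rfl).trans (Real.exp_le_exp.mpr ?_)
  have := d.hZ1
  linarith

lemma Phi_sub (p : d.J → ℤ) (t0 t1 : ℕ) (c c' : d.J → ℂ) (z : ℂ) :
    d.Phi p t0 t1 c z - d.Phi p t0 t1 c' z = d.Phi p t0 t1 (fun j => c j - c' j) z := by
  unfold Phi
  rw [← Finset.sum_sub_distrib]
  exact Finset.sum_congr rfl fun _ _ => by ring

lemma Phi_order (hb : d.b2 ≠ 0) (p : d.J → ℤ)
    (hp : ∀ σ < d.s, ∀ t0 < 2 * d.m, ∀ t1 < 2 * d.m, ∑ j, p j * d.ent 0 σ t0 t1 j = 0)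
    (σ : ℕ) (hσ : σ < d.s) (t0 t1 : ℕ) (h0 : t0 ≤ d.m) (h1 : t1 ≤ d.m) :
    (d.m : ℕ∞) ≤ analyticOrderAt
      (d.Phi p t0 t1 (fun j => ((Real.exp ((7 * σ + (0 : ℕ)) * d.ep j.2) : ℝ) : ℂ))) (7 * σ) := by
  refine tri_order_phi (J := d.J) (fun j => d.P j.1) (fun j => (p j : ℂ)) (fun j => (d.w j.2 : ℂ)) _
    (d.th : ℂ) (7 * σ) d.m t0 t1 h0 h1 ?_
  intro u0 hu0 u1 hu1
  have h := d.Phi_spec hb p u0 u1 0 σ (by norm_num) hσ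
  simp only [pow_zero, Complex.ofReal_one, mul_one] at h
  rw [← Int.cast_sum, hp σ hσ u0 hu0 u1 hu1, Int.cast_zero] at h
  have hD : (d.D : ℂ) ≠ 0 := by
    have := d.hD1
    exact_mod_cast (by omega : d.D ≠ 0)
  have hv1 : (d.v1 : ℂ) ≠ 0 := by
    have := d.hv1
    exact_mod_cast (by omega : d.v1 ≠ 0)
  have hv2 : (d.v2 : ℂ) ≠ 0 := by
    have := d.hv2
    exact_mod_cast (by omega : d.v2 ≠ 0)
  have h' := (mul_eq_zero.mp h).resolve_left (by positivity)
  unfold Phi at h'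
  convert h' using 6 <;> push_cast <;> ring

lemma exp_ep (hb : d.b2 ≠ 0) (h : d.Small) (x : ℝ) (hx0 : 0 ≤ x) (hx : x ≤ 7 * d.s) (j : d.J) :
    ‖((Real.exp (x * d.ep j.2) : ℝ) : ℂ) - 1‖ ≤ 14 * d.s * d.L * |d.Lam| := by
  have hs := d.hs1
  have hE := d.hE1
  have h1 := d.ep_small hb h j.2
  have h2 := d.hep hb j.2
  have h3 : |x * d.ep j.2| ≤ 7 * d.s * |d.ep j.2| := by
    rw [abs_mul, abs_of_nonneg hx0]; gcongr
  have h4 : 7 * d.s * |d.ep j.2| ≤ 1 := by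
    refine le_trans ?_ h1
    have : (0 : ℝ) ≤ d.s * |d.ep j.2| := by positivity
    nlinarith
  rw [← Complex.ofReal_one, ← Complex.ofReal_sub, Complex.norm_real, Real.norm_eq_abs]
  refine (Real.abs_exp_sub_one_le (h3.trans h4)).trans ?_
  have h5 : 7 * d.s * |d.ep j.2| ≤ 7 * d.s * (d.L * |d.Lam|) := by gcongr
  linarith

lemma Kbound : (3 * Real.exp (7 * (7 * d.E * d.s + d.s))) ^ (2 * d.m) ≤ Real.exp (22344 * (d.E * d.Z)) := by
  have hs := d.hs1
  have hE := d.hE1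
  have h3 : (3 : ℝ) ≤ Real.exp 2 := by
    have := Real.add_one_le_exp 2
    linarith
  have h1 := tri_mul_exp (Real.exp_pos _).le h3 (le_refl (Real.exp (7 * (7 * d.E * d.s + d.s))))
  refine (tri_pow_exp (2 * d.m) (by positivity) h1).trans (Real.exp_le_exp.mpr ?_)
  have h2 := d.hm2
  have h4 : (2 : ℝ) + 7 * (7 * d.E * d.s + d.s) ≤ 57 * d.E * d.s := by nlinarith
  have h5 : ((2 * d.m : ℕ) : ℝ) * (2 + 7 * (7 * d.E * d.s + d.s)) ≤ ((2 * d.m : ℕ) : ℝ) * (57 * d.E * d.s) := by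
    gcongr
  refine h5.trans (le_of_eq ?_)
  calc ((2 * d.m : ℕ) : ℝ) * (57 * d.E * d.s) = (((2 * d.m : ℕ) : ℝ) * d.s) * (57 * d.E) := by ring
    _ = _ := by rw [h2]; ring

set_option maxHeartbeats 2000000 in
lemma xi_bound (hb : d.b2 ≠ 0) (h : d.Small) (p : d.J → ℤ) (hpb : ∀ j, |(p j : ℝ)| ≤ Real.exp (20201 * d.Z))
    (hp : ∀ σ < d.s, ∀ t0 < 2 * d.m, ∀ t1 < 2 * d.m, ∑ j, p j * d.ent 0 σ t0 t1 j = 0)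
    (σ : ℕ) (hσ : σ < d.s) (t0 t1 : ℕ) (h0 : t0 < d.m) (h1 : t1 < d.m) :
    ‖d.Phi p t0 t1 (fun j => ((Real.exp ((7 * σ + (1 : ℕ)) * d.ep j.2) : ℝ) : ℂ)) ((7 * σ + 1 : ℕ) : ℂ)‖ ≤
      Real.exp (24300 * d.Z - 147 * d.Z * Real.log d.E) := by
  have hs := d.hs1
  have hE := d.hE1
  have hZ := d.hZ1
  have hlogE : Real.log d.E ≤ d.E := (Real.log_le_self (by positivity))
  have hm1 : 1 ≤ d.m := by omega
  set η : ℝ := d.B0 * (14 * d.s * d.L * |d.Lam|) with hη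
  have hB0 : 0 < d.B0 := Real.exp_pos _
  have hη0 : 0 ≤ η := by positivity
  set K : ℝ := (3 * Real.exp (7 * (7 * d.E * d.s + d.s))) ^ (2 * d.m) with hK
  have hK0 : 0 ≤ K := by positivity
  have hx : ((7 * σ + 1 : ℕ) : ℝ) ≤ 7 * d.s := by
    exact_mod_cast (by omega : 7 * σ + 1 ≤ 7 * d.s)
  have hx2 : (7 * d.s : ℝ) ≤ 7 * d.E * d.s := by nlinarith
  have hsch := tri_schwarz d.s d.m d.hs0 hm1 (7 * d.E * d.s) (d.Phi p t0 t1 (fun _ => 1))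
    (fun σ => d.Phi p t0 t1 (fun j => ((Real.exp ((7 * σ + (0 : ℕ)) * d.ep j.2) : ℝ) : ℂ)))
    (d.Phi_diff _ _ _ _) (fun σ _ => d.Phi_diff _ _ _ _)
    (fun σ hσ => d.Phi_order hb p hp σ hσ t0 t1 h0.le h1.le) d.B0 η
    (fun z hz => by
      have := d.Phi_bound hb h p hpb t0 t1 (by omega) (by omega) z hz (fun _ => 1) 1 (by norm_num) (by simp)
      simpa using this)
    (fun σ hσ z hz => by
      rw [Phi_sub]
      refine d.Phi_bound hb h p hpb t0 t1 (by omega) (by omega) z hz _ _ (by positivity) (fun j => ?_)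
      refine d.exp_ep hb h _ (by positivity) ?_ j
      push_cast
      have : (σ : ℝ) ≤ d.s := by exact_mod_cast hσ.le
      linarith)
    (by nlinarith) ((7 * σ + 1 : ℕ) : ℝ) (by positivity) hx
  rw [← hK] at hsch
  -- compare
  have hxi : ‖d.Phi p t0 t1 (fun j => ((Real.exp ((7 * σ + (1 : ℕ)) * d.ep j.2) : ℝ) : ℂ)) ((7 * σ + 1 : ℕ) : ℂ)
      - d.Phi p t0 t1 (fun _ => 1) ((7 * σ + 1 : ℕ) : ℂ)‖ ≤ η := by
    rw [Phi_sub]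
    refine d.Phi_bound hb h p hpb t0 t1 (by omega) (by omega) _ ?_ _ _ (by positivity) (fun j => ?_)
    · rw [Complex.norm_natCast]; linarith
    · refine d.exp_ep hb h _ (by positivity) ?_ j
      push_cast at hx ⊢
      linarith
  -- smallness of error terms
  set δ : ℝ := d.B0 * Real.exp (-(196 * d.Z * Real.log d.E)) with hδ
  have hEZ := d.hEZ
  have hlZ : 196 * d.Z * Real.log d.E ≤ 196 * (d.E * d.Z) := by
    have := mul_le_mul_of_nonneg_left hlogE (by linarith : (0 : ℝ) ≤ 196 * d.Z)
    linarith
  have hsm := d.small_aux h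
  have hsm2 : (d.s : ℝ) * (14 * d.s * d.L * |d.Lam|) ≤ Real.exp (-(24999 * (d.E * d.Z))) := by
    refine le_trans ?_ hsm
    have : (0 : ℝ) ≤ d.s * (14 * d.s * d.L * |d.Lam|) := by positivity
    nlinarith
  have hsm3 : (14 * d.s * d.L * |d.Lam|) ≤ Real.exp (-(24999 * (d.E * d.Z))) := by
    refine le_trans ?_ hsm2
    have : (0 : ℝ) ≤ (14 * d.s * d.L * |d.Lam|) := by positivity
    nlinarith
  have h1' : (d.s : ℝ) * (η * K) ≤ δ := by
    have := tri_mul_exp hK0 hsm2 d.Kbound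
    calc (d.s : ℝ) * (η * K) = d.B0 * ((d.s : ℝ) * (14 * d.s * d.L * |d.Lam|) * K) := by rw [hη]; ring
      _ ≤ d.B0 * Real.exp (-(196 * d.Z * Real.log d.E)) := by
        gcongr
        exact this.trans (Real.exp_le_exp.mpr (by linarith))
  have h2' : η ≤ δ := by
    rw [hη, hδ]
    gcongr
    exact hsm3.trans (Real.exp_le_exp.mpr (by linarith))
  have h3' : (7 * (d.s : ℝ) / (7 * d.E * d.s - 7 * d.s)) ^ (d.m * d.s) ≤
      Real.exp (196 * d.Z - 196 * d.Z * Real.log d.E) := by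
    have e1 : 7 * (d.s : ℝ) / (7 * d.E * d.s - 7 * d.s) ≤ Real.exp (1 - Real.log d.E) := by
      rw [Real.exp_sub, Real.exp_log (by linarith), div_le_div_iff₀ (by nlinarith) (by linarith)]
      have h2 : (2 : ℝ) ≤ Real.exp 1 := by
        have := Real.add_one_le_exp 1
        linarith
      have h4 : (0 : ℝ) ≤ 7 * d.E * d.s - 7 * d.s := by nlinarith
      nlinarith
    have e2 := tri_pow_exp (d.m * d.s) (div_nonneg (by positivity) (by nlinarith)) e1
    refine e2.trans (Real.exp_le_exp.mpr (le_of_eq ?_))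
    have : ((d.m * d.s : ℕ) : ℝ) = 196 * d.Z := by unfold m Z; push_cast; ring
    rw [this]; ring
  have h4' : δ ≤ d.B0 * Real.exp (196 * d.Z - 196 * d.Z * Real.log d.E) := by
    rw [hδ]; gcongr; linarith
  have h5' : δ ≤ d.B0 := by
    rw [hδ]
    have : Real.exp (-(196 * d.Z * Real.log d.E)) ≤ 1 := by
      rw [Real.exp_le_one_iff]
      have : 0 ≤ Real.log d.E := Real.log_natCast_nonneg _
      have : 0 ≤ d.Z * Real.log d.E := by positivity
      linarith
    nlinarith
  have h6' : (d.B0 + d.s * (η * K)) * (7 * (d.s : ℝ) / (7 * d.E * d.s - 7 * d.s)) ^ (d.m * d.s) ≤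
      (2 * d.B0) * Real.exp (196 * d.Z - 196 * d.Z * Real.log d.E) := by
    refine mul_le_mul (by linarith) h3' (pow_nonneg (div_nonneg (by positivity) (by nlinarith)) _) (by positivity)
  have h7' : ‖d.Phi p t0 t1 (fun j => ((Real.exp ((7 * σ + (1 : ℕ)) * d.ep j.2) : ℝ) : ℂ)) ((7 * σ + 1 : ℕ) : ℂ)‖
      ≤ 4 * (d.B0 * Real.exp (196 * d.Z - 196 * d.Z * Real.log d.E)) := by
    have a := norm_le_norm_add_norm_sub' (d.Phi p t0 t1 (fun j => ((Real.exp ((7 * σ + (1 : ℕ)) * d.ep j.2) : ℝ) : ℂ)) ((7 * σ + 1 : ℕ) : ℂ)) (d.Phi p t0 t1 (fun _ => 1) ((7 * σ + 1 : ℕ) : ℂ))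
    rw [Complex.ofReal_natCast] at hsch
    linarith
  refine h7'.trans ?_
  rw [B0, ← Real.exp_add]
  have h8 : (4 : ℝ) ≤ Real.exp 3 := by
    have := Real.add_one_le_exp 3
    linarith
  refine (tri_mul_exp (Real.exp_pos _).le h8 le_rfl).trans (Real.exp_le_exp.mpr ?_)
  linarith

end TriD


lemma tri_carry (r u v : ℝ) (h : r ^ 7 * v = u) (i j : Fin 7) :
    v * (r ^ (i : ℕ) * r ^ (j : ℕ)) =
      (if (i : ℕ) + j < 7 then v else u) * r ^ ((i + j : Fin 7) : ℕ) := by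
  rw [Fin.val_add, ← pow_add]
  have hi := i.isLt
  have hj := j.isLt
  split_ifs with h1
  · rw [Nat.mod_eq_of_lt h1]
  · have e : ((i : ℕ) + j) = 7 + ((i : ℕ) + j) % 7 := by omega
    conv_lhs => rw [e, pow_add]
    rw [← h]; ring

namespace TriD
variable (d : TriD)

/-- coefficients in the basis of radicals -/
noncomputable def cc (p : d.J → ℤ) (σ t0 t1 : ℕ) (i : Fin 7 × Fin 7) : ℤ :=
  ∑ j : d.J, (if (j.2.1 : ℕ) % 7 = i.1 ∧ (j.2.2 : ℕ) % 7 = i.2 then p j * d.ent 1 σ t0 t1 j else 0)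

lemma cc_sum (p : d.J → ℤ) (σ t0 t1 : ℕ) :
    ∑ j, ((p j * d.ent 1 σ t0 t1 j : ℤ) : ℝ) * (d.r1 ^ ((j.2.1 : ℕ) % 7) * d.r2 ^ ((j.2.2 : ℕ) % 7)) =
      ∑ i, (d.cc p σ t0 t1 i : ℝ) * (d.r1 ^ (i.1 : ℕ) * d.r2 ^ (i.2 : ℕ)) := by
  unfold cc
  simp only [Int.cast_sum, Finset.sum_mul]
  rw [Finset.sum_comm]
  refine Finset.sum_congr rfl fun j _ => ?_
  rw [Finset.sum_eq_single ((⟨(j.2.1 : ℕ) % 7, Nat.mod_lt _ (by norm_num)⟩ : Fin 7),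
    (⟨(j.2.2 : ℕ) % 7, Nat.mod_lt _ (by norm_num)⟩ : Fin 7))]
  · simp
  · intro i _ hi
    rw [if_neg, Int.cast_zero, zero_mul]
    rintro ⟨h1, h2⟩
    exact hi (Prod.ext (Fin.ext h1.symm) (Fin.ext h2.symm))
  · simp

lemma cc_bound (p : d.J → ℤ) (hpb : ∀ j, |(p j : ℝ)| ≤ Real.exp (20201 * d.Z))
    (σ t0 t1 : ℕ) (hσ : σ < d.s) (h0 : t0 < d.m) (h1 : t1 < d.m) (i : Fin 7 × Fin 7) :
    |(d.cc p σ t0 t1 i : ℝ)| ≤ Real.exp (40402 * d.Z) := by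
  unfold cc
  rw [Int.cast_sum]
  refine (Finset.abs_sum_le_sum_abs _ _).trans ?_
  have : ∀ j ∈ (Finset.univ : Finset d.J), |((if (j.2.1 : ℕ) % 7 = i.1 ∧ (j.2.2 : ℕ) % 7 = i.2
      then p j * d.ent 1 σ t0 t1 j else 0 : ℤ) : ℝ)| ≤ Real.exp (20201 * d.Z + 20200 * d.Z) := by
    intro j _
    split_ifs
    · push_cast
      rw [abs_mul]
      exact tri_mul_exp (abs_nonneg _) (hpb j) (d.hent 1 σ t0 t1 le_rfl hσ (by omega) (by omega) j)
    · simp [Real.exp_nonneg]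
  refine (Finset.sum_le_card_nsmul _ _ _ this).trans ?_
  rw [nsmul_eq_mul, Finset.card_univ]
  refine (tri_mul_exp (Real.exp_pos _).le d.hcardJ le_rfl).trans (Real.exp_le_exp.mpr ?_)
  linarith

lemma r1_7 : d.r1 ^ 7 * d.v1 = d.u1 := by
  rw [r1, ← Real.exp_nat_mul, ← d.exp_l1]; congr 2; push_cast; ring
lemma r2_7 : d.r2 ^ 7 * d.v2 = d.u2 := by
  rw [r2, ← Real.exp_nat_mul, ← d.exp_l2]; congr 2; push_cast; ring

lemma cc_small (hb : d.b2 ≠ 0) (h : d.Small) (p : d.J → ℤ)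
    (hpb : ∀ j, |(p j : ℝ)| ≤ Real.exp (20201 * d.Z))
    (hp : ∀ σ < d.s, ∀ t0 < 2 * d.m, ∀ t1 < 2 * d.m, ∑ j, p j * d.ent 0 σ t0 t1 j = 0)
    (σ : ℕ) (hσ : σ < d.s) (t0 t1 : ℕ) (h0 : t0 < d.m) (h1 : t1 < d.m) :
    |∑ i, (d.cc p σ t0 t1 i : ℝ) * (d.r1 ^ (i.1 : ℕ) * d.r2 ^ (i.2 : ℕ))| ≤
      Real.exp (40765 * d.Z - 147 * d.Z * Real.log d.E) := by
  have h1' := d.Phi_spec hb p t0 t1 1 σ le_rfl hσ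
  have h2' := d.xi_bound hb h p hpb hp σ hσ t0 t1 h0 h1
  rw [← d.cc_sum]
  have h3a : ((∑ j, ((p j * d.ent 1 σ t0 t1 j : ℤ) : ℝ) * (d.r1 ^ ((j.2.1 : ℕ) % 7) *
      d.r2 ^ ((j.2.2 : ℕ) % 7)) : ℝ) : ℂ) = ∑ j, ((p j * d.ent 1 σ t0 t1 j : ℤ) : ℂ) *
      (((d.r1 ^ ((j.2.1 : ℕ) % 7) * d.r2 ^ ((j.2.2 : ℕ) % 7)) ^ 1 : ℝ) : ℂ) := by
    rw [Complex.ofReal_sum]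
    refine Finset.sum_congr rfl fun j _ => ?_
    rw [pow_one, Complex.ofReal_mul, Complex.ofReal_intCast]
  have h3 := h3a.trans h1'.symm
  rw [← Real.norm_eq_abs, ← Complex.norm_real, h3, norm_mul, norm_mul, norm_pow, norm_pow,
    Complex.norm_natCast, norm_mul, Complex.norm_natCast, Complex.norm_natCast]
  have a1 := d.hDpow t0 (by omega)
  have a2 := tri_pow_exp (d.L * d.s) (by positivity) (tri_mul_exp (by positivity) d.hv1' d.hv2')
  refine (tri_mul_exp (norm_nonneg _) (tri_mul_exp (by positivity) a1 a2) h2').trans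
    (Real.exp_le_exp.mpr ?_)
  have h4 : ((d.L * d.s : ℕ) : ℝ) * (d.s + d.s) = 196 * (d.E * d.s ^ 3) := by
    unfold L; push_cast; ring
  rw [h4]
  have := d.hZs2
  have : (0 : ℝ) ≤ d.E * d.s ^ 3 := by positivity
  linarith

lemma cc_zero (hb : d.b2 ≠ 0) (h : d.Small) (hind : TriIndep ((d.u1 : ℚ) / d.v1) ((d.u2 : ℚ) / d.v2))
    (p : d.J → ℤ)
    (hpb : ∀ j, |(p j : ℝ)| ≤ Real.exp (20201 * d.Z))
    (hp : ∀ σ < d.s, ∀ t0 < 2 * d.m, ∀ t1 < 2 * d.m, ∑ j, p j * d.ent 0 σ t0 t1 j = 0)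
    (σ : ℕ) (hσ : σ < d.s) (t0 t1 : ℕ) (h0 : t0 < d.m) (h1 : t1 < d.m) :
    d.cc p σ t0 t1 = 0 := by
  by_contra hc
  have hs := d.hs1
  have hZ := d.hZ1
  have q1 : (0 : ℚ) < d.u1 := by exact_mod_cast d.hu1
  have q2 : (0 : ℚ) < d.v1 := by exact_mod_cast d.hv1
  have q3 : (0 : ℚ) < d.u2 := by exact_mod_cast d.hu2
  have q4 : (0 : ℚ) < d.v2 := by exact_mod_cast d.hv2
  have p2 : (0 : ℝ) < d.v1 := by exact_mod_cast d.hv1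
  have p4 : (0 : ℝ) < d.v2 := by exact_mod_cast d.hv2
  have p1 : (1 : ℝ) ≤ d.u1 := by exact_mod_cast d.hu1
  have p3 : (1 : ℝ) ≤ d.u2 := by exact_mod_cast d.hu2
  have hr1 : ∀ i : Fin 7, d.r1 ^ (i : ℕ) ≤ Real.exp d.s := by
    intro i
    rw [r1, ← Real.exp_nat_mul, Real.exp_le_exp]
    have hi : ((i : ℕ) : ℝ) ≤ 7 := by exact_mod_cast i.isLt.le
    have h0 : (0 : ℝ) ≤ (i : ℕ) := by positivity
    have h2 := (abs_le.mp d.hl1).2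
    nlinarith
  have hr2 : ∀ i : Fin 7, d.r2 ^ (i : ℕ) ≤ Real.exp d.s := by
    intro i
    rw [r2, ← Real.exp_nat_mul, Real.exp_le_exp]
    have hi : ((i : ℕ) : ℝ) ≤ 7 := by exact_mod_cast i.isLt.le
    have h0 : (0 : ℝ) ≤ (i : ℕ) := by positivity
    have h2 := (abs_le.mp d.hl2).2
    nlinarith
  have hr1p : 0 < d.r1 := Real.exp_pos _
  have hr2p : 0 < d.r2 := Real.exp_pos _
  have key := tri_liouville (ι := Fin 7 × Fin 7) (fun k => d.r1 ^ (k.1 : ℕ) * d.r2 ^ (k.2 : ℕ))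
    (fun c hc => tri_radical_indep _ _ (div_pos q1 q2) (div_pos q3 q4) hind d.r1 d.r2 hr1p hr2p
      (by push_cast; rw [eq_div_iff p2.ne', d.r1_7]) (by push_cast; rw [eq_div_iff p4.ne', d.r2_7]) c hc)
    (by simp) ((d.v1 : ℝ) * d.v2) (by positivity)
    (fun k k' => (if (k.1 : ℕ) + k'.1 < 7 then (d.v1 : ℤ) else d.u1) *
      (if (k.2 : ℕ) + k'.2 < 7 then (d.v2 : ℤ) else d.u2))
    (fun k k' => by
      have e1 := tri_carry d.r1 d.u1 d.v1 d.r1_7 k.1 k'.1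
      have e2 := tri_carry d.r2 d.u2 d.v2 d.r2_7 k.2 k'.2
      push_cast
      simp only [Prod.fst_add, Prod.snd_add]
      calc _ = ((d.v1 : ℝ) * (d.r1 ^ (k.1 : ℕ) * d.r1 ^ (k'.1 : ℕ))) *
            ((d.v2 : ℝ) * (d.r2 ^ (k.2 : ℕ) * d.r2 ^ (k'.2 : ℕ))) := by ring
        _ = _ := by rw [e1, e2]; ring)
    (Real.exp (d.s + d.s)) (Real.exp (40402 * d.Z)) (Real.exp (d.s + d.s))
    (fun k k' => by
      push_cast
      rw [abs_mul]
      refine tri_mul_exp (abs_nonneg _) ?_ ?_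
      · split_ifs
        · rw [Nat.abs_cast]; exact d.hv1'
        · rw [Nat.abs_cast]; exact d.hu1'
      · split_ifs
        · rw [Nat.abs_cast]; exact d.hv2'
        · rw [Nat.abs_cast]; exact d.hu2')
    (fun k => by
      rw [abs_of_nonneg (by positivity)]
      exact tri_mul_exp (by positivity) (hr1 _) (hr2 _))
    (d.cc p σ t0 t1) (fun k => d.cc_bound p hpb σ t0 t1 hσ h0 h1 k)
    (by rw [← Real.exp_add]; exact Real.one_le_exp (by positivity)) (by positivity) hc
  have hsm := d.cc_small hb h p hpb hp σ hσ t0 t1 h0 h1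
  simp only [Fintype.card_prod, Fintype.card_fin] at key
  have c1 : ((7 * 7 : ℕ) : ℝ) ≤ Real.exp 49 := by
    have := Real.add_one_le_exp 49
    push_cast; linarith
  have c2 : (((7 * 7 : ℕ).factorial : ℕ) : ℝ) ≤ Real.exp (49 * 49) := by
    have e : (((7 * 7 : ℕ).factorial : ℕ) : ℝ) ≤ ((7 * 7 : ℕ) : ℝ) ^ (7 * 7) := by
      exact_mod_cast Nat.factorial_le_pow (7 * 7)
    refine e.trans ((tri_pow_exp (7 * 7) (by positivity) c1).trans (Real.exp_le_exp.mpr ?_))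
    push_cast; norm_num
  have c3 : (Real.exp (40402 * d.Z) * Real.exp (d.s + d.s)) ^ (7 * 7) ≤
      Real.exp (((7 * 7 : ℕ) : ℝ) * (40402 * d.Z + (d.s + d.s))) :=
    tri_pow_exp _ (by positivity) (tri_mul_exp (by positivity) le_rfl le_rfl)
  have c4 : (d.v1 : ℝ) * d.v2 * Real.exp (d.s + d.s) ≤ Real.exp ((d.s + d.s) + (d.s + d.s)) :=
    tri_mul_exp (by positivity) (tri_mul_exp (by positivity) d.hv1' d.hv2') le_rfl
  have c5 := tri_mul_exp (abs_nonneg _) (tri_mul_exp (by positivity) (tri_mul_exp (by positivity) c1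
    (tri_mul_exp (by positivity) c2 c3)) c4) hsm
  have c6 := key.trans c5
  rw [← Real.exp_zero, Real.exp_le_exp] at c6
  have hlog : 14000 ≤ Real.log d.E := by
    rw [Real.le_log_iff_exp_le (by have := d.hE1; linarith)]
    exact d.hE
  have := d.hZs5
  push_cast at c6
  nlinarith

/-- the transcendence argument -/
theorem core (hinj : Function.Injective d.w)
    (hind : TriIndep ((d.u1 : ℚ) / d.v1) ((d.u2 : ℚ) / d.v2)) :
    Real.exp (-(25000 * (d.E * d.Z))) < |d.Lam| := by
  by_contra hcon
  have h : d.Small := not_lt.mp hcon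
  have hL : 2 ≤ d.L := by
    have := d.hs0
    have := d.hE0
    unfold L
    have : 1 ≤ d.E * d.s := Nat.mul_pos d.hE0 d.hs0
    nlinarith
  have hb : d.b2 ≠ 0 := by
    intro hb
    have : (⟨0, by omega⟩, ⟨0, by omega⟩) = ((⟨1, by omega⟩, ⟨0, by omega⟩) : Fin d.L × Fin d.L) := by
      apply hinj
      simp [w, hb]
    simp at this
  obtain ⟨p, hp0, hpb, hp⟩ := d.siegel
  apply hp0
  refine d.finish p hinj ?_
  intro σ hσ t0 h0 t1 h1 i
  exact congrFun (d.cc_zero hb h hind p hpb hp σ hσ t0 t1 h0 h1) i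

end TriD


lemma tri_log_nat (M N : ℕ) (hM : 1 ≤ M) (hN : 1 ≤ N) (h : Real.log M - Real.log N ≠ 0) (X : ℝ)
    (hMX : (M : ℝ) ≤ Real.exp X) (hNX : (N : ℝ) ≤ Real.exp X) :
    Real.exp (-X) ≤ |Real.log M - Real.log N| := by
  have aux : ∀ M N : ℕ, 1 ≤ N → N < M → (M : ℝ) ≤ Real.exp X →
      Real.exp (-X) ≤ Real.log M - Real.log N := by
    intro M N hN hlt hMX
    have hN' : (0 : ℝ) < N := by exact_mod_cast hN
    have hM' : (0 : ℝ) < M := by exact_mod_cast (by omega : 0 < M)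
    have h1 := Real.one_sub_inv_le_log_of_pos (div_pos hM' hN')
    rw [Real.log_div hM'.ne' hN'.ne', inv_div] at h1
    refine le_trans ?_ h1
    have h2 : (N : ℝ) + 1 ≤ M := by exact_mod_cast hlt
    have h3 : (N : ℝ) / M ≤ 1 - 1 / M := by
      rw [div_le_iff₀ hM']; field_simp; linarith
    rw [Real.exp_neg, ← one_div]
    have h4 : 1 / Real.exp X ≤ 1 / (M : ℝ) := one_div_le_one_div_of_le hM' hMX
    linarith
  rcases lt_trichotomy M N with h1 | h1 | h1
  · rw [abs_sub_comm]
    exact (aux N M hM h1 hNX).trans (le_abs_self _)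
  · exact absurd (by rw [h1, sub_self]) h
  · exact (aux M N hN h1 hMX).trans (le_abs_self _)

/-- constant of the method -/
noncomputable def triE : ℕ := ⌈Real.exp 14000⌉₊

lemma tri_core (S : ℕ) (hS : triE ≤ S) (u1 v1 u2 v2 : ℕ) (b1 b2 : ℤ)
    (hu1 : 1 ≤ u1) (hv1 : 1 ≤ v1) (hu2 : 1 ≤ u2) (hv2 : 1 ≤ v2)
    (hu1' : (u1 : ℝ) ≤ Real.exp S) (hv1' : (v1 : ℝ) ≤ Real.exp S)
    (hu2' : (u2 : ℝ) ≤ Real.exp S) (hv2' : (v2 : ℝ) ≤ Real.exp S)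
    (hb1 : |(b1 : ℝ)| ≤ Real.exp S) (hb2 : |(b2 : ℝ)| ≤ Real.exp S)
    (hind : TriIndep ((u1 : ℚ) / v1) ((u2 : ℚ) / v2))
    (h : (b1 : ℝ) * (Real.log u1 - Real.log v1) + b2 * (Real.log u2 - Real.log v2) ≠ 0) :
    Real.exp (-(25000 * (triE : ℝ) ^ 3 * (S : ℝ) ^ 3)) ≤
      |(b1 : ℝ) * (Real.log u1 - Real.log v1) + b2 * (Real.log u2 - Real.log v2)| := by
  obtain ⟨D, hD1, hD, hD'⟩ := tri_lcm (7 * S)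
  let d : TriD := ⟨triE, S, u1, v1, u2, v2, b1, b2, D, Nat.le_ceil _, hS, hu1, hv1, hu2, hv2, hu1', hv1',
    hu2', hv2', hb1, hb2, hD1, hD, hD'.trans (Real.exp_le_exp.mpr (by push_cast; linarith))⟩
  have hE1 : (14000 : ℝ) ≤ triE := d.hE1
  have hs1 : (14000 : ℝ) ≤ S := d.hs1
  have eL : (d.L : ℝ) = 98 * triE * S := by
    show ((98 * triE * S : ℕ) : ℝ) = _
    push_cast; ring
  by_cases hinj : Function.Injective d.w
  · have := d.core hinj hind
    refine le_trans (le_of_eq ?_) this.le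
    congr 1
    show _ = -(25000 * ((triE : ℝ) * ((triE : ℝ) ^ 2 * (S : ℝ) ^ 3)))
    ring
  · unfold Function.Injective at hinj
    push Not at hinj
    obtain ⟨l, l', hl, hne⟩ := hinj
    have hl' : (b2 : ℝ) * ((l.1 : ℕ) - (l'.1 : ℕ)) = b1 * ((l.2 : ℕ) - (l'.2 : ℕ)) := by
      have : b2 * ((l.1 : ℕ) : ℤ) - b1 * ((l.2 : ℕ) : ℤ) = b2 * ((l'.1 : ℕ) : ℤ) - b1 * ((l'.2 : ℕ) : ℤ) := hl
      have : ((b2 * ((l.1 : ℕ) : ℤ) - b1 * ((l.2 : ℕ) : ℤ) : ℤ) : ℝ) =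
        ((b2 * ((l'.1 : ℕ) : ℤ) - b1 * ((l'.2 : ℕ) : ℤ) : ℤ) : ℝ) := by rw [this]
      push_cast at this
      linarith
    have i1 : ((l.1 : ℕ) : ℝ) ≤ d.L := by exact_mod_cast l.1.isLt.le
    have i2 : ((l.2 : ℕ) : ℝ) ≤ d.L := by exact_mod_cast l.2.isLt.le
    have i1' : ((l'.1 : ℕ) : ℝ) ≤ d.L := by exact_mod_cast l'.1.isLt.le
    have i2' : ((l'.2 : ℕ) : ℝ) ≤ d.L := by exact_mod_cast l'.2.isLt.le
    have j1 : (0 : ℝ) ≤ ((l.1 : ℕ) : ℝ) := by positivity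
    have j2 : (0 : ℝ) ≤ ((l.2 : ℕ) : ℝ) := by positivity
    have j1' : (0 : ℝ) ≤ ((l'.1 : ℕ) : ℝ) := by positivity
    have j2' : (0 : ℝ) ≤ ((l'.2 : ℕ) : ℝ) := by positivity
    set Λ := (b1 : ℝ) * (Real.log u1 - Real.log v1) + b2 * (Real.log u2 - Real.log v2) with hΛ
    have hLe : (d.L : ℝ) * 2 ≤ Real.exp (3 * S) := d.hLexp
    -- the product form
    set M : ℕ := u1 ^ (l.1 : ℕ) * v1 ^ (l'.1 : ℕ) * (u2 ^ (l.2 : ℕ) * v2 ^ (l'.2 : ℕ)) with hM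
    set N : ℕ := v1 ^ (l.1 : ℕ) * u1 ^ (l'.1 : ℕ) * (v2 ^ (l.2 : ℕ) * u2 ^ (l'.2 : ℕ)) with hN
    have pw : ∀ (n : ℕ) (x : ℕ), (n : ℝ) ≤ Real.exp S → (x : ℝ) ≤ d.L → (n : ℝ) ^ x ≤ Real.exp (d.L * S) := by
      intro n x hn hx
      refine (tri_pow_exp x (by positivity) hn).trans (Real.exp_le_exp.mpr (by gcongr))
    have hMX : (M : ℝ) ≤ Real.exp (4 * (d.L * S)) := by
      rw [hM]; push_cast
      refine (tri_mul_exp (by positivity) (tri_mul_exp (by positivity) (pw _ _ hu1' i1) (pw _ _ hv1' i1'))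
        (tri_mul_exp (by positivity) (pw _ _ hu2' i2) (pw _ _ hv2' i2'))).trans
        (Real.exp_le_exp.mpr (by linarith))
    have hNX : (N : ℝ) ≤ Real.exp (4 * (d.L * S)) := by
      rw [hN]; push_cast
      refine (tri_mul_exp (by positivity) (tri_mul_exp (by positivity) (pw _ _ hv1' i1) (pw _ _ hu1' i1'))
        (tri_mul_exp (by positivity) (pw _ _ hv2' i2) (pw _ _ hu2' i2'))).trans
        (Real.exp_le_exp.mpr (by linarith))
    have hM1 : 1 ≤ M := Nat.one_le_iff_ne_zero.mpr (by positivity)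
    have hN1 : 1 ≤ N := Nat.one_le_iff_ne_zero.mpr (by positivity)
    have q1 : (u1 : ℝ) ≠ 0 := by positivity
    have q2 : (v1 : ℝ) ≠ 0 := by positivity
    have q3 : (u2 : ℝ) ≠ 0 := by positivity
    have q4 : (v2 : ℝ) ≠ 0 := by positivity
    have elog : Real.log M - Real.log N =
        ((l.1 : ℕ) - (l'.1 : ℕ)) * (Real.log u1 - Real.log v1) +
        ((l.2 : ℕ) - (l'.2 : ℕ)) * (Real.log u2 - Real.log v2) := by
      rw [hM, hN]; push_cast
      rw [Real.log_mul (by positivity) (by positivity), Real.log_mul (by positivity) (by positivity),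
        Real.log_mul (by positivity) (by positivity), Real.log_mul (by positivity) (by positivity),
        Real.log_mul (by positivity) (by positivity), Real.log_mul (by positivity) (by positivity)]
      simp only [Real.log_pow]
      ring
    have m1 : ((l.1 : ℕ) - (l'.1 : ℕ) : ℝ) * Λ = b1 * (Real.log M - Real.log N) := by
      rw [elog, hΛ]; linear_combination (Real.log u2 - Real.log v2) * hl'
    have m2 : ((l.2 : ℕ) - (l'.2 : ℕ) : ℝ) * Λ = b2 * (Real.log M - Real.log N) := by
      rw [elog, hΛ]; linear_combination -(Real.log u1 - Real.log v1) * hl'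
    have fin : ∀ (b : ℤ) (x : ℝ), x ≠ 0 → |x| ≤ d.L → x * Λ = b * (Real.log M - Real.log N) →
        Real.exp (-(25000 * (triE : ℝ) ^ 3 * (S : ℝ) ^ 3)) ≤ |Λ| := by
      intro b x hx hxL e
      have hne0 : (b : ℝ) * (Real.log M - Real.log N) ≠ 0 := by rw [← e]; exact mul_ne_zero hx h
      have hb0 : b ≠ 0 := by
        rintro rfl
        simp at hne0
      have hb1 : (1 : ℝ) ≤ |(b : ℝ)| := by
        have := Int.one_le_abs hb0
        exact_mod_cast this
      have hlog0 : Real.log M - Real.log N ≠ 0 := right_ne_zero_of_mul hne0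
      have hl := tri_log_nat M N hM1 hN1 hlog0 _ hMX hNX
      have e2 : |x| * |Λ| = |(b : ℝ)| * |Real.log M - Real.log N| := by rw [← abs_mul, e, abs_mul]
      have e3 : Real.exp (-(4 * (d.L * S))) ≤ Real.exp (3 * S) * |Λ| := by
        calc Real.exp (-(4 * (d.L * S))) ≤ 1 * |Real.log M - Real.log N| := by linarith
          _ ≤ |(b : ℝ)| * |Real.log M - Real.log N| := by gcongr
          _ = |x| * |Λ| := e2.symm
          _ ≤ _ := by
            gcongr
            have : (0 : ℝ) ≤ d.L := by positivity
            linarith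
      have e4 : Real.exp (-(4 * (d.L * S)) - 3 * S) ≤ |Λ| := by
        rw [Real.exp_sub, div_le_iff₀ (Real.exp_pos _)]; linarith
      refine le_trans (Real.exp_le_exp.mpr ?_) e4
      rw [eL, mul_assoc 25000]
      have t1 : (triE : ℝ) * S * S ≤ triE ^ 3 * S ^ 3 := by
        have a1 : (1 : ℝ) ≤ triE ^ 2 := one_le_pow₀ (by linarith)
        calc (triE : ℝ) * S * S = triE * 1 * (S * S * 1) := by ring
          _ ≤ triE * triE ^ 2 * (S * S * S) := by gcongr; linarith
          _ = _ := by ring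
      have t2 : (S : ℝ) ≤ triE ^ 3 * S ^ 3 := by
        refine le_trans ?_ t1
        have : (1 : ℝ) ≤ triE * S := one_le_mul_of_one_le_of_one_le (by linarith) (by linarith)
        calc (S : ℝ) = 1 * S := by ring
          _ ≤ triE * S * S := by gcongr
      have t3 : (0 : ℝ) ≤ triE ^ 3 * S ^ 3 := by positivity
      generalize (triE : ℝ) ^ 3 * (S : ℝ) ^ 3 = y at t1 t2 t3 ⊢
      linarith
    by_cases hx : ((l.1 : ℕ) - (l'.1 : ℕ) : ℝ) = 0
    · refine fin b2 _ ?_ ?_ m2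
      · intro hy
        apply hne
        have z1 : ((l.1 : ℕ) : ℝ) = ((l'.1 : ℕ) : ℝ) := by linarith
        have z2 : ((l.2 : ℕ) : ℝ) = ((l'.2 : ℕ) : ℝ) := by linarith
        exact Prod.ext (Fin.ext (by exact_mod_cast z1)) (Fin.ext (by exact_mod_cast z2))
      · rw [abs_le]; constructor <;> linarith
    · refine fin b1 _ hx ?_ m1
      rw [abs_le]; constructor <;> linarith

lemma tri_inv7 (a : ℤ) (h : ¬ (7 : ℤ) ∣ a) : ∃ n q : ℤ, n * a = 1 + 7 * q := by
  have : a % 7 = 1 ∨ a % 7 = 2 ∨ a % 7 = 3 ∨ a % 7 = 4 ∨ a % 7 = 5 ∨ a % 7 = 6 := by omega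
  rcases this with h | h | h | h | h | h
  · exact ⟨1, a / 7, by omega⟩
  · exact ⟨4, (4 * a) / 7, by omega⟩
  · exact ⟨5, (5 * a) / 7, by omega⟩
  · exact ⟨2, (2 * a) / 7, by omega⟩
  · exact ⟨3, (3 * a) / 7, by omega⟩
  · exact ⟨6, (6 * a) / 7, by omega⟩

lemma tri_fail (x1 x2 : ℚ) (h1 : 0 < x1) (h2 : 0 < x2) (h : ¬ TriIndep x1 x2) :
    (∃ j : ℤ, |j| ≤ 3 ∧ ∃ ρ : ℚ, 0 < ρ ∧ x1 * x2 ^ j = ρ ^ 7) ∨ (∃ ρ : ℚ, 0 < ρ ∧ x2 = ρ ^ 7) := by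
  unfold TriIndep at h
  push Not at h
  obtain ⟨a, b, ρ, hρ, e, hab⟩ := h
  have g1 := h1.ne'
  have g2 := h2.ne'
  have g3 := hρ.ne'
  have pw : ∀ (x : ℚ) (k : ℤ), (x ^ k) ^ 7 = x ^ (7 * k) := by
    intro x k
    rw [mul_comm, zpow_mul]; norm_cast
  have e' : ∀ n : ℤ, x1 ^ (n * a) * x2 ^ (n * b) = ρ ^ (7 * n) := by
    intro n
    rw [mul_comm n a, mul_comm n b, zpow_mul, zpow_mul, ← mul_zpow, e, zpow_mul]; norm_cast
  by_cases ha : (7 : ℤ) ∣ a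
  · right
    obtain ⟨q, rfl⟩ := ha
    obtain ⟨n, r, hr⟩ := tri_inv7 b (hab (Dvd.intro _ rfl))
    refine ⟨ρ ^ n * x1 ^ (-(n * q)) * x2 ^ (-r), by positivity, ?_⟩
    rw [mul_pow, mul_pow, pw, pw, pw, ← e' n, hr, mul_assoc, mul_mul_mul_comm, ← zpow_add₀ g1,
      ← zpow_add₀ g2]
    have t1 : n * (7 * q) + 7 * (-(n * q)) = 0 := by ring
    have t2 : 1 + 7 * r + 7 * (-r) = 1 := by ring
    rw [t1, t2]; simp
  · left
    obtain ⟨n, r, hr⟩ := tri_inv7 a ha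
    refine ⟨(n * b + 3) % 7 - 3, ?_, ρ ^ n * x1 ^ (-r) * x2 ^ (-((n * b + 3) / 7)), by positivity, ?_⟩
    · rw [abs_le]; omega
    · rw [mul_pow, mul_pow, pw, pw, pw, ← e' n, hr, mul_assoc _ (x1 ^ _), mul_mul_mul_comm, ← zpow_add₀ g1,
        ← zpow_add₀ g2]
      have t1 : 1 + 7 * r + 7 * (-r) = 1 := by ring
      have t2 : n * b + 7 * (-((n * b + 3) / 7)) = (n * b + 3) % 7 - 3 := by omega
      rw [t1, t2]; simp

lemma tri_height (ρ : ℚ) (hρ : 0 < ρ) (A B : ℕ) (hA : 1 ≤ A) (hB : 1 ≤ B) (h : ρ ^ 7 = A / B) :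
    ∃ P Q : ℕ, 1 ≤ P ∧ 1 ≤ Q ∧ ρ = P / Q ∧ P ^ 7 ≤ A ∧ Q ^ 7 ≤ B := by
  have hn : 0 < ρ.num := Rat.num_pos.mpr hρ
  have e0 : ρ = (ρ.num.natAbs : ℚ) / ρ.den := by
    conv_lhs => rw [← Rat.num_div_den ρ]
    congr 1
    have : ((ρ.num.natAbs : ℤ) : ℚ) = (ρ.num : ℚ) := by
      rw [Int.natAbs_of_nonneg hn.le]
    rw [← this, Int.cast_natCast]
  have hQ : 0 < ρ.den := ρ.den_pos
  have hcop : Nat.Coprime (ρ.num.natAbs ^ 7) (ρ.den ^ 7) := Nat.Coprime.pow _ _ ρ.reduced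
  have e1 : ρ.num.natAbs ^ 7 * B = A * ρ.den ^ 7 := by
    have hQ' : (ρ.den : ℚ) ≠ 0 := by positivity
    have hB' : (B : ℚ) ≠ 0 := by positivity
    have : (ρ.num.natAbs : ℚ) ^ 7 * B = A * (ρ.den : ℚ) ^ 7 := by
      rw [e0, div_pow, div_eq_div_iff (by positivity) hB'] at h
      exact h
    exact_mod_cast this
  refine ⟨ρ.num.natAbs, ρ.den, by omega, hQ, e0, ?_, ?_⟩
  · exact Nat.le_of_dvd hA (hcop.dvd_of_dvd_mul_right (Dvd.intro _ e1))
  · refine Nat.le_of_dvd hB (hcop.symm.dvd_of_dvd_mul_left (n := B) (Dvd.intro_left _ e1.symm))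



/-- hypotheses of the descent -/
structure TriH (S k : ℕ) (u1 v1 u2 v2 : ℕ) (b1 b2 : ℤ) (h1 h2 : ℝ) : Prop where
  u1p : 1 ≤ u1
  v1p : 1 ≤ v1
  u2p : 1 ≤ u2
  v2p : 1 ≤ v2
  u1h : Real.log u1 ≤ h1
  v1h : Real.log v1 ≤ h1
  u2h : Real.log u2 ≤ h2
  v2h : Real.log v2 ≤ h2
  h1S : h1 ≤ S
  h2S : h2 ≤ S
  b1h : |(b1 : ℝ)| * 7 ^ k ≤ Real.exp S
  b2h : |(b2 : ℝ)| * 7 ^ k ≤ Real.exp S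
  prod : h1 * h2 < (7 / 4) ^ k / 4

lemma TriH.symm {S k : ℕ} {u1 v1 u2 v2 : ℕ} {b1 b2 : ℤ} {h1 h2 : ℝ}
    (h : TriH S k u1 v1 u2 v2 b1 b2 h1 h2) : TriH S k u2 v2 u1 v1 b2 b1 h2 h1 :=
  ⟨h.u2p, h.v2p, h.u1p, h.v1p, h.u2h, h.v2h, h.u1h, h.v1h, h.h2S, h.h1S, h.b2h, h.b1h,
    by rw [mul_comm]; exact h.prod⟩

lemma tri_le_exp {u : ℕ} {h S : ℝ} (hu : 1 ≤ u) (a : Real.log u ≤ h) (b : h ≤ S) :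
    (u : ℝ) ≤ Real.exp S := by
  rw [← Real.log_le_iff_le_exp (by positivity)]; linarith

lemma tri_eq_one {u : ℕ} {h : ℝ} (hu : 1 ≤ u) (a : Real.log u ≤ h) (b : h < 1 / 2) : u = 1 := by
  by_contra hne
  have h2 : (2 : ℝ) ≤ u := by exact_mod_cast (by omega : 2 ≤ u)
  have := Real.log_le_log (by norm_num) h2
  have := Real.log_two_gt_d9
  linarith

lemma tri_base1 (S : ℕ) (b : ℤ) (u v : ℕ) (hu : 1 ≤ u) (hv : 1 ≤ v) (hu' : (u : ℝ) ≤ Real.exp S)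
    (hv' : (v : ℝ) ≤ Real.exp S) (h : (b : ℝ) * (Real.log u - Real.log v) ≠ 0) :
    Real.exp (-S) ≤ |(b : ℝ) * (Real.log u - Real.log v)| := by
  have hb0 : b ≠ 0 := by
    rintro rfl
    simp at h
  have hb1 : (1 : ℝ) ≤ |(b : ℝ)| := by
    have := Int.one_le_abs hb0
    exact_mod_cast this
  have := tri_log_nat u v hu hv (right_ne_zero_of_mul h) S hu' hv'
  rw [abs_mul]
  nlinarith [abs_nonneg (Real.log u - Real.log v)]

lemma tri_base (S : ℕ) (u1 v1 u2 v2 : ℕ) (b1 b2 : ℤ) (h1 h2 : ℝ)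
    (H : TriH S 0 u1 v1 u2 v2 b1 b2 h1 h2)
    (h : (b1 : ℝ) * (Real.log u1 - Real.log v1) + b2 * (Real.log u2 - Real.log v2) ≠ 0) :
    Real.exp (-S) ≤
      |(b1 : ℝ) * (Real.log u1 - Real.log v1) + b2 * (Real.log u2 - Real.log v2)| := by
  have hp := H.prod
  rw [pow_zero] at hp
  by_cases c : h1 < 1 / 2
  · have e1 := tri_eq_one H.u1p H.u1h c
    have e2 := tri_eq_one H.v1p H.v1h c
    subst e1 e2
    simp only [sub_self, mul_zero, zero_add] at h ⊢
    exact tri_base1 S b2 u2 v2 H.u2p H.v2p (tri_le_exp H.u2p H.u2h H.h2S) (tri_le_exp H.v2p H.v2h H.h2S) h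
  · have c2 : h2 < 1 / 2 := by
      by_contra c2
      push Not at c c2
      nlinarith
    have e1 := tri_eq_one H.u2p H.u2h c2
    have e2 := tri_eq_one H.v2p H.v2h c2
    subst e1 e2
    simp only [sub_self, mul_zero, add_zero] at h ⊢
    exact tri_base1 S b1 u1 v1 H.u1p H.v1p (tri_le_exp H.u1p H.u1h H.h1S) (tri_le_exp H.v1p H.v1h H.h1S) h

lemma tri_pow7_log {P A : ℕ} (hP : 1 ≤ P) (h : P ^ 7 ≤ A) : 7 * Real.log P ≤ Real.log A := by
  have h1 : (P : ℝ) ^ 7 ≤ A := by exact_mod_cast h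
  have := Real.log_le_log (by positivity) h1
  rw [Real.log_pow] at this
  exact_mod_cast this

lemma tri_rat_log {P Q : ℕ} (hP : 1 ≤ P) (hQ : 1 ≤ Q) :
    Real.log (((P : ℚ) / Q : ℚ) : ℝ) = Real.log P - Real.log Q := by
  push_cast
  rw [Real.log_div (by positivity) (by positivity)]

lemma tri_step (S k : ℕ) (X : ℝ)
    (ih : ∀ (u1 v1 u2 v2 : ℕ) (b1 b2 : ℤ) (h1 h2 : ℝ), TriH S k u1 v1 u2 v2 b1 b2 h1 h2 →
      (b1 : ℝ) * (Real.log u1 - Real.log v1) + b2 * (Real.log u2 - Real.log v2) ≠ 0 →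
      X ≤ |(b1 : ℝ) * (Real.log u1 - Real.log v1) + b2 * (Real.log u2 - Real.log v2)|)
    (u1 v1 u2 v2 : ℕ) (b1 b2 : ℤ) (h1 h2 : ℝ) (H : TriH S (k + 1) u1 v1 u2 v2 b1 b2 h1 h2)
    (h21 : h2 ≤ h1)
    (hind : ¬ TriIndep ((u1 : ℚ) / v1) ((u2 : ℚ) / v2))
    (h : (b1 : ℝ) * (Real.log u1 - Real.log v1) + b2 * (Real.log u2 - Real.log v2) ≠ 0) :
    X ≤ |(b1 : ℝ) * (Real.log u1 - Real.log v1) + b2 * (Real.log u2 - Real.log v2)| := by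
  have u1p := H.u1p
  have v1p := H.v1p
  have u2p := H.u2p
  have v2p := H.v2p
  have g1 : 0 ≤ Real.log u1 := Real.log_natCast_nonneg _
  have g2 : 0 ≤ Real.log u2 := Real.log_natCast_nonneg _
  have k1 := H.u1h
  have k2 := H.v1h
  have k3 := H.u2h
  have k4 := H.v2h
  have hh1 : 0 ≤ h1 := by linarith
  have hh2 : 0 ≤ h2 := by linarith
  have hS1 := H.h1S
  have hS2 := H.h2S
  have hp := H.prod
  have hb1 := H.b1h
  have hb2 := H.b2h
  rw [pow_succ] at hp hb1 hb2
  have hbb1 : |(b1 : ℝ)| * 7 ^ k ≤ Real.exp S := by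
    have : (0 : ℝ) ≤ |(b1 : ℝ)| * 7 ^ k := by positivity
    linarith
  rcases tri_fail _ _ (by positivity) (by positivity) hind with ⟨j, hj, ρ, hρ, e⟩ | ⟨ρ, hρ, e⟩
  · -- x1 * x2 ^ j = ρ ^ 7
    have hAB : ∃ A B : ℕ, 1 ≤ A ∧ 1 ≤ B ∧ ρ ^ 7 = (A : ℚ) / B ∧
        Real.log A ≤ h1 + 3 * h2 ∧ Real.log B ≤ h1 + 3 * h2 := by
      have gen : ∀ (x y : ℕ) (n : ℕ), n ≤ 3 → 1 ≤ x → 1 ≤ y → Real.log x ≤ h1 → Real.log y ≤ h2 →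
          Real.log ((x * y ^ n : ℕ) : ℝ) ≤ h1 + 3 * h2 := by
        intro x y n hn hx hy e1 e2
        push_cast
        rw [Real.log_mul (by positivity) (by positivity), Real.log_pow]
        have hn' : (n : ℝ) ≤ 3 := by exact_mod_cast hn
        have : (n : ℝ) * Real.log y ≤ 3 * h2 :=
          mul_le_mul hn' e2 (Real.log_natCast_nonneg _) (by norm_num)
        linarith
      obtain ⟨n, rfl | rfl⟩ := Int.eq_nat_or_neg j
      · have hn : n ≤ 3 := by rw [Nat.abs_cast] at hj; exact_mod_cast hj
        refine ⟨u1 * u2 ^ n, v1 * v2 ^ n, Nat.one_le_iff_ne_zero.mpr (by positivity),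
          Nat.one_le_iff_ne_zero.mpr (by positivity), ?_, gen _ _ _ hn u1p u2p k1 k3,
          gen _ _ _ hn v1p v2p k2 k4⟩
        rw [← e, zpow_natCast, div_pow]; push_cast; field_simp
      · have hn : n ≤ 3 := by rw [abs_neg, Nat.abs_cast] at hj; exact_mod_cast hj
        refine ⟨u1 * v2 ^ n, v1 * u2 ^ n, Nat.one_le_iff_ne_zero.mpr (by positivity),
          Nat.one_le_iff_ne_zero.mpr (by positivity), ?_, gen _ _ _ hn u1p v2p k1 k4,
          gen _ _ _ hn v1p u2p k2 k3⟩
        rw [← e, zpow_neg, zpow_natCast, div_pow]; push_cast; field_simp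
    obtain ⟨A, B, hA, hB, eAB, lA, lB⟩ := hAB
    obtain ⟨P, Q, hP, hQ, eP, hPA, hQB⟩ := tri_height ρ hρ A B hA hB eAB
    have m1 := tri_pow7_log hP hPA
    have m2 := tri_pow7_log hQ hQB
    have elog : 7 * (Real.log P - Real.log Q) =
        (Real.log u1 - Real.log v1) + j * (Real.log u2 - Real.log v2) := by
      have := congrArg (fun x : ℚ => Real.log (x : ℝ)) e
      simp only [Rat.cast_mul, Rat.cast_pow, Rat.cast_zpow] at this
      rw [Real.log_mul, Real.log_zpow, Real.log_pow, tri_rat_log u1p v1p, tri_rat_log u2p v2p, eP,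
        tri_rat_log hP hQ] at this
      · push_cast at this; linarith
      · push_cast; positivity
      · push_cast; positivity
    have eΛ : (b1 : ℝ) * (Real.log u1 - Real.log v1) + b2 * (Real.log u2 - Real.log v2) =
        ((7 * b1 : ℤ) : ℝ) * (Real.log P - Real.log Q) +
          ((b2 - j * b1 : ℤ) : ℝ) * (Real.log u2 - Real.log v2) := by
      push_cast
      linear_combination -(b1 : ℝ) * elog
    rw [eΛ] at h ⊢
    refine ih P Q u2 v2 _ _ (4 / 7 * h1) h2 ⟨hP, hQ, u2p, v2p, by linarith, by linarith, k3, k4,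
      by linarith, hS2, ?_, ?_, by nlinarith⟩ h
    · push_cast
      rw [abs_mul, abs_of_pos (by norm_num : (0 : ℝ) < 7)]
      linarith
    · push_cast
      have hj' : |(j : ℝ)| ≤ 3 := by exact_mod_cast hj
      have t1 : |(b2 : ℝ) - j * b1| ≤ |(b2 : ℝ)| + 3 * |(b1 : ℝ)| := by
        refine (abs_sub _ _).trans ?_
        rw [abs_mul]; gcongr
      have t2 : |(b2 : ℝ) - j * b1| * 7 ^ k ≤ (|(b2 : ℝ)| + 3 * |(b1 : ℝ)|) * 7 ^ k := by gcongr
      have t3 : (0 : ℝ) ≤ |(b2 : ℝ)| * 7 ^ k := by positivity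
      have t4 : (0 : ℝ) ≤ |(b1 : ℝ)| * 7 ^ k := by positivity
      linarith
  · obtain ⟨P, Q, hP, hQ, eP, hPA, hQB⟩ := tri_height ρ hρ u2 v2 u2p v2p e.symm
    have m1 := tri_pow7_log hP hPA
    have m2 := tri_pow7_log hQ hQB
    have elog : 7 * (Real.log P - Real.log Q) = (Real.log u2 - Real.log v2) := by
      have := congrArg (fun x : ℚ => Real.log (x : ℝ)) e
      simp only [Rat.cast_pow] at this
      rw [Real.log_pow, tri_rat_log u2p v2p, eP, tri_rat_log hP hQ] at this
      push_cast at this; linarith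
    have eΛ : (b1 : ℝ) * (Real.log u1 - Real.log v1) + b2 * (Real.log u2 - Real.log v2) =
        (b1 : ℝ) * (Real.log u1 - Real.log v1) + ((7 * b2 : ℤ) : ℝ) * (Real.log P - Real.log Q) := by
      push_cast
      linear_combination -(b2 : ℝ) * elog
    rw [eΛ] at h ⊢
    refine ih u1 v1 P Q _ _ h1 (4 / 7 * h2) ⟨u1p, v1p, hP, hQ, k1, k2, by linarith, by linarith, hS1,
      by linarith, hbb1, ?_, by nlinarith⟩ h
    push_cast
    rw [abs_mul, abs_of_pos (by norm_num : (0 : ℝ) < 7)]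
    linarith

lemma tri_descent (S : ℕ) (hS : triE ≤ S) (hS1 : 1 ≤ S) (k : ℕ) :
    ∀ (u1 v1 u2 v2 : ℕ) (b1 b2 : ℤ) (h1 h2 : ℝ), TriH S k u1 v1 u2 v2 b1 b2 h1 h2 →
      (b1 : ℝ) * (Real.log u1 - Real.log v1) + b2 * (Real.log u2 - Real.log v2) ≠ 0 →
      Real.exp (-((25000 * (triE : ℝ) ^ 3 + 1) * (S : ℝ) ^ 3)) ≤
        |(b1 : ℝ) * (Real.log u1 - Real.log v1) + b2 * (Real.log u2 - Real.log v2)| := by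
  have hSr : (1 : ℝ) ≤ S := by exact_mod_cast hS1
  have hS3 : (S : ℝ) ≤ S ^ 3 := le_self_pow₀ hSr (by norm_num)
  have hT : (0 : ℝ) ≤ (triE : ℝ) ^ 3 * S ^ 3 := by positivity
  induction k with
  | zero =>
    intro u1 v1 u2 v2 b1 b2 h1 h2 H h
    refine le_trans (Real.exp_le_exp.mpr ?_) (tri_base S u1 v1 u2 v2 b1 b2 h1 h2 H h)
    linarith
  | succ k ih =>
    have main : ∀ (u1 v1 u2 v2 : ℕ) (b1 b2 : ℤ) (h1 h2 : ℝ), TriH S (k + 1) u1 v1 u2 v2 b1 b2 h1 h2 →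
        h2 ≤ h1 →
        (b1 : ℝ) * (Real.log u1 - Real.log v1) + b2 * (Real.log u2 - Real.log v2) ≠ 0 →
        Real.exp (-((25000 * (triE : ℝ) ^ 3 + 1) * (S : ℝ) ^ 3)) ≤
        |(b1 : ℝ) * (Real.log u1 - Real.log v1) + b2 * (Real.log u2 - Real.log v2)| := by
      intro u1 v1 u2 v2 b1 b2 h1 h2 H h21 h
      by_cases hind : TriIndep ((u1 : ℚ) / v1) ((u2 : ℚ) / v2)
      · have h7 : (1 : ℝ) ≤ 7 ^ (k + 1) := one_le_pow₀ (by norm_num)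
        refine le_trans (Real.exp_le_exp.mpr ?_) (tri_core S hS u1 v1 u2 v2 b1 b2 H.u1p H.v1p H.u2p H.v2p
          (tri_le_exp H.u1p H.u1h H.h1S) (tri_le_exp H.v1p H.v1h H.h1S)
          (tri_le_exp H.u2p H.u2h H.h2S) (tri_le_exp H.v2p H.v2h H.h2S)
          (le_trans (le_mul_of_one_le_right (abs_nonneg _) h7) H.b1h)
          (le_trans (le_mul_of_one_le_right (abs_nonneg _) h7) H.b2h) hind h)
        nlinarith
      · exact tri_step S k _ ih u1 v1 u2 v2 b1 b2 h1 h2 H h21 hind h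
    intro u1 v1 u2 v2 b1 b2 h1 h2 H h
    rcases le_total h2 h1 with h21 | h21
    · exact main u1 v1 u2 v2 b1 b2 h1 h2 H h21 h
    · rw [add_comm ((b1:ℝ) * (Real.log u1 - Real.log v1))] at h ⊢
      exact main u2 v2 u1 v1 b2 b1 h2 h1 H.symm h21 h

/-- Lower bound for linear forms in two logarithms. -/
theorem tri_LF : ∃ C : ℝ, 0 < C ∧ ∀ (s : ℝ) (u1 v1 u2 v2 : ℕ) (b1 b2 : ℤ), 1 ≤ s →
    1 ≤ u1 → 1 ≤ v1 → 1 ≤ u2 → 1 ≤ v2 →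
    (u1 : ℝ) ≤ Real.exp s → (v1 : ℝ) ≤ Real.exp s → (u2 : ℝ) ≤ Real.exp s → (v2 : ℝ) ≤ Real.exp s →
    |(b1 : ℝ)| ≤ Real.exp s → |(b2 : ℝ)| ≤ Real.exp s →
    (b1 : ℝ) * (Real.log u1 - Real.log v1) + b2 * (Real.log u2 - Real.log v2) ≠ 0 →
    Real.exp (-(C * s ^ 3)) ≤
      |(b1 : ℝ) * (Real.log u1 - Real.log v1) + b2 * (Real.log u2 - Real.log v2)| := by
  refine ⟨(25000 * (triE : ℝ) ^ 3 + 1) * (triE * 100) ^ 3, ?_, ?_⟩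
  · have : 0 < triE := Nat.ceil_pos.mpr (Real.exp_pos _)
    positivity
  intro s u1 v1 u2 v2 b1 b2 hs hu1 hv1 hu2 hv2 hu1' hv1' hu2' hv2' hb1 hb2 h
  have hE : 1 ≤ triE := Nat.ceil_pos.mpr (Real.exp_pos _)
  have hEr : (1 : ℝ) ≤ triE := by exact_mod_cast hE
  set n := ⌈s⌉₊ with hn
  have hn1 : s ≤ n := Nat.le_ceil _
  have hn2 : (n : ℝ) < s + 1 := Nat.ceil_lt_add_one (by linarith)
  have hn0 : 1 ≤ n := Nat.ceil_pos.mpr (by linarith)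
  have hnr : (1 : ℝ) ≤ n := by exact_mod_cast hn0
  have lg : ∀ u : ℕ, 1 ≤ u → (u : ℝ) ≤ Real.exp s → Real.log u ≤ s := fun u hu h =>
    (Real.log_le_iff_le_exp (by positivity)).mpr h
  have hSn : (50 * n : ℝ) ≤ ((triE * (50 * n) : ℕ) : ℝ) := by
    push_cast
    have : (0 : ℝ) ≤ 50 * n := by positivity
    nlinarith
  have h7 : (7 : ℝ) ≤ Real.exp 2 := by
    have := Real.exp_one_gt_d9
    have e : Real.exp 2 = Real.exp 1 * Real.exp 1 := by rw [← Real.exp_add]; norm_num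
    rw [e]; nlinarith
  have hbb : ∀ b : ℤ, |(b : ℝ)| ≤ Real.exp s → |(b : ℝ)| * 7 ^ (8 * n) ≤
      Real.exp ((triE * (50 * n) : ℕ) : ℝ) := by
    intro b hb
    refine (tri_mul_exp (by positivity) hb (tri_pow_exp (8 * n) (by norm_num) h7)).trans
      (Real.exp_le_exp.mpr ?_)
    refine le_trans ?_ hSn
    push_cast; linarith
  have key := tri_descent (triE * (50 * n)) (Nat.le_mul_of_pos_right _ (by omega))
    (Nat.one_le_iff_ne_zero.mpr (by positivity)) (8 * n) u1 v1 u2 v2 b1 b2 s s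
    ⟨hu1, hv1, hu2, hv2, lg _ hu1 hu1', lg _ hv1 hv1', lg _ hu2 hu2', lg _ hv2 hv2', by linarith,
      by linarith, hbb _ hb1, hbb _ hb2, ?_⟩ h
  · refine le_trans (Real.exp_le_exp.mpr ?_) key
    rw [neg_le_neg_iff]
    have e1 : ((triE * (50 * n) : ℕ) : ℝ) ≤ triE * 100 * s := by
      push_cast
      have : (50 * (n : ℝ)) ≤ 100 * s := by linarith
      calc (triE : ℝ) * (50 * n) ≤ triE * (100 * s) := by gcongr
        _ = _ := by ring
    calc (25000 * (triE : ℝ) ^ 3 + 1) * ((triE * (50 * n) : ℕ) : ℝ) ^ 3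
        ≤ (25000 * (triE : ℝ) ^ 3 + 1) * (triE * 100 * s) ^ 3 := by gcongr
      _ = _ := by ring
  · have a1 : s * s ≤ (n : ℝ) * n := by gcongr
    have a2 : (5 : ℝ) ≤ (7 / 4) ^ 4 := by norm_num
    have a3 : (1 + (n : ℝ) * 4) ≤ 5 ^ n := by
      have := one_add_mul_le_pow (a := (4 : ℝ)) (by norm_num) n
      norm_num at this ⊢
      exact this
    have a4 : (5 : ℝ) ^ n * 5 ^ n ≤ (7 / 4) ^ (8 * n) := by
      rw [← pow_add, show n + n = 2 * n by ring, show 8 * n = 4 * (2 * n) by ring, pow_mul (7 / 4 : ℝ) 4]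
      gcongr
    have a5 : (1 + (n : ℝ) * 4) * (1 + (n : ℝ) * 4) ≤ 5 ^ n * 5 ^ n := by gcongr
    nlinarith


theorem tri_root_lower (a b c : ℤ) (p q : ℕ) (hp : 1 ≤ p) (hq : 1 ≤ q) (H x : ℝ)
    (hH : 1 ≤ H) (hb : |(b:ℝ)| ≤ H) (hc : |(c:ℝ)| ≤ H) (hne : ¬ (a = 0 ∧ b = 0 ∧ c = 0))
    (hx : x ≠ 0) (h : (a:ℝ) + b * x ^ p + c * x ^ (p + q) = 0) : 1 ≤ 2 * H * |x| := by
  by_contra! hlt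
  have hx0 : 0 < |x| := abs_pos.mpr hx
  have hx1 : |x| ≤ 1 := by nlinarith
  have key : ∀ k : ℕ, 1 ≤ k → |x| ^ k ≤ |x| := fun k hk => by
    calc |x| ^ k ≤ |x| ^ 1 := pow_le_pow_of_le_one hx0.le hx1 hk
      _ = |x| := pow_one _
  have one : ∀ z : ℤ, z ≠ 0 → (1:ℝ) ≤ |(z:ℝ)| := fun z hz => by
    exact_mod_cast Int.one_le_abs hz
  by_cases ha : a = 0
  · have h2 : (b:ℝ) + c * x ^ q = 0 := by
      have : x ^ p * ((b:ℝ) + c * x ^ q) = 0 := by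
        rw [← h, ha, pow_add]; push_cast; ring
      rcases mul_eq_zero.mp this with h | h
      · exact absurd h (pow_ne_zero _ hx)
      · exact h
    by_cases hb0 : b = 0
    · subst hb0
      have : (c:ℝ) * x ^ q = 0 := by simpa using h2
      rcases mul_eq_zero.mp this with h | h
      · exact hne ⟨ha, rfl, by exact_mod_cast h⟩
      · exact absurd h (pow_ne_zero _ hx)
    · have h3 : |(b:ℝ)| = |(c:ℝ)| * |x| ^ q := by
        rw [← abs_pow, ← abs_mul, eq_neg_of_add_eq_zero_left h2, abs_neg]
      have := one b hb0
      have h4 : |(c:ℝ)| * |x| ^ q ≤ H * |x| :=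
        mul_le_mul hc (key q hq) (by positivity) (by linarith)
      nlinarith
  · have h3 : |(a:ℝ)| ≤ |(b:ℝ)| * |x| ^ p + |(c:ℝ)| * |x| ^ (p + q) := by
      have : (a:ℝ) = - (b * x ^ p + c * x ^ (p + q)) := by linarith
      rw [this, abs_neg, ← abs_pow, ← abs_pow, ← abs_mul, ← abs_mul]
      exact abs_add_le _ _
    have := one a ha
    have h4 : |(c:ℝ)| * |x| ^ (p+q) ≤ H * |x| :=
      mul_le_mul hc (key _ (by omega)) (by positivity) (by linarith)
    have h5 : |(b:ℝ)| * |x| ^ p ≤ H * |x| :=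
      mul_le_mul hb (key _ hp) (by positivity) (by linarith)
    nlinarith

theorem tri_nonzero (a b c : ℤ) (p q : ℕ) (hp : 1 ≤ p) (hq : 1 ≤ q) (x y : ℝ)
    (hne : ¬ (a = 0 ∧ b = 0 ∧ c = 0)) (hx : 0 < x) (hxy : x < y)
    (h1 : (a:ℝ) + b * x ^ p + c * x ^ (p + q) = 0)
    (h2 : (a:ℝ) + b * y ^ p + c * y ^ (p + q) = 0) : a ≠ 0 ∧ b ≠ 0 ∧ c ≠ 0 := by
  have hpow : ∀ k : ℕ, 1 ≤ k → x ^ k < y ^ k := fun k hk =>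
    pow_lt_pow_left₀ hxy hx.le (by omega)
  have two : ∀ (u v : ℤ) (k : ℕ), 1 ≤ k → (u:ℝ) + v * x ^ k = 0 → (u:ℝ) + v * y ^ k = 0 →
      u = 0 ∧ v = 0 := by
    intro u v k hk e1 e2
    have : (v:ℝ) * (y ^ k - x ^ k) = 0 := by linarith
    have hv : (v:ℝ) = 0 := by
      rcases mul_eq_zero.mp this with h | h
      · exact h
      · have := hpow k hk; linarith
    rw [hv] at e1
    constructor
    · have : (u:ℝ) = 0 := by linarith
      exact_mod_cast this
    · exact_mod_cast hv
  refine ⟨?_, ?_, ?_⟩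
  · rintro rfl
    have d : ∀ t : ℝ, 0 < t → ((0:ℤ):ℝ) + b * t ^ p + c * t ^ (p + q) = 0 →
        (b:ℝ) + c * t ^ q = 0 := by
      intro t ht h
      have : t ^ p * ((b:ℝ) + c * t ^ q) = 0 := by
        rw [← h, pow_add]; push_cast; ring
      rcases mul_eq_zero.mp this with h | h
      · exact absurd h (pow_ne_zero _ ht.ne')
      · exact h
    obtain ⟨h3, h4⟩ := two b c q hq (d x hx h1) (d y (hx.trans hxy) h2)
    exact hne ⟨rfl, h3, h4⟩
  · rintro rfl
    obtain ⟨h3, h4⟩ := two a c (p+q) (by omega) (by simpa using h1) (by simpa using h2)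
    exact hne ⟨h3, rfl, h4⟩
  · rintro rfl
    obtain ⟨h3, h4⟩ := two a b p hp (by simpa using h1) (by simpa using h2)
    exact hne ⟨h3, h4, rfl⟩

theorem tri_rolle (a b c : ℝ) (p q : ℕ) (hp : 1 ≤ p) (x y : ℝ) (hx : 0 < x) (hxy : x < y)
    (h1 : a + b * x ^ p + c * x ^ (p + q) = 0)
    (h2 : a + b * y ^ p + c * y ^ (p + q) = 0) :
    ∃ z, x < z ∧ z < y ∧ (p:ℝ) * b + (p + q) * c * z ^ q = 0 := by
  have hd : ∀ t : ℝ, HasDerivAt (fun t : ℝ => a + b * t ^ p + c * t ^ (p + q))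
      (b * (p * t ^ (p - 1)) + c * (((p + q : ℕ):ℝ) * t ^ (p + q - 1))) t := by
    intro t
    have e1 := (hasDerivAt_pow p t).const_mul b
    have e2 := (hasDerivAt_pow (p+q) t).const_mul c
    exact (e1.const_add a).add e2
  obtain ⟨z, hz, e⟩ := exists_hasDerivAt_eq_zero hxy
    (fun t _ => (hd t).continuousAt.continuousWithinAt) (by simp only [h1, h2])
    (fun t _ => hd t)
  refine ⟨z, hz.1, hz.2, ?_⟩
  have hz0 : 0 < z := hx.trans hz.1
  have e3 : p + q - 1 = (p - 1) + q := by omega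
  rw [e3, pow_add] at e
  push_cast at e
  have : z ^ (p-1) * ((p:ℝ) * b + (p + q) * c * z ^ q) = 0 := by rw [← e]; ring
  rcases mul_eq_zero.mp this with h | h
  · exact absurd h (pow_ne_zero _ hz0.ne')
  · exact h

/-- bounds for W = n v^p - p v^n -/
theorem tri_W (p q : ℕ) (hp : 1 ≤ p) (hq : 1 ≤ q) (v : ℝ) (hv : 0 < v) (hv1 : v < 1) :
    0 < ((p:ℝ) + q) * v ^ p - p * v ^ (p + q) ∧
    ((p:ℝ) + q) * v ^ p - p * v ^ (p + q) < q ∧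
    (q:ℝ) - (p + q) * p * (1 - v) ≤ ((p:ℝ) + q) * v ^ p - p * v ^ (p + q) := by
  have hp' : (1:ℝ) ≤ p := by exact_mod_cast hp
  have hq' : (1:ℝ) ≤ q := by exact_mod_cast hq
  have hvp : 0 < v ^ p := by positivity
  have hvq : 0 < v ^ q := by positivity
  have hvq1 : v ^ q ≤ 1 := pow_le_one₀ hv.le hv1.le
  have hvn1 : v ^ (p+q) ≤ 1 := pow_le_one₀ hv.le hv1.le
  have b1 : 1 + (p:ℝ) * (v - 1) ≤ v ^ p := by
    have := one_add_mul_le_pow (a := v - 1) (by linarith) p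
    simpa using this
  have b2 : 1 + (q:ℝ) * (v - 1) ≤ v ^ q := by
    have := one_add_mul_le_pow (a := v - 1) (by linarith) q
    simpa using this
  have hw : 0 < v⁻¹ := by positivity
  have b3 : 1 + (p:ℝ) * (v⁻¹ - 1) ≤ (v⁻¹) ^ p := by
    have := one_add_mul_le_pow (a := v⁻¹ - 1) (by linarith) p
    simpa using this
  have b4 : 0 < v⁻¹ - 1 + (v - 1) := by
    have : v⁻¹ - 1 + (v - 1) = (1 - v)^2 * v⁻¹ := by field_simp; ring
    rw [this]; have : 0 < 1 - v := by linarith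
    positivity
  refine ⟨?_, ?_, ?_⟩
  · rw [pow_add]
    have : ((p:ℝ) + q) * v ^ p - p * (v ^ p * v ^ q) = v ^ p * (q + p * (1 - v ^ q)) := by ring
    rw [this]
    have : 0 ≤ (p:ℝ) * (1 - v ^ q) := mul_nonneg (by linarith) (by linarith)
    exact mul_pos hvp (by linarith)
  · have h : (p:ℝ) + q < q * (v⁻¹) ^ p + p * v ^ q := by
      have e1 : (q:ℝ) * (1 + (p:ℝ) * (v⁻¹ - 1)) ≤ q * (v⁻¹) ^ p :=
        mul_le_mul_of_nonneg_left b3 (by linarith)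
      have e2 : (p:ℝ) * (1 + (q:ℝ) * (v - 1)) ≤ p * v ^ q :=
        mul_le_mul_of_nonneg_left b2 (by linarith)
      have e3 : 0 < (p:ℝ) * q * (v⁻¹ - 1 + (v - 1)) := by positivity
      nlinarith
    have h2 := mul_lt_mul_of_pos_left h hvp
    have e4 : v ^ p * (q * (v⁻¹) ^ p + p * v ^ q) = q + p * v ^ (p+q) := by
      rw [pow_add, inv_pow]; field_simp
    rw [e4] at h2
    linarith
  · have e1 : ((p:ℝ) + q) * (1 + (p:ℝ) * (v - 1)) ≤ (p + q) * v ^ p :=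
      mul_le_mul_of_nonneg_left b1 (by linarith)
    have e2 : (p:ℝ) * v ^ (p+q) ≤ p * 1 := mul_le_mul_of_nonneg_left hvn1 (by linarith)
    nlinarith

set_option maxHeartbeats 1000000 in
theorem tri_pos : ∃ C : ℝ, 0 < C ∧ ∀ (a b c : ℤ) (p q : ℕ) (s x y : ℝ), 1 ≤ p → 1 ≤ q → 1 ≤ s →
    |(a:ℝ)| ≤ Real.exp s → |(b:ℝ)| ≤ Real.exp s → |(c:ℝ)| ≤ Real.exp s →
    (p:ℝ) + q ≤ Real.exp s → ¬ (a = 0 ∧ b = 0 ∧ c = 0) → 0 < x → x < y →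
    (a:ℝ) + b * x ^ p + c * x ^ (p + q) = 0 → (a:ℝ) + b * y ^ p + c * y ^ (p + q) = 0 →
    Real.exp (-(C * s ^ 3)) ≤ y - x := by
  obtain ⟨K, hK, hLF⟩ := tri_LF
  refine ⟨8 * K + 6, by positivity, ?_⟩
  intro a b c p q s x y hp hq hs ha hb hc hn hne hx hxy h1 h2
  obtain ⟨ha0, hb0, hc0⟩ := tri_nonzero a b c p q hp hq x y hne hx hxy h1 h2
  obtain ⟨z, hxz, hzy, hz⟩ := tri_rolle a b c p q hp x y hx hxy h1 h2
  have hz0 : 0 < z := hx.trans hxz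
  have hp' : (1:ℝ) ≤ p := by exact_mod_cast hp
  have hq' : (1:ℝ) ≤ q := by exact_mod_cast hq
  have hH : 1 ≤ Real.exp s := Real.one_le_exp (by linarith)
  have hlow := tri_root_lower a b c p q hp hq (Real.exp s) x hH hb hc hne hx.ne' h1
  rw [abs_of_pos hx] at hlow
  set v := x / z with hv
  have hv0 : 0 < v := by positivity
  have hv1 : v < 1 := (div_lt_one hz0).mpr hxz
  have hxv : x = z * v := by rw [hv]; field_simp
  obtain ⟨w0, w1, w2⟩ := tri_W p q hp hq v hv0 hv1
  set W := ((p:ℝ) + q) * v ^ p - p * v ^ (p + q) with hW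
  have haR : 0 < |(a:ℝ)| := abs_pos.mpr (by exact_mod_cast ha0)
  have hbR : 0 < |(b:ℝ)| := abs_pos.mpr (by exact_mod_cast hb0)
  have hcR : 0 < |(c:ℝ)| := abs_pos.mpr (by exact_mod_cast hc0)
  have r1 : (p:ℝ) * |(b:ℝ)| = (p + q) * |(c:ℝ)| * z ^ q := by
    have : (p:ℝ) * b = -((p + q) * c * z ^ q) := by linarith
    have h := congrArg abs this
    rw [abs_neg, abs_mul, abs_mul, abs_mul, abs_of_pos (show (0:ℝ) < p by linarith),
      abs_of_pos (show (0:ℝ) < p + q by linarith), abs_of_pos (pow_pos hz0 q)] at h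
    exact h
  have r2 : |(a:ℝ)| * (p + q) = |(b:ℝ)| * z ^ p * W := by
    have : (a:ℝ) * (p + q) = -(b * z ^ p * W) := by
      rw [hxv] at h1
      rw [hW]
      have e : (p:ℝ) * b * (z ^ p * v ^ (p+q)) = - ((p + q) * c * z ^ q) * (z ^ p * v ^ (p+q)) := by
        rw [show (p:ℝ) * b = -((p + q) * c * z ^ q) by linarith]
      rw [mul_pow, mul_pow, pow_add z] at h1
      linear_combination ((p:ℝ) + q) * h1 - e
    have h := congrArg abs this
    rw [abs_neg, abs_mul, abs_mul, abs_mul, abs_of_pos w0,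
      abs_of_pos (show (0:ℝ) < p + q by linarith), abs_of_pos (pow_pos hz0 p)] at h
    exact h
  have l1 : Real.log (p * |(b:ℝ)|) - Real.log ((p + q) * |(c:ℝ)|) = q * Real.log z := by
    rw [r1, Real.log_mul (by positivity) (by positivity), Real.log_pow]; ring
  have l2 : Real.log (|(b:ℝ)| * q) - Real.log (|(a:ℝ)| * (p + q))
      = Real.log q - p * Real.log z - Real.log W := by
    rw [r2, Real.log_mul (by positivity) (by positivity),
      Real.log_mul (by positivity) (by positivity),
      Real.log_mul (by positivity) (by positivity), Real.log_pow]; ring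
  have hlogW : Real.log W < Real.log q := Real.log_lt_log w0 w1
  have na : ∀ t : ℤ, ((t.natAbs : ℕ) : ℝ) = |(t:ℝ)| := fun t => by
    rw [Nat.cast_natAbs, Int.cast_abs]
  have L := hLF (2*s) (p * b.natAbs) ((p+q) * c.natAbs) (b.natAbs * q) (a.natAbs * (p+q)) p q
    (by linarith)
    (Nat.mul_pos hp (Int.natAbs_pos.mpr hb0)) (Nat.mul_pos (by omega) (Int.natAbs_pos.mpr hc0))
    (Nat.mul_pos (Int.natAbs_pos.mpr hb0) hq) (Nat.mul_pos (Int.natAbs_pos.mpr ha0) (by omega))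
  push_cast at L
  simp only [na] at L
  have hpe : (p:ℝ) ≤ Real.exp s := by linarith
  have hqe : (q:ℝ) ≤ Real.exp s := by linarith
  have e2s : Real.exp (2*s) = Real.exp s * Real.exp s := by rw [← Real.exp_add]; ring_nf
  have hE : Real.exp s ≤ Real.exp (2*s) := Real.exp_le_exp.mpr (by linarith)
  have hval : (p:ℝ) * (Real.log (p * |(b:ℝ)|) - Real.log ((p + q) * |(c:ℝ)|)) +
      q * (Real.log (|(b:ℝ)| * q) - Real.log (|(a:ℝ)| * (p + q)))
      = q * (Real.log q - Real.log W) := by rw [l1, l2]; ring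
  have hpos : 0 < q * (Real.log q - Real.log W) := mul_pos (by linarith) (by linarith)
  rw [hval, e2s] at L
  have L2 := L (mul_le_mul hpe hb hbR.le (by linarith)) (mul_le_mul hn hc hcR.le (by linarith))
    (mul_le_mul hb hqe (by linarith) (by linarith)) (mul_le_mul ha hn (by linarith) (by linarith))
    (by rw [abs_of_pos (by linarith)]; linarith) (by rw [abs_of_pos (by linarith)]; linarith)
    hpos.ne'
  rw [abs_of_pos hpos] at L2
  clear L
  -- lower bound for the logarithm
  set lam := Real.log q - Real.log W with hlam
  set ε := Real.exp (-(K * (2*s)^3) - s) with hε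
  have hs3 : 1 ≤ s ^ 3 := one_le_pow₀ hs
  have hss : s ≤ s ^ 3 := le_self_pow₀ hs (by norm_num)
  have hε0 : 0 < ε := Real.exp_pos _
  have hε1 : ε ≤ 1 := Real.exp_le_one_iff.mpr (by
    have : 0 ≤ K * (2*s)^3 := by positivity
    linarith)
  have hlamε : ε ≤ lam := by
    have e : ε * Real.exp s = Real.exp (-(K * (2*s)^3)) := by
      rw [hε, ← Real.exp_add]; ring_nf
    have lampos : 0 < lam := by linarith
    have : ε * Real.exp s ≤ Real.exp s * lam := by
      rw [e]; exact L2.trans (mul_le_mul_of_nonneg_right hqe lampos.le)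
    have h0 : 0 < Real.exp s := Real.exp_pos _
    rw [mul_comm] at this
    exact le_of_mul_le_mul_left this h0
  have hWq : W / q ≤ 1 - ε / 2 := by
    have e : W / q = Real.exp (-lam) := by
      rw [hlam, neg_sub, Real.exp_sub, Real.exp_log w0, Real.exp_log (by linarith)]
    rw [e]
    have h3 : Real.exp (-lam) ≤ Real.exp (-ε) := Real.exp_le_exp.mpr (by linarith)
    have h4 : Real.exp (-ε) ≤ 1 / (1 + ε) := by
      rw [Real.exp_neg, ← one_div]
      exact one_div_le_one_div_of_le (by linarith) (by linarith [Real.add_one_le_exp ε])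
    have h5 : 1 / (1 + ε) ≤ 1 - ε / 2 := by
      rw [div_le_iff₀ (by linarith)]
      have : 0 ≤ ε * (1 - ε) := mul_nonneg hε0.le (by linarith)
      linear_combination this / 2
    linarith
  have h6 : W ≤ q - q * (ε / 2) := by
    rw [div_le_iff₀ (by linarith)] at hWq; linarith
  have h7 : ε / 2 ≤ Real.exp s * Real.exp s * (1 - v) := by
    have a1 : (q:ℝ) * (ε/2) ≤ (p + q) * p * (1 - v) := by linarith
    have a2 : 1 * (ε/2) ≤ q * (ε/2) := mul_le_mul_of_nonneg_right hq' (by linarith)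
    have a3 : ((p:ℝ) + q) * p * (1 - v) ≤ Real.exp s * Real.exp s * (1 - v) :=
      mul_le_mul_of_nonneg_right (mul_le_mul hn hpe (by linarith) (by linarith)) (by linarith)
    linarith
  have h8 : z - x = z * (1 - v) := by rw [hxv]; ring
  have h9 : ε / 2 ≤ 2 * Real.exp s * Real.exp s * Real.exp s * (z - x) := by
    rw [h8]
    have b1 : 1 ≤ 2 * Real.exp s * z := by
      have : 2 * Real.exp s * x ≤ 2 * Real.exp s * z :=
        mul_le_mul_of_nonneg_left hxz.le (by positivity)
      linarith
    have b2 := mul_le_mul_of_nonneg_right b1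
      (show 0 ≤ Real.exp s * Real.exp s * (1 - v) by
        have : 0 ≤ 1 - v := by linarith
        positivity)
    linear_combination h7 + b2
  have h10 : ε ≤ Real.exp (2 + 3 * s) * (z - x) := by
    have e3 : Real.exp (2 + 3 * s) = Real.exp 1 * Real.exp 1 * (Real.exp s * Real.exp s * Real.exp s) := by
      rw [← Real.exp_add, ← Real.exp_add, ← Real.exp_add, ← Real.exp_add]; ring_nf
    have e1 : 2 ≤ Real.exp 1 := by linarith [Real.add_one_le_exp (1:ℝ)]
    have e4 : 4 ≤ Real.exp 1 * Real.exp 1 := by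
      have := mul_le_mul e1 e1 (by norm_num) (Real.exp_pos 1).le
      linarith
    rw [e3]
    have : 0 ≤ Real.exp s * Real.exp s * Real.exp s * (z - x) := by
      have : 0 ≤ z - x := by linarith
      positivity
    have e6 := mul_le_mul_of_nonneg_right e4 this
    have e7 : ε ≤ 4 * (Real.exp s * Real.exp s * Real.exp s * (z - x)) := by
      linear_combination 2 * h9
    refine e7.trans (e6.trans (le_of_eq ?_))
    ring
  have h11 : Real.exp (-((8 * K + 6) * s ^ 3)) ≤ z - x := by
    have e5 : Real.exp (-((8 * K + 6) * s ^ 3)) * Real.exp (2 + 3 * s) ≤ ε := by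
      rw [hε, ← Real.exp_add]
      apply Real.exp_le_exp.mpr
      have e8 : K * (2 * s) ^ 3 = 8 * (K * s ^ 3) := by ring
      rw [e8]
      linear_combination 2 * hs3 + 4 * hss
    have h0 : 0 < Real.exp (2 + 3 * s) := Real.exp_pos _
    have := e5.trans h10
    rw [mul_comm] at this
    exact le_of_mul_le_mul_left this h0
  linarith

/-- Root separation for real roots of trinomials (Theorem 2 of the paper). -/
theorem trinomial_real_root_separation :
    ∃ C : ℝ, 0 < C ∧
      ∀ (a b c : ℤ) (α β γ : ℕ) (f : Polynomial ℤ) (s : ℝ),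
        α < β → β < γ →
        f = Polynomial.C a * Polynomial.X ^ α + Polynomial.C b * Polynomial.X ^ β
              + Polynomial.C c * Polynomial.X ^ γ →
        f ≠ 0 →
        1 ≤ s →
        Real.log (max (max (max |(a : ℝ)| |(b : ℝ)|) |(c : ℝ)|)
            (max (max (α : ℝ) (β : ℝ)) (γ : ℝ))) ≤ s →
        ∀ x₁ x₂ : ℝ,
          Polynomial.aeval x₁ f = 0 → Polynomial.aeval x₂ f = 0 → x₁ ≠ x₂ →
          |x₁ - x₂| ≥ Real.exp (-C * s ^ 3) := by
  obtain ⟨K, hK, hpos⟩ := tri_pos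
  refine ⟨K + 2, by positivity, ?_⟩
  intro a b c α β γ f s hαβ hβγ hf hf0 hs hlog
  obtain ⟨p, rfl⟩ := Nat.exists_eq_add_of_lt hαβ
  obtain ⟨q, rfl⟩ := Nat.exists_eq_add_of_lt hβγ
  have hne : ¬ (a = 0 ∧ b = 0 ∧ c = 0) := by
    rintro ⟨rfl, rfl, rfl⟩
    exact hf0 (by rw [hf]; simp)
  have hM : max (max (max |(a : ℝ)| |(b : ℝ)|) |(c : ℝ)|)
      (max (max (α : ℝ) ((α + p + 1 : ℕ) : ℝ)) ((α + p + 1 + q + 1 : ℕ) : ℝ)) ≤ Real.exp s := by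
    refine (Real.log_le_iff_le_exp ?_).mp hlog
    refine lt_of_lt_of_le ?_ ((le_max_right _ _).trans (le_max_right _ _))
    exact_mod_cast Nat.succ_pos _
  obtain ⟨hM1, hM2⟩ := max_le_iff.mp hM
  obtain ⟨hM3, hc⟩ := max_le_iff.mp hM1
  obtain ⟨ha, hb⟩ := max_le_iff.mp hM3
  obtain ⟨-, hγ⟩ := max_le_iff.mp hM2
  have hn : ((p + 1 : ℕ) : ℝ) + ((q + 1 : ℕ):ℝ) ≤ Real.exp s := by
    refine le_trans ?_ hγ
    exact_mod_cast (by omega : (p + 1) + (q + 1) ≤ α + p + 1 + q + 1)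
  have hH : 1 ≤ Real.exp s := Real.one_le_exp (by linarith)
  have hs3 : 1 ≤ s ^ 3 := one_le_pow₀ hs
  have hss : s ≤ s ^ 3 := le_self_pow₀ hs (by norm_num)
  have hroot : ∀ x : ℝ, x ≠ 0 → Polynomial.aeval x f = 0 →
      (a:ℝ) + b * x ^ (p + 1) + c * x ^ ((p + 1) + (q + 1)) = 0 := by
    intro x hx h
    rw [hf] at h
    simp only [map_add, map_mul, map_pow, Polynomial.aeval_X, Polynomial.aeval_C,
      algebraMap_int_eq, eq_intCast, map_intCast] at h
    have : x ^ α * ((a:ℝ) + b * x ^ (p + 1) + c * x ^ ((p + 1) + (q + 1))) = 0 := by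
      rw [← h]; ring
    rcases mul_eq_zero.mp this with h | h
    · exact absurd h (pow_ne_zero _ hx)
    · exact h
  have hsmall : Real.exp (-(K + 2) * s ^ 3) * (2 * Real.exp s) ≤ 1 := by
    have e1 : 2 ≤ Real.exp 1 := by linarith [Real.add_one_le_exp (1:ℝ)]
    have e2 : Real.exp (-(K + 2) * s ^ 3) * (Real.exp 1 * Real.exp s) ≤ 1 := by
      rw [← Real.exp_add, ← Real.exp_add, Real.exp_le_one_iff]
      nlinarith [mul_pos hK (show 0 < s ^ 3 by linarith)]
    refine le_trans ?_ e2
    exact mul_le_mul_of_nonneg_left (mul_le_mul_of_nonneg_right e1 (Real.exp_pos _).le)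
      (Real.exp_pos _).le
  have hlow : ∀ x : ℝ, x ≠ 0 → Polynomial.aeval x f = 0 →
      Real.exp (-(K + 2) * s ^ 3) ≤ |x| := by
    intro x hx h
    have h1 := tri_root_lower a b c (p+1) (q+1) (by omega) (by omega) (Real.exp s) x hH hb hc hne hx
      (hroot x hx h)
    have h2 := hsmall.trans h1
    rw [mul_comm] at h2
    exact le_of_mul_le_mul_left h2 (by positivity)
  have hKK : Real.exp (-(K + 2) * s ^ 3) ≤ Real.exp (-(K * s ^ 3)) :=
    Real.exp_le_exp.mpr (by nlinarith)
  have sg : ∀ (k : ℕ) (t : ℤ), |(((-1) ^ k * t : ℤ) : ℝ)| = |(t:ℝ)| := by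
    intro k t; push_cast; rw [abs_mul, abs_pow]; simp
  have sgx : ∀ (k : ℕ) (t : ℤ) (x : ℝ), (((-1) ^ k * t : ℤ) : ℝ) * (-x) ^ k = t * x ^ k := by
    intro k t x
    push_cast
    rw [mul_comm ((-1:ℝ)^k), mul_assoc, ← mul_pow]; simp
  -- ordered version
  have main : ∀ x y : ℝ, Polynomial.aeval x f = 0 → Polynomial.aeval y f = 0 → x < y →
      Real.exp (-(K + 2) * s ^ 3) ≤ y - x := by
    intro x y hx hy hxy
    rcases lt_trichotomy x 0 with hx0 | hx0 | hx0
    · rcases lt_or_ge y 0 with hy0 | hy0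
      · refine hKK.trans ?_
        have h1 := hroot x hx0.ne hx
        have h2 := hroot y hy0.ne hy
        have := hpos a ((-1) ^ (p+1) * b) ((-1) ^ ((p+1)+(q+1)) * c) (p+1) (q+1) s (-y) (-x)
          (by omega) (by omega) hs ha (by rw [sg]; exact hb) (by rw [sg]; exact hc) hn
          (by
            rintro ⟨e1, e2, e3⟩
            refine hne ⟨e1, ?_, ?_⟩
            · simpa using e2
            · simpa using e3)
          (by linarith) (by linarith)
          (by rw [sgx, sgx]; exact h2) (by rw [sgx, sgx]; exact h1)
        linarith
      · have := hlow x hx0.ne hx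
        rw [abs_of_neg hx0] at this
        linarith
    · have := hlow y (by linarith) hy
      rw [abs_of_pos (by linarith)] at this
      linarith
    · exact hKK.trans (hpos a b c (p+1) (q+1) s x y (by omega) (by omega) hs ha hb hc hn hne hx0 hxy
        (hroot x hx0.ne' hx) (hroot y (hx0.trans hxy).ne' hy))
  intro x₁ x₂ h1 h2 hne'
  rcases lt_or_gt_of_ne hne' with h | h
  · rw [abs_sub_comm, abs_of_pos (by linarith)]
    exact main x₁ x₂ h1 h2 h
  · rw [abs_of_pos (by linarith)]
    exact main x₂ x₁ h2 h1 h
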